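/- (Two-sided ratio bound for the small ball function.) There exist constants K₂ > 0 and K₃ > 0 such that for all ε ∈ (0, 2/K₂) and all μ > ε/2: exp( −K₃ |μ−ε| / ε^{1+1/β} ) ≤ φ(μ)/φ(ε) ≤ exp( K₃ |μ−ε| / ε^{1+1/β} ). -/

import Mathlib

open MeasureTheory ProbabilityTheory Real Set Filter

/-- A process is a centered Gaussian process if every finite linear combination of its
values has a centered Gaussian distribution. -/
def IsCenteredGaussianProcess {Ω : Type*} [MeasurableSpace Ω] (P : Measure Ω)
    (X : ℝ → Ω → ℝ) : Prop :=
  ∀ (n : ℕ) (t : Fin n → ℝ) (c : Fin n → ℝ), ∃ v : NNReal,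
    P.map (fun ω => ∑ i, c i * X (t i) ω) = ProbabilityTheory.gaussianReal 0 v

/-- The covariance function of the generalized fractional Brownian motion:
`E[X s X t] = ∫_ℝ ((s−u)₊^α − (−u)₊^α)((t−u)₊^α − (−u)₊^α)|u|^{−γ} du`. -/
noncomputable def gfbmCov (α γ s t : ℝ) : ℝ :=
  ∫ u : ℝ, ((max (s - u) 0) ^ α - (max (-u) 0) ^ α) *
    ((max (t - u) 0) ^ α - (max (-u) 0) ^ α) * |u| ^ (-γ)

/-- `X` is a generalized fractional Brownian motion with parameters `(α, γ)` under `P`. -/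
def IsGFBM {Ω : Type*} [MeasurableSpace Ω] (P : Measure Ω) (α γ : ℝ)
    (X : ℝ → Ω → ℝ) : Prop :=
  IsCenteredGaussianProcess P X ∧
  (∀ ω, ContinuousOn (fun t => X t ω) (Set.Ici 0)) ∧
  (∀ ω, X 0 ω = 0) ∧
  (∀ s t : ℝ, 0 ≤ s → 0 ≤ t → ∫ ω, X s ω * X t ω ∂P = gfbmCov α γ s t)

/-- The fractional integral `Y(t) = (1/Γ(θ)) ∫₀^t (t−u)^{θ−1} X(u) du` of a process `X`. -/
noncomputable def fracInt {Ω : Type*} (θ : ℝ) (X : ℝ → Ω → ℝ) (t : ℝ) (ω : Ω) : ℝ :=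
  (Real.Gamma θ)⁻¹ * ∫ u in (0:ℝ)..t, (t - u) ^ (θ - 1) * X u ω

/-- The running maximum `M(t) = sup_{0 ≤ s ≤ t} |Y(s)|`. -/
noncomputable def runSup {Ω : Type*} (Y : ℝ → Ω → ℝ) (t : ℝ) (ω : Ω) : ℝ :=
  ⨆ s : Set.Icc (0:ℝ) t, |Y s.1 ω|

/-- The small ball function `φ(ε) = P(M(1) ≤ ε)`. -/
noncomputable def smallBall {Ω : Type*} [MeasurableSpace Ω] (P : Measure Ω)
    (Y : ℝ → Ω → ℝ) (ε : ℝ) : ℝ :=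
  (P {ω | runSup Y 1 ω ≤ ε}).toReal

section

open scoped ENNReal NNReal Topology

theorem volume_add_le_of_add_subset {A B C : Set ℝ} (hA : MeasurableSet A) (hB : MeasurableSet B)
    (hA' : A.Nonempty) (hB' : B.Nonempty) (h : ∀ x ∈ A, ∀ y ∈ B, x + y ∈ C) :
    volume A + volume B ≤ volume C := by
  rw [hA.measure_eq_iSup_isCompact, hB.measure_eq_iSup_isCompact]
  have key : ∀ K, K ⊆ A → IsCompact K → ∀ L, L ⊆ B → IsCompact L →
      volume K + volume L ≤ volume C := by
    intro K hK cK L hL cL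
    have tr : ∀ (x : ℝ) (S : Set ℝ), volume ((fun y => x + y) '' S) = volume S := by
      intro x S; simp
    rcases K.eq_empty_or_nonempty with rfl | nK
    · obtain ⟨x, hx⟩ := hA'
      rw [measure_empty, zero_add, ← tr x L]
      apply measure_mono
      rintro _ ⟨y, hy, rfl⟩
      exact h x hx y (hL hy)
    rcases L.eq_empty_or_nonempty with rfl | nL
    · obtain ⟨y, hy⟩ := hB'
      rw [measure_empty, add_zero, ← tr y K]
      apply measure_mono
      rintro _ ⟨x, hx, rfl⟩
      simpa [add_comm] using h x (hK hx) y hy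
    obtain ⟨x₀, hx₀, hx₀'⟩ := cK.exists_isGreatest nK
    obtain ⟨y₀, hy₀, hy₀'⟩ := cL.exists_isLeast nL
    rw [← tr y₀ K, ← tr x₀ L, ← measure_union₀]
    · apply measure_mono
      rintro _ (⟨x, hx, rfl⟩ | ⟨y, hy, rfl⟩)
      · simpa [add_comm] using h x (hK hx) y₀ (hL hy₀)
      · exact h x₀ (hK hx₀) y (hL hy)
    · exact (cL.image (by fun_prop)).measurableSet.nullMeasurableSet
    · refine measure_mono_null (t := {x₀ + y₀}) ?_ (by simp)
      rintro _ ⟨⟨x, hx, rfl⟩, ⟨y, hy, hxy⟩⟩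
      have h1 := hx₀' hx
      have h2 := hy₀' hy
      simp only [mem_singleton_iff] at *
      linarith
  simp only [iSup_and']
  exact ENNReal.biSup_add_biSup_le' ⟨∅, by simp⟩ ⟨∅, by simp⟩
    fun K hK L hL => key K hK.1 hK.2 L hL.1 hL.2

/-- The Prékopa–Leindler inequality as a property of a measure. -/
def PrekopaLeindler {E : Type*} [AddCommGroup E] [Module ℝ E] [MeasurableSpace E]
    (ν : Measure E) : Prop :=
  ∀ a b : ℝ, 0 < a → 0 < b → a + b = 1 → ∀ f g h : E → ℝ≥0∞,
    Measurable f → Measurable g → Measurable h →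
    (∀ x y, f x ^ a * g y ^ b ≤ h (a • x + b • y)) →
    (∫⁻ x, f x ∂ν) ^ a * (∫⁻ x, g x ∂ν) ^ b ≤ ∫⁻ x, h x ∂ν

theorem lintegral_prekopaLeindler_normalized {a b : ℝ} (ha : 0 < a) (hb : 0 < b)
    {f g h : ℝ → ℝ} (hf : Measurable f) (hg : Measurable g) (hh : Measurable h)
    (f0 : ∀ x, 0 ≤ f x) (g0 : ∀ x, 0 ≤ g x) (h0 : ∀ x, 0 ≤ h x)
    (f1 : ∀ x, f x ≤ 1) (g1 : ∀ x, g x ≤ 1)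
    (fs : ∀ t < 1, ∃ x, t < f x) (gs : ∀ t < 1, ∃ x, t < g x) (hab : a + b = 1)
    (H : ∀ x y, f x ^ a * g y ^ b ≤ h (a * x + b * y)) :
    ENNReal.ofReal a * (∫⁻ x, ENNReal.ofReal (f x)) +
      ENNReal.ofReal b * (∫⁻ x, ENNReal.ofReal (g x))
      ≤ ∫⁻ x, ENNReal.ofReal (h x) := by
  rw [lintegral_eq_lintegral_meas_lt _ (ae_of_all _ f0) hf.aemeasurable,
    lintegral_eq_lintegral_meas_lt _ (ae_of_all _ g0) hg.aemeasurable,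
    lintegral_eq_lintegral_meas_lt _ (ae_of_all _ h0) hh.aemeasurable]
  have mf : Measurable fun t => volume {x | t < f x} :=
    Antitone.measurable fun s t hst => measure_mono fun x hx => lt_of_le_of_lt hst hx
  have mg : Measurable fun t => volume {x | t < g x} :=
    Antitone.measurable fun s t hst => measure_mono fun x hx => lt_of_le_of_lt hst hx
  rw [← lintegral_const_mul _ mf, ← lintegral_const_mul _ mg,
    ← lintegral_add_left (mf.const_mul _)]
  refine setLIntegral_mono' measurableSet_Ioi fun t ht => ?_
  rcases lt_or_ge t 1 with h1 | h1
  · have sc : ∀ (c : ℝ), 0 < c → ∀ S : Set ℝ, ENNReal.ofReal c * volume S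
        = volume ((fun x => c * x) '' S) := by
      intro c hc S
      have := Measure.addHaar_smul volume c S
      simp only [Module.finrank_self, pow_one, abs_of_pos hc] at this
      rw [← this]; rfl
    have ms : ∀ (c : ℝ), 0 < c → ∀ S : Set ℝ, MeasurableSet S →
        MeasurableSet ((fun x => c * x) '' S) := fun c hc S hS =>
      (measurableEmbedding_mulLeft₀ hc.ne').measurableSet_image.2 hS
    rw [sc a ha, sc b hb]
    refine volume_add_le_of_add_subset (ms a ha _ (measurableSet_lt measurable_const hf))
      (ms b hb _ (measurableSet_lt measurable_const hg)) (Set.Nonempty.image _ (fs t h1))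
      (Set.Nonempty.image _ (gs t h1)) ?_
    rintro _ ⟨x, hx, rfl⟩ _ ⟨y, hy, rfl⟩
    refine lt_of_lt_of_le ?_ (H x y)
    have ht : 0 < t := ht
    calc t = t ^ a * t ^ b := by rw [← Real.rpow_add ht, hab, Real.rpow_one]
      _ < f x ^ a * g y ^ b := by
        have := Real.rpow_lt_rpow ht.le hx ha
        have := Real.rpow_lt_rpow ht.le hy hb
        have := Real.rpow_pos_of_pos ht a
        have := Real.rpow_pos_of_pos ht b
        gcongr
  · have e1 : {x | t < f x} = ∅ := by ext x; simpa using (f1 x).trans h1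
    have e2 : {x | t < g x} = ∅ := by ext x; simpa using (g1 x).trans h1
    simp [e1, e2]

theorem ENNReal.rpow_mul_rpow_le_weighted_add {a b : ℝ} (ha : 0 < a) (hb : 0 < b) (hab : a + b = 1)
    (x y : ℝ≥0∞) : x ^ a * y ^ b ≤ ENNReal.ofReal a * x + ENNReal.ofReal b * y := by
  rcases eq_or_ne x ∞ with rfl | hx
  · simp [ENNReal.mul_top, ha]
  rcases eq_or_ne y ∞ with rfl | hy
  · simp [ENNReal.mul_top, hb]
  lift x to ℝ≥0 using hx
  lift y to ℝ≥0 using hy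
  have := NNReal.geom_mean_le_arith_mean2_weighted ⟨a, ha.le⟩ ⟨b, hb.le⟩ x y
    (NNReal.eq hab)
  rw [← ENNReal.coe_rpow_of_nonneg _ ha.le, ← ENNReal.coe_rpow_of_nonneg _ hb.le,
    ENNReal.ofReal, ENNReal.ofReal, Real.toNNReal_of_nonneg ha.le, Real.toNNReal_of_nonneg hb.le]
  exact_mod_cast this

theorem prekopaLeindler_bounded {a b : ℝ} (ha : 0 < a) (hb : 0 < b) (hab : a + b = 1)
    {f g h : ℝ → ℝ≥0∞} (hf : Measurable f) (hg : Measurable g) (hh : Measurable h)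
    {N : ℝ≥0∞} (hN : N ≠ ∞) (fN : ∀ x, f x ≤ N) (gN : ∀ x, g x ≤ N)
    (H : ∀ x y, f x ^ a * g y ^ b ≤ h (a * x + b * y)) :
    (∫⁻ x, f x) ^ a * (∫⁻ x, g x) ^ b ≤ ∫⁻ x, h x := by
  set F := ⨆ x, f x with hF
  set G := ⨆ x, g x with hG
  have F1 : F ≠ ∞ := ne_top_of_le_ne_top hN (iSup_le fN)
  have G1 : G ≠ ∞ := ne_top_of_le_ne_top hN (iSup_le gN)
  rcases eq_or_ne F 0 with F0 | F0
  · have : ∀ x, f x = 0 := fun x => le_antisymm (F0 ▸ le_iSup f x) zero_le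
    simp [this, ha]
  rcases eq_or_ne G 0 with G0 | G0
  · have : ∀ x, g x = 0 := fun x => le_antisymm (G0 ▸ le_iSup g x) zero_le
    simp [this, hb]
  have le1 : ∀ x, f x / F ≤ 1 := fun x => ENNReal.div_le_of_le_mul (by simpa using le_iSup f x)
  have le2 : ∀ x, g x / G ≤ 1 := fun x => ENNReal.div_le_of_le_mul (by simpa using le_iSup g x)
  set c := F ^ a * G ^ b with hc
  have c1 : c ≠ ∞ := ENNReal.mul_ne_top (ENNReal.rpow_ne_top_of_nonneg ha.le F1)
    (ENNReal.rpow_ne_top_of_nonneg hb.le G1)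
  have c0 : c ≠ 0 := mul_ne_zero (by simp [ENNReal.rpow_eq_zero_iff, F0, F1])
    (by simp [ENNReal.rpow_eq_zero_iff, G0, G1])
  have top1 : ∀ x, f x / F ≠ ∞ := fun x => ne_top_of_le_ne_top ENNReal.one_ne_top (le1 x)
  have top2 : ∀ x, g x / G ≠ ∞ := fun x => ne_top_of_le_ne_top ENNReal.one_ne_top (le2 x)
  have top3 : ∀ x, min (h x / c) 1 ≠ ∞ := fun x =>
    ne_top_of_le_ne_top ENNReal.one_ne_top (min_le_right _ _)
  have sup : ∀ (u : ℝ → ℝ≥0∞) (U : ℝ≥0∞), U = ⨆ x, u x → U ≠ 0 → U ≠ ∞ →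
      (∀ x, u x / U ≠ ∞) → ∀ t : ℝ, t < 1 → ∃ x, t < (u x / U).toReal := by
    intro u U hU U0 U1 hu t ht
    rcases lt_or_ge t 0 with h0 | h0
    · exact ⟨0, h0.trans_le ENNReal.toReal_nonneg⟩
    have : ENNReal.ofReal t * U < ⨆ x, u x := by
      rw [← hU]
      conv_rhs => rw [← one_mul U]
      exact (ENNReal.mul_lt_mul_iff_left U0 U1).2 (by simpa using ht)
    obtain ⟨x, hx⟩ := lt_iSup_iff.1 this
    refine ⟨x, ?_⟩
    rw [← ENNReal.ofReal_lt_iff_lt_toReal h0 (hu x)]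
    exact (ENNReal.lt_div_iff_mul_lt (Or.inl U0) (Or.inl U1)).2 hx
  have main := lintegral_prekopaLeindler_normalized (f := fun x => (f x / F).toReal)
    (g := fun x => (g x / G).toReal) (h := fun x => (min (h x / c) 1).toReal) ha hb
    (by fun_prop) (by fun_prop) (by fun_prop) (fun _ => ENNReal.toReal_nonneg)
    (fun _ => ENNReal.toReal_nonneg) (fun _ => ENNReal.toReal_nonneg)
    (fun x => ENNReal.toReal_le_of_le_ofReal zero_le_one (by simpa using le1 x))
    (fun x => ENNReal.toReal_le_of_le_ofReal zero_le_one (by simpa using le2 x))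
    (sup f F hF F0 F1 top1) (sup g G hG G0 G1 top2) hab ?_
  · simp only [ENNReal.ofReal_toReal (top1 _), ENNReal.ofReal_toReal (top2 _),
      ENNReal.ofReal_toReal (top3 _)] at main
    have step := (ENNReal.rpow_mul_rpow_le_weighted_add ha hb hab _ _).trans main
    have e3 : ∫⁻ x, min (h x / c) 1 ≤ (∫⁻ x, h x) / c := by
      rw [ENNReal.div_eq_inv_mul, ← lintegral_const_mul _ hh]
      exact lintegral_mono fun x => (min_le_left _ _).trans (by rw [ENNReal.div_eq_inv_mul])
    have e1 : ∫⁻ x, f x / F = (∫⁻ x, f x) / F := by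
      simp only [ENNReal.div_eq_inv_mul]; rw [lintegral_const_mul _ hf]
    have e2 : ∫⁻ x, g x / G = (∫⁻ x, g x) / G := by
      simp only [ENNReal.div_eq_inv_mul]; rw [lintegral_const_mul _ hg]
    rw [e1, e2, ENNReal.div_rpow_of_nonneg _ _ ha.le, ENNReal.div_rpow_of_nonneg _ _ hb.le] at step
    have step := step.trans e3
    rw [ENNReal.le_div_iff_mul_le (Or.inl c0) (Or.inl c1)] at step
    refine le_trans (le_of_eq ?_) step
    have Fa0 : F ^ a ≠ 0 := by simp [ENNReal.rpow_eq_zero_iff, F0, F1]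
    have Gb0 : G ^ b ≠ 0 := by simp [ENNReal.rpow_eq_zero_iff, G0, G1]
    have Fa1 := ENNReal.rpow_ne_top_of_nonneg ha.le F1
    have Gb1 := ENNReal.rpow_ne_top_of_nonneg hb.le G1
    rw [hc, mul_mul_mul_comm, ENNReal.div_mul_cancel Fa0 Fa1, ENNReal.div_mul_cancel Gb0 Gb1]
  · intro x y
    simp only [ENNReal.toReal_rpow, ← ENNReal.toReal_mul]
    refine ENNReal.toReal_mono (top3 _) (le_min ?_ ?_)
    · rw [ENNReal.div_rpow_of_nonneg _ _ ha.le, ENNReal.div_rpow_of_nonneg _ _ hb.le,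
        ENNReal.le_div_iff_mul_le (Or.inl c0) (Or.inl c1)]
      have Fa0 : F ^ a ≠ 0 := by simp [ENNReal.rpow_eq_zero_iff, F0, F1]
      have Gb0 : G ^ b ≠ 0 := by simp [ENNReal.rpow_eq_zero_iff, G0, G1]
      have Fa1 := ENNReal.rpow_ne_top_of_nonneg ha.le F1
      have Gb1 := ENNReal.rpow_ne_top_of_nonneg hb.le G1
      rw [hc, mul_mul_mul_comm, ENNReal.div_mul_cancel Fa0 Fa1, ENNReal.div_mul_cancel Gb0 Gb1]
      exact H x y
    · calc (f x / F) ^ a * (g y / G) ^ b ≤ 1 ^ a * 1 ^ b := by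
            gcongr
            exacts [le1 x, le2 y]
        _ = 1 := by simp

theorem prekopaLeindler_volume : PrekopaLeindler (volume : Measure ℝ) := by
  intro a b ha hb hab f g h hf hg hh H
  have lim : ∀ u : ℝ → ℝ≥0∞, Measurable u →
      Tendsto (fun n : ℕ => ∫⁻ x, min (u x) n) atTop (𝓝 (∫⁻ x, u x)) := by
    intro u hu
    refine lintegral_tendsto_of_tendsto_of_monotone (fun n => by fun_prop) ?_ ?_
    · exact ae_of_all _ fun x m n hmn => min_le_min le_rfl (by exact_mod_cast hmn)
    · refine ae_of_all _ fun x => ?_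
      have : Tendsto (fun n : ℕ => min (u x) (n : ℝ≥0∞)) atTop (𝓝 (min (u x) ∞)) :=
        tendsto_const_nhds.min ENNReal.tendsto_nat_nhds_top
      simpa using this
  rcases eq_or_ne (∫⁻ x, f x) 0 with f0 | f0
  · simp [f0, ha]
  rcases eq_or_ne (∫⁻ x, g x) 0 with g0 | g0
  · simp [g0, hb]
  have L := ENNReal.Tendsto.mul ((lim f hf).ennrpow_const a) (Or.inl (by
    simp [ENNReal.rpow_eq_zero_iff, f0, ha, ha.not_gt])) ((lim g hg).ennrpow_const b) (Or.inl (by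
    simp [ENNReal.rpow_eq_zero_iff, g0, hb, hb.not_gt]))
  refine le_of_tendsto' L fun n => ?_
  refine prekopaLeindler_bounded ha hb hab (by fun_prop) (by fun_prop) hh (N := n)
    (ENNReal.natCast_ne_top n) (fun x => min_le_right _ _) (fun x => min_le_right _ _) ?_
  intro x y
  refine le_trans ?_ (H x y)
  gcongr <;> exact min_le_left _ _

section
variable {E F : Type*} [AddCommGroup E] [Module ℝ E] [MeasurableSpace E]
  [AddCommGroup F] [Module ℝ F] [MeasurableSpace F]

theorem PrekopaLeindler.prod {ν : Measure E} {ρ : Measure F} [SFinite ν] [SFinite ρ]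
    (hν : PrekopaLeindler ν) (hρ : PrekopaLeindler ρ) : PrekopaLeindler (ν.prod ρ) := by
  intro a b ha hb hab f g h hf hg hh H
  rw [lintegral_prod _ hf.aemeasurable, lintegral_prod _ hg.aemeasurable,
    lintegral_prod _ hh.aemeasurable]
  refine hν a b ha hb hab _ _ _ hf.lintegral_prod_right' hg.lintegral_prod_right'
    hh.lintegral_prod_right' fun x y => ?_
  exact hρ a b ha hb hab _ _ _ (by fun_prop) (by fun_prop) (by fun_prop)
    fun x' y' => H (x, x') (y, y')

theorem PrekopaLeindler.map {ν : Measure E} (hν : PrekopaLeindler ν) {T : E → F}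
    (mT : Measurable T) (hT : ∀ a b : ℝ, a + b = 1 → ∀ x y, T (a • x + b • y) = a • T x + b • T y) :
    PrekopaLeindler (ν.map T) := by
  intro a b ha hb hab f g h hf hg hh H
  rw [lintegral_map hf mT, lintegral_map hg mT, lintegral_map hh mT]
  refine hν a b ha hb hab _ _ _ (hf.comp mT) (hg.comp mT) (hh.comp mT) fun x y => ?_
  simpa [hT a b hab] using H (T x) (T y)

theorem PrekopaLeindler.withDensity {ν : Measure E} (hν : PrekopaLeindler ν) {p : E → ℝ≥0∞}
    (mp : Measurable p)
    (hp : ∀ a b : ℝ, 0 < a → 0 < b → a + b = 1 → ∀ x y, p x ^ a * p y ^ b ≤ p (a • x + b • y)) :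
    PrekopaLeindler (ν.withDensity p) := by
  intro a b ha hb hab f g h hf hg hh H
  rw [lintegral_withDensity_eq_lintegral_mul _ mp hf, lintegral_withDensity_eq_lintegral_mul _
    mp hg,
    lintegral_withDensity_eq_lintegral_mul _ mp hh]
  refine hν a b ha hb hab _ _ _ (mp.mul hf) (mp.mul hg) (mp.mul hh) fun x y => ?_
  simp only [Pi.mul_apply, ENNReal.mul_rpow_of_nonneg _ _ ha.le, ENNReal.mul_rpow_of_nonneg _
    _ hb.le]
  rw [mul_mul_mul_comm]
  exact mul_le_mul' (hp a b ha hb hab x y) (H x y)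
end

theorem prekopaLeindler_gaussianReal_one : PrekopaLeindler (gaussianReal 0 1) := by
  rw [gaussianReal_of_var_ne_zero 0 one_ne_zero]
  refine prekopaLeindler_volume.withDensity (measurable_gaussianPDF 0 1) ?_
  intro a b ha hb hab x y
  simp only [gaussianPDF]
  rw [ENNReal.ofReal_rpow_of_nonneg (gaussianPDFReal_nonneg _ _ _) ha.le,
    ENNReal.ofReal_rpow_of_nonneg (gaussianPDFReal_nonneg _ _ _) hb.le,
    ← ENNReal.ofReal_mul (by have := gaussianPDFReal_nonneg 0 1 x; positivity)]
  refine ENNReal.ofReal_le_ofReal ?_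
  simp only [gaussianPDFReal]
  have hs : 0 < (√(2 * π * ((1 : ℝ≥0) : ℝ)))⁻¹ := by positivity
  set s := (√(2 * π * ((1 : ℝ≥0) : ℝ)))⁻¹
  rw [Real.mul_rpow hs.le (exp_pos _).le, Real.mul_rpow hs.le (exp_pos _).le, mul_mul_mul_comm,
    ← Real.rpow_add hs, hab, Real.rpow_one, ← Real.exp_mul, ← Real.exp_mul, ← Real.exp_add]
  refine mul_le_mul_of_nonneg_left (Real.exp_le_exp.2 ?_) hs.le
  have : b = 1 - a := by linarith
  subst this
  simp only [smul_eq_mul, NNReal.coe_one, sub_zero, mul_one]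
  nlinarith [mul_nonneg (mul_nonneg ha.le hb.le) (sq_nonneg (x - y))]

theorem prekopaLeindler_pi_gaussianReal (n : ℕ) :
    PrekopaLeindler (Measure.pi fun _ : Fin n => gaussianReal 0 1) := by
  induction n with
  | zero =>
    intro a b ha hb hab f g h hf hg hh H
    have : ∀ u : (Fin 0 → ℝ) → ℝ≥0∞, ∫⁻ x, u x ∂(Measure.pi fun _ : Fin 0 => gaussianReal 0 1)
        = u 0 := by
      intro u
      have : u = fun _ => u 0 := by ext x; rw [Subsingleton.elim x 0]
      rw [this]; simp
    rw [this, this, this]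
    simpa using H 0 0
  | succ n ih =>
    have := (measurePreserving_piFinSuccAbove (fun _ : Fin (n + 1) => gaussianReal 0 1) 0).symm
    rw [← this.map_eq]
    refine (prekopaLeindler_gaussianReal_one.prod ih).map this.measurable ?_
    intro a b hab x y
    ext i
    refine Fin.cases ?_ (fun j => ?_) i <;> simp [MeasurableEquiv.piFinSuccAbove_symm_apply]

theorem prekopaLeindler_of_isGaussian {ι : Type*} [Fintype ι] (μ : Measure (EuclideanSpace ℝ ι))
    [IsGaussian μ] : PrekopaLeindler μ := by
  classical
  have std : PrekopaLeindler (stdGaussian (EuclideanSpace ℝ ι)) := by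
    refine (prekopaLeindler_pi_gaussianReal _).map (by fun_prop) ?_
    intro a b _ x y
    simp [add_smul, Finset.sum_add_distrib, Finset.smul_sum, smul_smul]
  have multi : ∀ (m : EuclideanSpace ℝ ι) (S : Matrix ι ι ℝ),
      PrekopaLeindler (multivariateGaussian m S) := by
    intro m S
    refine std.map (by fun_prop) ?_
    intro a b hab x y
    simp only [map_add, map_smul, smul_add]
    have : m = a • m + b • m := by rw [← add_smul, hab, one_smul]
    conv_lhs => rw [this]
    abel
  let e := EuclideanSpace.basisFun ι ℝ
  let S : Matrix ι ι ℝ := fun i j => covarianceBilin μ (e i) (e j)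
  have expand : ∀ x y : EuclideanSpace ℝ ι, covarianceBilin μ x y = x ⬝ᵥ S.mulVec y := by
    intro x y
    conv_lhs => rw [← e.sum_repr x, ← e.sum_repr y]
    simp only [S, e, dotProduct, Matrix.mulVec, Finset.mul_sum, mul_comm, mul_left_comm, map_sum,
      map_smul, sum_apply, smul_apply, smul_eq_mul,
      EuclideanSpace.basisFun_repr]
    rw [Finset.sum_comm]
  have hS : S.PosSemidef := by
    refine Matrix.PosSemidef.of_dotProduct_mulVec_nonneg ?_ ?_
    · ext i j
      simp only [S]
      exact covarianceBilin_comm _ _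
    · intro x
      have := covarianceBilin_self_nonneg (μ := μ) (WithLp.toLp 2 x)
      rw [expand] at this
      simpa using this
  have : μ = multivariateGaussian (μ[id]) S := by
    refine IsGaussian.ext (by simp) ?_
    ext x y
    rw [covarianceBilin_multivariateGaussian hS, expand]
  rw [this]
  exact multi _ _

section
variable {Ω : Type*} [MeasurableSpace Ω] {P : Measure Ω}

/-- All linear combinations of a finite family of random variables are centered Gaussian. -/
def IsCenteredGaussianFamily {ι : Type*} [Fintype ι] (P : Measure Ω) (V : ι → Ω → ℝ) : Prop :=
  ∀ c : ι → ℝ, ∃ v : ℝ≥0, P.map (fun ω => ∑ i, c i * V i ω) = gaussianReal 0 v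

namespace IsCenteredGaussianFamily
variable {ι : Type*} [Fintype ι] {V : ι → Ω → ℝ}

theorem linear (hV : IsCenteredGaussianFamily P V) {κ : Type*} [Fintype κ] (A : κ → ι → ℝ) :
    IsCenteredGaussianFamily P (fun k ω => ∑ i, A k i * V i ω) := by
  intro c
  obtain ⟨v, hv⟩ := hV (fun i => ∑ k, c k * A k i)
  refine ⟨v, ?_⟩
  rw [← hv]
  congr 1
  ext ω
  simp only [Finset.mul_sum, Finset.sum_mul, mul_assoc]
  rw [Finset.sum_comm]

theorem apply (hV : IsCenteredGaussianFamily P V) (i : ι) :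
    ∃ v : ℝ≥0, P.map (V i) = gaussianReal 0 v := by
  classical
  obtain ⟨v, hv⟩ := hV (Pi.single i 1)
  refine ⟨v, ?_⟩
  rw [← hv]
  congr 1
  ext ω
  simp [Pi.single_apply]

theorem aemeasurable (hV : IsCenteredGaussianFamily P V) (i : ι) : AEMeasurable (V i) P := by
  obtain ⟨v, hv⟩ := hV.apply i
  refine AEMeasurable.of_map_ne_zero ?_
  rw [hv]
  exact IsProbabilityMeasure.ne_zero _

theorem exists_map_dual (hV : IsCenteredGaussianFamily P V) (L : (ι → ℝ) →L[ℝ] ℝ) :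
    ∃ v : ℝ≥0, (P.map (fun ω i => V i ω)).map L = gaussianReal 0 v := by
  classical
  have mV : AEMeasurable (fun ω i => V i ω) P := aemeasurable_pi_lambda _ hV.aemeasurable
  obtain ⟨v, hv⟩ := hV (fun i => L (Pi.single i 1))
  refine ⟨v, ?_⟩
  rw [← hv, AEMeasurable.map_map_of_aemeasurable (by fun_prop) mV]
  congr 1
  ext ω
  have := L.toLinearMap.pi_apply_eq_sum_univ (fun i => V i ω)
  simp only [ContinuousLinearMap.coe_coe, smul_eq_mul] at this
  simp only [Function.comp_apply]
  rw [this]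
  refine Finset.sum_congr rfl fun i _ => ?_
  rw [mul_comm]
  congr 2
  ext j
  simp [Pi.single_apply, eq_comm]

theorem hasGaussianLaw (hV : IsCenteredGaussianFamily P V) :
    HasGaussianLaw (fun ω i => V i ω) P := by
  refine ⟨isGaussian_of_isGaussian_map fun L => ?_⟩
  obtain ⟨v, hv⟩ := hV.exists_map_dual L
  rw [hv]
  infer_instance

theorem prekopaLeindler (hV : IsCenteredGaussianFamily P V) :
    PrekopaLeindler (P.map (fun ω i => V i ω)) := by
  have h := hV.hasGaussianLaw.toLp_pi 2
  have := h.isGaussian_map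
  have := (prekopaLeindler_of_isGaussian (P.map (fun ω => WithLp.toLp 2 (fun i => V i ω)))).map
    (F := ι → ℝ) (T := WithLp.ofLp) (by fun_prop) (by intros; rfl)
  rw [AEMeasurable.map_map_of_aemeasurable (by fun_prop) h.aemeasurable] at this
  exact this

theorem map_neg (hV : IsCenteredGaussianFamily P V) :
    P.map (fun ω i => - V i ω) = P.map (fun ω i => V i ω) := by
  have mV : AEMeasurable (fun ω i => V i ω) P := aemeasurable_pi_lambda _ hV.aemeasurable
  have : (fun ω i => - V i ω) = Neg.neg ∘ (fun ω i => V i ω) := rfl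
  have hG := hV.hasGaussianLaw.isGaussian_map
  rw [this, ← AEMeasurable.map_map_of_aemeasurable (by fun_prop) mV]
  have := Measure.isProbabilityMeasure_map (μ := P.map (fun ω i => V i ω)) (f := Neg.neg)
    (by fun_prop)
  refine Measure.ext_of_charFunDual ?_
  ext L
  rw [charFunDual_eq_charFun_map_one, charFunDual_eq_charFun_map_one,
    Measure.map_map (by fun_prop) (by fun_prop)]
  have h2 : (L ∘ Neg.neg : (ι → ℝ) → ℝ) = Neg.neg ∘ L := by ext; simp
  obtain ⟨v, hv⟩ := hV.exists_map_dual L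
  rw [h2, ← Measure.map_map (by fun_prop) (by fun_prop), hv]
  have := gaussianReal_map_neg (μ := 0) (v := v)
  rw [show (Neg.neg : ℝ → ℝ) = fun x => -x from rfl, this, neg_zero]

theorem measure_rpow_mul_rpow_le (hV : IsCenteredGaussianFamily P V) {a b : ℝ} (ha : 0 < a)
    (hb : 0 < b) (hab : a + b = 1) {A B C : Set (ι → ℝ)} (hA : MeasurableSet A)
    (hB : MeasurableSet B) (hC : MeasurableSet C) (H : ∀ x ∈ A, ∀ y ∈ B, a • x + b • y ∈ C) :
    P.map (fun ω i => V i ω) A ^ a * P.map (fun ω i => V i ω) B ^ b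
      ≤ P.map (fun ω i => V i ω) C := by
  have := hV.prekopaLeindler a b ha hb hab (A.indicator 1) (B.indicator 1) (C.indicator 1)
    (measurable_one.indicator hA) (measurable_one.indicator hB) (measurable_one.indicator hC) ?_
  · simpa [lintegral_indicator_one, hA, hB, hC] using this
  · intro x y
    by_cases hx : x ∈ A
    · by_cases hy : y ∈ B
      · simp [hx, hy, H x hx y hy]
      · simp [hy, hb]
    · simp [hx, ha]

end IsCenteredGaussianFamily

end

theorem measure_mul_lintegral_le_setLIntegral {E : Type*} [MeasurableSpace E] {ν : Measure E}
    [IsProbabilityMeasure ν] {g : E → ℝ≥0∞} {S : Set E} (hS : MeasurableSet S)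
    (h : ∀ x ∈ S, ∀ y ∉ S, g y ≤ g x) : ν S * ∫⁻ x, g x ∂ν ≤ ∫⁻ x in S, g x ∂ν := by
  set m := ⨅ x ∈ S, g x
  have h1 : ∫⁻ x in Sᶜ, g x ∂ν ≤ m * ν Sᶜ := by
    rw [← setLIntegral_const]
    refine setLIntegral_mono measurable_const fun y hy => ?_
    exact le_iInf₂ fun x hx => h x hx y hy
  have h2 : m * ν S ≤ ∫⁻ x in S, g x ∂ν := by
    rw [← setLIntegral_const]
    exact setLIntegral_mono' hS fun x hx => iInf₂_le x hx
  calc ν S * ∫⁻ x, g x ∂ν = ν S * (∫⁻ x in S, g x ∂ν) + ν S * ∫⁻ x in Sᶜ, g x ∂ν := by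
        rw [← lintegral_add_compl g hS, mul_add]
    _ ≤ ν S * (∫⁻ x in S, g x ∂ν) + ν S * (m * ν Sᶜ) := by gcongr
    _ = ν S * (∫⁻ x in S, g x ∂ν) + ν Sᶜ * (m * ν S) := by ring
    _ ≤ ν S * (∫⁻ x in S, g x ∂ν) + ν Sᶜ * ∫⁻ x in S, g x ∂ν := by gcongr
    _ = ∫⁻ x in S, g x ∂ν := by
        rw [← add_mul, prob_add_prob_compl hS, one_mul]

section
variable {Ω : Type*} [MeasurableSpace Ω] {P : Measure Ω}

namespace IsCenteredGaussianFamily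
variable {ι : Type*} [Fintype ι] {V : ι → Ω → ℝ}

theorem sidak_step [IsProbabilityMeasure P] (hV : IsCenteredGaussianFamily P V) (c : ι → ℝ)
    (s : Finset ι) (j : ι) :
    P {ω | |V j ω| ≤ c j} * P {ω | ∀ i ∈ s, |V i ω| ≤ c i} ≤
      P {ω | |V j ω| ≤ c j ∧ ∀ i ∈ s, |V i ω| ≤ c i} := by
  classical
  have hL2 : ∀ i, MemLp (V i) 2 P := fun i => (hV.hasGaussianLaw.eval i).memLp_two
  obtain ⟨a, ha⟩ : ∃ a : ι → ℝ, ∀ i, cov[fun ω => V i ω - a i * V j ω, V j; P] = 0 := by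
    refine ⟨fun i => cov[V i, V j; P] / cov[V j, V j; P], fun i => ?_⟩
    rw [covariance_fun_sub_left (hL2 i) ((hL2 j).const_mul _) (hL2 j), covariance_const_mul_left]
    by_cases h0 : cov[V j, V j; P] = 0
    · have h1 : V j =ᵐ[P] fun _ => P[V j] := by
        rw [covariance_self (hL2 j).aemeasurable] at h0
        exact ae_eq_integral_of_variance_eq_zero (hL2 j) h0
      have h2 : cov[V i, V j; P] = 0 := by
        rw [covariance]
        refine integral_eq_zero_of_ae ?_
        filter_upwards [h1] with ω h
        simp [h]
      simp [h2]
    · field_simp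
      ring
  let W : ι → Ω → ℝ := fun i ω => V i ω - a i * V j ω
  have hW : IsCenteredGaussianFamily P W := by
    have := hV.linear (fun k i => (if i = k then (1:ℝ) else 0) - a k * (if i = j then (1:ℝ) else 0))
    convert this using 2 with k
    ext ω
    simp [W, sub_mul, Finset.sum_sub_distrib]
  have hind : IndepFun (fun ω i => W i ω) (V j) P := by
    let L : (ι → ℝ) →L[ℝ] ((ι → ℝ) × (Unit → ℝ)) :=
      (ContinuousLinearMap.pi fun i => ContinuousLinearMap.proj i - a i •
        ContinuousLinearMap.proj j).prod
        (ContinuousLinearMap.pi fun _ => ContinuousLinearMap.proj j)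
    have h1 := hV.hasGaussianLaw.map L
    have h2 := HasGaussianLaw.indepFun_of_covariance_eval (X := W) (Y := fun _ : Unit => V j)
      (P := P) h1 (fun i _ => ha i)
    exact h2.comp measurable_id (measurable_pi_apply ())
  have mW : AEMeasurable (fun ω i => W i ω) P := aemeasurable_pi_lambda _ hW.aemeasurable
  have mV := hV.aemeasurable j
  have hprod := (indepFun_iff_map_prod_eq_prod_map_map mW mV).1 hind
  set ρ := P.map (fun ω i => W i ω) with hρ
  set ν := P.map (V j) with hν
  have : IsProbabilityMeasure ρ := Measure.isProbabilityMeasure_map mW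
  have : IsProbabilityMeasure ν := Measure.isProbabilityMeasure_map mV
  let D : Set ((ι → ℝ) × ℝ) := {p | ∀ i ∈ s, |p.1 i + a i * p.2| ≤ c i}
  have mD : MeasurableSet D := by
    have : D = ⋂ i ∈ s, {p | |p.1 i + a i * p.2| ≤ c i} := by ext; simp [D]
    rw [this]
    refine Finset.measurableSet_biInter _ fun i _ => measurableSet_le (by fun_prop) (by fun_prop)
  let S : Set ℝ := {x | |x| ≤ c j}
  have mS : MeasurableSet S := measurableSet_le (by fun_prop) (by fun_prop)
  let g : ℝ → ℝ≥0∞ := fun x => ρ ((fun w => (w, x)) ⁻¹' D)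
  have mg : ∀ x, MeasurableSet ((fun w : ι → ℝ => (w, x)) ⁻¹' D) := fun x =>
    mD.preimage (by fun_prop)
  have e1 : P {ω | |V j ω| ≤ c j} = ν S := by
    rw [hν, Measure.map_apply_of_aemeasurable mV mS]; rfl
  have e2 : P {ω | ∀ i ∈ s, |V i ω| ≤ c i} = ∫⁻ x, g x ∂ν := by
    rw [← Measure.prod_apply_symm mD, ← hprod,
      Measure.map_apply_of_aemeasurable (mW.prodMk mV) mD]
    simp [D, W]
  have e3 : P {ω | |V j ω| ≤ c j ∧ ∀ i ∈ s, |V i ω| ≤ c i} = ∫⁻ x in S, g x ∂ν := by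
    have : ∫⁻ x in S, g x ∂ν = (ρ.prod ν) (D ∩ Prod.snd ⁻¹' S) := by
      rw [Measure.prod_apply_symm (mD.inter (mS.preimage measurable_snd)),
        ← lintegral_indicator mS]
      refine lintegral_congr fun x => ?_
      by_cases hx : x ∈ S
      · simp only [hx, indicator_of_mem, g]
        congr 1
        ext w
        simp [hx]
      · have : (fun w : ι → ℝ => (w, x)) ⁻¹' (D ∩ Prod.snd ⁻¹' S) = ∅ := by
          ext w
          simp [hx]
        simp [hx, this]
    rw [this, ← hprod, Measure.map_apply_of_aemeasurable (mW.prodMk mV)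
      (mD.inter (mS.preimage measurable_snd))]
    congr 1
    ext ω
    simp [D, W, S, and_comm]
  rw [e1, e2, e3]
  refine measure_mul_lintegral_le_setLIntegral mS fun x hx y hy => ?_
  have hxy : |x| ≤ |y| := by
    simp only [S, mem_ofPred_eq, not_le] at hx hy
    exact hx.trans hy.le
  have g_neg : ∀ x, g (-x) = g x := by
    intro x
    have h1 : ρ = P.map (fun ω i => - W i ω) := hW.map_neg.symm
    have mW' : AEMeasurable (fun ω i => - W i ω) P := mW.neg
    show ρ _ = ρ _
    conv_lhs => rw [h1]
    rw [Measure.map_apply_of_aemeasurable mW' (mg _), hρ,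
      Measure.map_apply_of_aemeasurable mW (mg _)]
    congr 1
    ext ω
    simp only [D, mem_preimage, mem_ofPred_eq]
    refine forall₂_congr fun i _ => ?_
    rw [← abs_neg]
    ring_nf
  rcases eq_or_ne |x| |y| with h | h
  · rcases abs_eq_abs.1 h with rfl | rfl
    · exact le_rfl
    · rw [g_neg]
  have hlt := lt_of_le_of_ne hxy h
  wlog hy0 : 0 < y generalizing y
  · have h3 : y < 0 := by
      rcases lt_or_ge y 0 with h | h
      · exact h
      · have : y = 0 := le_antisymm (not_lt.1 hy0) h
        simp [this] at hlt
        exact absurd hlt (not_lt.2 (abs_nonneg _))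
    have := this (-y) (by simpa [S] using hy) (by simpa using hxy) (by simpa using h)
      (by simpa using hlt) (by linarith)
    rwa [g_neg] at this
  rw [abs_of_pos hy0, abs_lt] at hlt
  have hl := hW.measure_rpow_mul_rpow_le (a := (1 + x / y) / 2) (b := (1 - x / y) / 2)
    (by have : -1 < x / y := by rw [lt_div_iff₀ hy0]; linarith
        linarith)
    (by have : x / y < 1 := by rw [div_lt_iff₀ hy0]; linarith
        linarith) (by ring) (mg y) (mg (-y)) (mg x) ?_
  · change g y ^ _ * g (-y) ^ _ ≤ g x at hl
    rw [g_neg, ← ENNReal.rpow_add_of_nonneg] at hl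
    · rwa [show (1 + x / y) / 2 + (1 - x / y) / 2 = 1 by ring, ENNReal.rpow_one] at hl
    · have : -1 < x / y := by rw [lt_div_iff₀ hy0]; linarith
      linarith
    · have : x / y < 1 := by rw [div_lt_iff₀ hy0]; linarith
      linarith
  · intro w hw w' hw' i hi
    have h1 := hw i hi
    have h2 := hw' i hi
    have p1 : 0 ≤ (1 + x / y) / 2 := by
      have : -1 < x / y := by rw [lt_div_iff₀ hy0]; linarith
      linarith
    have p2 : 0 ≤ (1 - x / y) / 2 := by
      have : x / y < 1 := by rw [div_lt_iff₀ hy0]; linarith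
      linarith
    have e : (((1 + x / y) / 2) • w + ((1 - x / y) / 2) • w') i + a i * x =
        (1 + x / y) / 2 * (w i + a i * y) + (1 - x / y) / 2 * (w' i + a i * (-y)) := by
      simp
      field_simp
      ring
    simp only at h1 h2 ⊢
    rw [e, abs_le]
    rw [abs_le] at h1 h2
    constructor <;> nlinarith [h1.1, h1.2, h2.1, h2.2]

theorem sidak [IsProbabilityMeasure P] (hV : IsCenteredGaussianFamily P V) (c : ι → ℝ)
    (s : Finset ι) :
    ∏ i ∈ s, P {ω | |V i ω| ≤ c i} ≤ P {ω | ∀ i ∈ s, |V i ω| ≤ c i} := by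
  classical
  induction s using Finset.induction_on with
  | empty => simp
  | insert j s hj ih =>
    rw [Finset.prod_insert hj]
    refine (mul_le_mul_right ih _).trans ((hV.sidak_step c s j).trans_eq ?_)
    simp

theorem measure_abs_le_rpow_mul_le [IsProbabilityMeasure P] (hV : IsCenteredGaussianFamily P V)
    {a b : ℝ} (ha : 0 < a) (hb : 0 < b) (hab : a + b = 1) (r s : ℝ) :
    P {ω | ∀ i, |V i ω| ≤ r} ^ a * P {ω | ∀ i, |V i ω| ≤ s} ^ b ≤
      P {ω | ∀ i, |V i ω| ≤ a * r + b * s} := by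
  have mV : AEMeasurable (fun ω i => V i ω) P := aemeasurable_pi_lambda _ hV.aemeasurable
  have mD : ∀ r : ℝ, MeasurableSet {w : ι → ℝ | ∀ i, |w i| ≤ r} := by
    intro r
    rw [ Set.ofPred_forall]
    exact MeasurableSet.iInter fun i => measurableSet_le (by fun_prop) (by fun_prop)
  have h := hV.measure_rpow_mul_rpow_le ha hb hab (mD r) (mD s) (mD (a * r + b * s)) ?_
  · simpa only [Measure.map_apply_of_aemeasurable mV (mD _), preimage_ofPred_eq] using h
  · intro x hx y hy i
    calc |(a • x + b • y) i| ≤ |a * x i| + |b * y i| := abs_add_le _ _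
      _ = a * |x i| + b * |y i| := by rw [abs_mul, abs_mul, abs_of_pos ha, abs_of_pos hb]
      _ ≤ a * r + b * s := by
        have := hx i
        have := hy i
        gcongr

end IsCenteredGaussianFamily

end

theorem exists_exp_le_gaussianReal_one {p : ℝ} (hp : 0 < p) :
    ∃ C : ℝ, 0 < C ∧ ∀ r : ℝ, 0 < r →
      rexp (-C * (1 / r) ^ p) ≤ (gaussianReal 0 1).real {x | |x| ≤ r} := by
  set μ := gaussianReal 0 1 with hμ
  have mS : ∀ r : ℝ, MeasurableSet {x : ℝ | |x| ≤ r} := fun r =>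
    measurableSet_le (by fun_prop) (by fun_prop)
  obtain ⟨c, hc, hc'⟩ : ∃ c : ℝ, 0 < c ∧ ∀ r : ℝ, 0 < r → r ≤ 1 → c * r ≤ μ.real {x | |x| ≤ r} := by
    refine ⟨2 * gaussianPDFReal 0 1 1, by have := gaussianPDFReal_pos 0 1 1 one_ne_zero; positivity,
      fun r hr hr1 => ?_⟩
    have h0 := gaussianPDFReal_nonneg 0 1 1
    rw [measureReal_def, ← ENNReal.ofReal_le_iff_le_toReal (measure_ne_top _ _), hμ,
      gaussianReal_apply _ one_ne_zero]
    calc ENNReal.ofReal (2 * gaussianPDFReal 0 1 1 * r)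
        = ∫⁻ x in {x : ℝ | |x| ≤ r}, gaussianPDF 0 1 1 := by
          have : {x : ℝ | |x| ≤ r} = Icc (-r) r := by ext; simp [abs_le]
          rw [setLIntegral_const, this, Real.volume_Icc, gaussianPDF, ← ENNReal.ofReal_mul h0]
          ring_nf
      _ ≤ ∫⁻ x in {x : ℝ | |x| ≤ r}, gaussianPDF 0 1 x := by
          refine setLIntegral_mono' (mS r) fun x hx => ?_
          simp only [gaussianPDF, gaussianPDFReal]
          gcongr ENNReal.ofReal (_ * rexp ?_)
          have : x ^ 2 ≤ 1 := (sq_le_one_iff_abs_le_one x).2 (le_trans hx hr1)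
          norm_num
          linarith
  have hM : Integrable (fun x => |x| ^ p) μ := by
    have h1 := memLp_id_gaussianReal (μ := 0) (v := 1) p.toNNReal
    have := h1.integrable_norm_rpow (by simpa using hp) ENNReal.coe_ne_top
    simpa [hp.le] using this
  set M := ∫ x, |x| ^ p ∂μ
  have hM0 : 0 ≤ M := integral_nonneg fun x => by positivity
  refine ⟨(1 / c) ^ p / p + M / c, by positivity, fun r hr => ?_⟩
  have hrp : 0 < (1 / r) ^ p := by positivity
  rcases le_total r 1 with h1 | h1
  · refine le_trans ?_ (hc' r hr h1)
    rw [← Real.le_log_iff_exp_le (by positivity)]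
    have h2 := Real.log_le_rpow_div (x := 1 / (c * r)) (by positivity) hp
    rw [one_div, Real.log_inv, mul_inv, ← one_div, ← one_div, mul_comm (1 / c),
      Real.mul_rpow (by positivity) (by positivity)] at h2
    have : 0 ≤ M / c * (1 / r) ^ p := by positivity
    have e : (1 / r) ^ p * (1 / c) ^ p / p = (1 / c) ^ p / p * (1 / r) ^ p := by ring
    nlinarith
  · have hq1 : c ≤ μ.real {x | |x| ≤ r} := by
      refine (by simpa using hc' 1 one_pos le_rfl : c ≤ _).trans ?_
      exact measureReal_mono fun x hx => le_trans hx h1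
    set q := μ.real {x | |x| ≤ r}
    have hq : 0 < q := hc.trans_le hq1
    have hmk : 1 - q ≤ M * (1 / r) ^ p := by
      have h2 : 1 - q = μ.real {x | |x| ≤ r}ᶜ := (probReal_compl_eq_one_sub (mS r)).symm
      have h3 := mul_meas_ge_le_integral_of_nonneg (μ := μ) (f := fun x => |x| ^ p)
        (ae_of_all _ fun x => by positivity) hM (r ^ p)
      have h4 : μ.real {x | |x| ≤ r}ᶜ ≤ μ.real {x | r ^ p ≤ |x| ^ p} := by
        refine measureReal_mono fun x hx => ?_
        simp only [mem_compl_iff, mem_ofPred_eq, not_le] at hx ⊢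
        exact Real.rpow_le_rpow hr.le hx.le hp.le
      rw [one_div, Real.inv_rpow hr.le, ← div_eq_mul_inv, le_div_iff₀ (by positivity), h2, mul_comm]
      exact (mul_le_mul_of_nonneg_left h4 (by positivity)).trans h3
    rw [← Real.le_log_iff_exp_le hq]
    have h5 := Real.one_sub_inv_le_log_of_pos hq
    have h6 : 1 - q⁻¹ = -((1 - q) / q) := by field_simp; ring
    have h7 : (1 - q) / q ≤ M * (1 / r) ^ p / c := by gcongr
    have h8 : 0 ≤ (1 / c) ^ p / p * (1 / r) ^ p := by positivity
    have h9 : M * (1 / r) ^ p / c = M / c * (1 / r) ^ p := by ring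
    nlinarith

theorem exists_exp_le_gaussianReal {p : ℝ} (hp : 0 < p) :
    ∃ C : ℝ, 0 < C ∧ ∀ (v : ℝ≥0) (r s : ℝ), 0 < r → 0 < s → (v : ℝ) ≤ s ^ 2 →
      ENNReal.ofReal (rexp (-C * (s / r) ^ p)) ≤ gaussianReal 0 v {x | |x| ≤ r} := by
  obtain ⟨C, hC, h⟩ := exists_exp_le_gaussianReal_one hp
  refine ⟨C, hC, fun v r s hr hs hv => ?_⟩
  have h1 := h (r / s) (by positivity)
  rw [one_div_div] at h1
  have h2 : gaussianReal 0 v = (gaussianReal 0 1).map (√v * ·) := by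
    rw [gaussianReal_map_const_mul]
    congr 1
    · simp
    · ext; simp
  rw [h2, Measure.map_apply (by fun_prop) (measurableSet_le (by fun_prop) (by fun_prop))]
  refine (ENNReal.ofReal_le_ofReal h1).trans ?_
  rw [ofReal_measureReal]
  refine measure_mono fun x hx => ?_
  simp only [mem_ofPred_eq, preimage_ofPred_eq] at hx ⊢
  rw [abs_mul, abs_of_nonneg (Real.sqrt_nonneg _)]
  have h3 : √(v : ℝ) ≤ s := Real.sqrt_le_iff.2 ⟨hs.le, hv⟩
  calc √(v : ℝ) * |x| ≤ s * (r / s) := by gcongr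
    _ = r := by field_simp

/-- Equispaced nodes in `[0, 1)`. -/
noncomputable def refNode (m : ℕ) (i : Fin (m + 1)) : ℝ := (i : ℝ) / (m + 1)

/-- The Lagrange basis polynomials of the equispaced nodes, as functions. -/
noncomputable def refBasis (m : ℕ) (i : Fin (m + 1)) (s : ℝ) : ℝ :=
  (Lagrange.basis Finset.univ (refNode m) i).eval s

theorem refNode_injective (m : ℕ) : Function.Injective (refNode m) := by
  intro i j h
  have : (m + 1 : ℝ) ≠ 0 := by positivity
  simp only [refNode] at h
  field_simp at h
  exact Fin.ext (by exact_mod_cast h)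

theorem refNode_mem (m : ℕ) (i : Fin (m + 1)) : refNode m i ∈ Icc (0 : ℝ) 1 := by
  refine ⟨by unfold refNode; positivity, ?_⟩
  rw [refNode, div_le_one (by positivity)]
  have := i.2
  exact_mod_cast this.le

theorem sum_eval_mul_refBasis (m : ℕ) (q : Polynomial ℝ) (hq : q.natDegree ≤ m) (s : ℝ) :
    ∑ i, q.eval (refNode m i) * refBasis m i s = q.eval s := by
  have h := Lagrange.eq_interpolate (s := Finset.univ) (v := refNode m) (f := q)
    (refNode_injective m).injOn (by
      rw [Finset.card_univ, Fintype.card_fin]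
      exact Polynomial.degree_le_natDegree.trans_lt (by exact_mod_cast Nat.lt_succ_of_le hq))
  conv_rhs => rw [h]
  simp [Lagrange.interpolate_apply, Polynomial.eval_finsetSum, refBasis]

theorem sum_mul_refBasis_zero (m : ℕ) (a : Fin (m + 1) → ℝ) : ∑ i, a i * refBasis m i 0 = a 0 := by
  have h0 : refNode m 0 = 0 := by simp [refNode]
  rw [Finset.sum_eq_single 0]
  · have := Lagrange.eval_basis_self (refNode_injective m).injOn (Finset.mem_univ (0 : Fin (m + 1)))
    rw [h0] at this
    rw [refBasis, this, mul_one]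
  · intro i _ hi
    have := Lagrange.eval_basis_of_ne (v := refNode m) hi (Finset.mem_univ (0 : Fin (m + 1)))
    rw [h0] at this
    rw [refBasis, this, mul_zero]
  · simp

theorem exists_abs_refBasis_le (m : ℕ) :
    ∃ L : ℝ, 0 < L ∧ ∀ i, ∀ s ∈ Icc (0 : ℝ) 1, |refBasis m i s| ≤ L := by
  have : ∀ i, ∃ L : ℝ, ∀ s ∈ Icc (0 : ℝ) 1, |refBasis m i s| ≤ L := by
    intro i
    exact isCompact_Icc.exists_bound_of_continuousOn
      ((Lagrange.basis Finset.univ (refNode m) i).continuous.continuousOn)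
  choose L hL using this
  refine ⟨∑ i, |L i| + 1, by positivity, fun i s hs => (hL i s hs).trans ?_⟩
  have := Finset.single_le_sum (f := fun i => |L i|) (fun i _ => abs_nonneg _) (Finset.mem_univ i)
  have h2 := le_abs_self (L i)
  linarith

/-- The position, relative to a dyadic cell, of the `i`-th node of its left or right half. -/
noncomputable def childNode (m : ℕ) (b : Fin 2) (i : Fin (m + 1)) : ℝ := ((b : ℝ) + refNode m i) / 2

/-- The error of polynomial interpolation of `f` on the `k`-th dyadic cell of level `n`,
measured at the nodes of the two halves of the cell. -/
noncomputable def refineErr (m : ℕ) (f : ℝ → ℝ) (n k : ℕ) (b : Fin 2) (i : Fin (m + 1)) : ℝ :=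
  f ((k + childNode m b i) / 2 ^ n) -
    ∑ j, refBasis m j (childNode m b i) * f ((k + refNode m j) / 2 ^ n)

theorem childNode_mem (m : ℕ) (b : Fin 2) (i : Fin (m + 1)) : childNode m b i ∈ Icc (0 : ℝ) 1 := by
  have h := refNode_mem m i
  have hb : (b : ℝ) ≤ 1 := by exact_mod_cast Nat.lt_succ_iff.1 b.2
  have hb0 : (0 : ℝ) ≤ b := by positivity
  constructor
  · have := h.1; unfold childNode; positivity
  · have := h.2; unfold childNode; linarith

/-- Multiscale bound: small interpolation errors at all levels force small dyadic values. -/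
theorem abs_le_of_refineErr_le {m : ℕ} {L : ℝ}
    (hL : ∀ i, ∀ s ∈ Icc (0 : ℝ) 1, |refBasis m i s| ≤ L) (f : ℝ → ℝ) (δ : ℝ) (e : ℕ → ℝ) (N : ℕ)
    (h0 : ∀ i, |f (refNode m i)| ≤ δ)
    (he : ∀ n < N, ∀ k < 2 ^ n, ∀ b i, |refineErr m f n k b i| ≤ e n) :
    ∀ k : ℕ, k < 2 ^ N → |f (k / 2 ^ N)| ≤ (m + 1) * L * (δ + ∑ n ∈ Finset.range N, e n) := by
  have sum_le : ∀ (a : Fin (m + 1) → ℝ) (d s : ℝ), (∀ i, |a i| ≤ d) → s ∈ Icc (0 : ℝ) 1 →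
      |∑ i, a i * refBasis m i s| ≤ (m + 1) * L * d := by
    intro a d s ha hs
    calc |∑ i, a i * refBasis m i s| ≤ ∑ i, |a i * refBasis m i s| := Finset.abs_sum_le_sum_abs _ _
      _ ≤ ∑ _i : Fin (m + 1), d * L := by
          refine Finset.sum_le_sum fun i _ => ?_
          rw [abs_mul]
          exact mul_le_mul (ha i) (hL i s hs) (abs_nonneg _) ((abs_nonneg _).trans (ha i))
      _ = (m + 1) * L * d := by simp; ring
  have main : ∀ M ≤ N, ∀ k : ℕ, k < 2 ^ M → ∀ s ∈ Icc (0 : ℝ) 1,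
      |∑ i, f ((k + refNode m i) / 2 ^ M) * refBasis m i s| ≤
        (m + 1) * L * (δ + ∑ n ∈ Finset.range M, e n) := by
    intro M
    induction M with
    | zero =>
      intro _ k hk s hs
      have : k = 0 := by simpa using hk
      subst this
      refine (sum_le _ δ s (fun i => ?_) hs).trans_eq (by simp)
      simpa using h0 i
    | succ M ih =>
      intro hM k hk s hs
      obtain ⟨k', b, rfl⟩ : ∃ (k' : ℕ) (b : Fin 2), k = 2 * k' + b :=
        ⟨k / 2, ⟨k % 2, Nat.mod_lt _ (by norm_num)⟩, by simp; omega⟩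
      have hk' : k' < 2 ^ M := by rw [pow_succ] at hk; omega
      have hb : (b : ℝ) ≤ 1 := by exact_mod_cast Nat.lt_succ_iff.1 b.2
      have hb0 : (0 : ℝ) ≤ b := by positivity
      have hs' : (b + s) / 2 ∈ Icc (0 : ℝ) 1 := by
        have := hs.1
        have := hs.2
        constructor
        · positivity
        · linarith
      let q : Polynomial ℝ := ∑ j, Polynomial.C (f ((k' + refNode m j) / 2 ^ M)) *
        (Lagrange.basis Finset.univ (refNode m) j).comp
          (Polynomial.C ((b : ℝ) / 2) + Polynomial.C (1 / 2) * Polynomial.X)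
      have hqe : ∀ x, q.eval x = ∑ j, f ((k' + refNode m j) / 2 ^ M) * refBasis m j
        ((b + x) / 2) := by
        intro x
        simp only [q, Polynomial.eval_finsetSum, Polynomial.eval_mul, Polynomial.eval_C,
          Polynomial.eval_comp, Polynomial.eval_add, Polynomial.eval_X, refBasis]
        rw [show (b : ℝ) / 2 + 1 / 2 * x = (b + x) / 2 by ring]
      have hqd : q.natDegree ≤ m := by
        refine Polynomial.natDegree_sum_le_of_forall_le _ _ fun j _ => ?_
        refine (Polynomial.natDegree_C_mul_le _ _).trans ?_
        refine Polynomial.natDegree_comp_le.trans ?_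
        have h1 : (Lagrange.basis Finset.univ (refNode m) j).natDegree = m := by
          refine Polynomial.natDegree_eq_of_degree_eq_some ?_
          rw [Lagrange.degree_basis (refNode_injective m).injOn (Finset.mem_univ _)]
          simp
        have h2 : (Polynomial.C ((b : ℝ) / 2) + Polynomial.C (1 / 2) * Polynomial.X).natDegree
          ≤ 1 := by
          compute_degree
        rw [h1]
        nlinarith
      have key : ∑ i, f (((2 * k' + b : ℕ) + refNode m i) / 2 ^ (M + 1)) * refBasis m i s =
          ∑ j, f ((k' + refNode m j) / 2 ^ M) * refBasis m j ((b + s) / 2) +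
            ∑ i, refineErr m f M k' b i * refBasis m i s := by
        rw [← hqe, ← sum_eval_mul_refBasis m q hqd s, ← Finset.sum_add_distrib]
        refine Finset.sum_congr rfl fun i _ => ?_
        rw [← add_mul, hqe, refineErr]
        congr 1
        have e1 : (((2 * k' + b : ℕ) : ℝ) + refNode m i) / 2 ^ (M + 1) =
            (k' + childNode m b i) / 2 ^ M := by
          rw [childNode, pow_succ]; push_cast; field_simp; ring
        rw [e1]
        simp only [childNode, mul_comm (refBasis m _ _)]
        ring
      rw [key, Finset.sum_range_succ]
      have h1 := ih (by omega) k' hk' _ hs'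
      have h2 := sum_le (fun i => refineErr m f M k' b i) (e M) s (he M (by omega) k' hk' b) hs
      refine (abs_add_le _ _).trans ((add_le_add h1 h2).trans_eq (by ring))
  intro k hk
  have := main N le_rfl k hk 0 (by simp)
  rw [sum_mul_refBasis_zero] at this
  simpa [refNode] using this

theorem sum_min_geometric_le {b x : ℝ} (hb : 1 < b) (hx : 0 < x) (N : ℕ) :
    ∑ n ∈ Finset.range N, min (b ^ n * x) (b ^ n * x)⁻¹ ≤ 2 * (b + 1) / (b - 1) := by
  have hb1 : 0 < b - 1 := by linarith
  set A := 2 * (b + 1) / (b - 1) with hA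
  have hA0 : 0 < A := by positivity
  have step : ∀ y : ℝ, 0 < y → min y y⁻¹ ≤ A * (b * y / (1 + b * y)) - A * (y / (1 + y)) := by
    intro y hy
    have e : A * (b * y / (1 + b * y)) - A * (y / (1 + y)) =
        2 * (b + 1) * y / ((1 + b * y) * (1 + y)) := by
      rw [hA]; field_simp; ring
    have hby : 0 < b * y := by positivity
    rw [e, le_div_iff₀ (by positivity)]
    rcases le_total y 1 with h | h
    · calc min y y⁻¹ * ((1 + b * y) * (1 + y)) ≤ y * ((1 + b * 1) * (1 + 1)) := by
            gcongr; exact min_le_left _ _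
        _ = _ := by ring
    · calc min y y⁻¹ * ((1 + b * y) * (1 + y)) ≤ y⁻¹ * ((y + b * y) * (y + y)) := by
            gcongr; exact min_le_right _ _
        _ = _ := by field_simp; ring
  have main : ∑ n ∈ Finset.range N, min (b ^ n * x) (b ^ n * x)⁻¹ ≤
      A * (b ^ N * x / (1 + b ^ N * x)) := by
    induction N with
    | zero => simp; positivity
    | succ N ih =>
      rw [Finset.sum_range_succ]
      have := step (b ^ N * x) (by positivity)
      rw [show b * (b ^ N * x) = b ^ (N + 1) * x by ring] at this
      linarith
  refine main.trans ?_
  have : b ^ N * x / (1 + b ^ N * x) ≤ 1 := by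
    rw [div_le_one (by positivity)]; linarith
  nlinarith

theorem sum_rpow_neg_le {q : ℝ} (hq0 : 0 ≤ q) (hq : q < 1) (n : ℕ) :
    ∑ k ∈ Finset.range n, ((k : ℝ) + 1) ^ (-q) ≤ (n : ℝ) ^ (1 - q) / (1 - q) := by
  have hr : 0 < 1 - q := by linarith
  induction n with
  | zero => simp [hr.ne']
  | succ n ih =>
    rw [Finset.sum_range_succ]
    refine (add_le_add_left ih _).trans ?_
    have hn : (0 : ℝ) < n + 1 := by positivity
    have h1 := rpow_one_add_le_one_add_mul_self (s := -1 / (n + 1)) (p := 1 - q)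
      (by rw [le_div_iff₀ hn]; linarith [(Nat.cast_nonneg n : (0 : ℝ) ≤ n)]) hr.le (by linarith)
    have h2 : (n : ℝ) ^ (1 - q) = ((n : ℝ) + 1) ^ (1 - q) * (1 + -1 / (n + 1)) ^ (1 - q) := by
      rw [← Real.mul_rpow hn.le]
      · congr 1; field_simp; ring
      · have : 1 + -1 / ((n : ℝ) + 1) = n / (n + 1) := by field_simp; ring
        rw [this]; positivity
    have h3 : ((n : ℝ) + 1) ^ (-q) = ((n : ℝ) + 1) ^ (1 - q) * (1 / (n + 1)) := by
      rw [sub_eq_add_neg, Real.rpow_add hn, Real.rpow_one]; field_simp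
    have h4 : 0 < ((n : ℝ) + 1) ^ (1 - q) := by positivity
    have h5 := mul_le_mul_of_nonneg_left h1 h4.le
    rw [← h2] at h5
    push_cast
    rw [h3, div_add' _ _ _ hr.ne', div_le_div_iff_of_pos_right hr]
    have h6 : (1 - q) * (-1 / ((n : ℝ) + 1)) = - ((1 / (n + 1)) * (1 - q)) := by ring
    rw [h6] at h5
    nlinarith

theorem sum_dyadic_rpow_neg_le {q : ℝ} (hq0 : 0 ≤ q) (hq : q < 1) (n : ℕ) :
    ∑ k ∈ Finset.range (2 ^ n), (((k : ℝ) + 1) / 2 ^ n) ^ (-q) ≤ 2 ^ n / (1 - q) := by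
  have h := sum_rpow_neg_le hq0 hq (2 ^ n)
  have h2 : (0 : ℝ) < 2 ^ n := by positivity
  have : ∀ k : ℕ, (((k : ℝ) + 1) / 2 ^ n) ^ (-q) = ((k : ℝ) + 1) ^ (-q) * (2 ^ n) ^ q := by
    intro k
    rw [Real.div_rpow (by positivity) h2.le, Real.rpow_neg h2.le, div_inv_eq_mul]
  simp_rw [this, ← Finset.sum_mul]
  calc _ ≤ ((2 ^ n : ℕ) : ℝ) ^ (1 - q) / (1 - q) * (2 ^ n) ^ q := by gcongr
    _ = 2 ^ n / (1 - q) := by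
      push_cast
      rw [div_mul_eq_mul_div, ← Real.rpow_add h2]
      simp

theorem mul_rpow_le_min {ρ β η p : ℝ} (hρ : 0 < ρ) (δ : ℝ)
    (h : (ρ ≤ 1 ∧ 0 ≤ η ∧ δ ≤ 1 - (β + η) * p ∧ 0 ≤ p ∧ 0 ≤ δ) ∨
      (1 ≤ ρ ∧ 0 ≤ η ∧ δ ≤ (β - η) * p - 1 ∧ 0 ≤ p ∧ 0 ≤ δ)) :
    ρ * (ρ ^ (-β) / min (ρ ^ η) (ρ ^ η)⁻¹) ^ p ≤ min (ρ ^ δ) (ρ ^ δ)⁻¹ := by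
  have hη : 0 < ρ ^ η := by positivity
  rcases h with ⟨h1, hη0, h2, hp, hδ⟩ | ⟨h1, hη0, h2, hp, hδ⟩
  · have a1 : ρ ^ η ≤ 1 := Real.rpow_le_one hρ.le h1 hη0
    have a2 : ρ ^ δ ≤ 1 := Real.rpow_le_one hρ.le h1 hδ
    rw [min_eq_left (a1.trans (one_le_inv₀ hη |>.2 a1)),
      min_eq_left (a2.trans (one_le_inv₀ (by positivity) |>.2 a2)), ← Real.rpow_sub hρ,
      ← Real.rpow_mul hρ.le]
    nth_rw 1 [← Real.rpow_one ρ]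
    rw [← Real.rpow_add hρ]
    exact Real.rpow_le_rpow_of_exponent_ge hρ h1 (by linarith)
  · have a1 : 1 ≤ ρ ^ η := Real.one_le_rpow h1 hη0
    have a2 : 1 ≤ ρ ^ δ := Real.one_le_rpow h1 hδ
    rw [min_eq_right ((inv_le_one_of_one_le₀ a1).trans a1),
      min_eq_right ((inv_le_one_of_one_le₀ a2).trans a2), ← Real.rpow_neg hρ.le,
      ← Real.rpow_neg hρ.le, ← Real.rpow_sub hρ, ← Real.rpow_mul hρ.le]
    nth_rw 1 [← Real.rpow_one ρ]
    rw [← Real.rpow_add hρ]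
    exact Real.rpow_le_rpow_of_exponent_le h1 (by linarith)

/-- Cost of one dyadic level in the multiscale small ball estimate. -/
theorem exists_level_cost {β γ C : ℝ} (hγ : 0 ≤ γ) (hβγ : γ / 2 < β) (hC : 0 < C) :
    ∃ η δ : ℝ, 0 < η ∧ 0 < δ ∧ ∀ κ : ℝ, 0 < κ → ∃ E : ℝ, 0 < E ∧ ∀ ε : ℝ, 0 < ε → ∀ n : ℕ, ∃ cost
      : ℕ → ℝ,
      (∀ k : ℕ, k < 2 ^ n → ∀ v : ℝ≥0,
        (v : ℝ) ≤ C * ((2 : ℝ) ^ n) ^ (-2 * β) * (((k : ℝ) + 1) / 2 ^ n) ^ (-γ) →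
        ENNReal.ofReal (rexp (-cost k)) ≤ gaussianReal 0 v
          {x | |x| ≤ κ * ε * min (((2 : ℝ) ^ η) ^ n * ε ^ (η / β))
            (((2 : ℝ) ^ η) ^ n * ε ^ (η / β))⁻¹}) ∧
      ∑ k ∈ Finset.range (2 ^ n), cost k ≤ E * ε ^ (-1 / β) *
        min (((2 : ℝ) ^ δ) ^ n * ε ^ (δ / β)) (((2 : ℝ) ^ δ) ^ n * ε ^ (δ / β))⁻¹ := by
  have hβ : 0 < β := by linarith
  set η := (β - γ / 2) / 2 with hη_def
  have hη : 0 < η := by rw [hη_def]; linarith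
  set p₀ := 1 / (2 * (β + η)) with hp₀
  set p₁ := 2 / ((β - η) + γ / 2) with hp₁
  have hβη : γ / 2 < β - η := by rw [hη_def]; linarith
  have hp₀_pos : 0 < p₀ := by positivity
  have hp₁_pos : 0 < p₁ := by
    have : 0 < β - η + γ / 2 := by linarith
    positivity
  have hp₀' : (β + η) * p₀ = 1 / 2 := by rw [hp₀]; field_simp
  have hp₁' : 1 < (β - η) * p₁ := by
    have : 0 < β - η + γ / 2 := by linarith
    rw [hp₁, mul_div_assoc', lt_div_iff₀ this]; linarith
  have hq₀ : γ / 2 * p₀ < 1 := by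
    have : γ / 2 * p₀ ≤ (β + η) * p₀ := by gcongr; linarith
    linarith
  have hq₁ : γ / 2 * p₁ < 1 := by
    have : 0 < β - η + γ / 2 := by linarith
    rw [hp₁, mul_div_assoc', div_lt_one this]; linarith
  set δ := min (1 / 2) ((β - η) * p₁ - 1) with hδ_def
  have hδ : 0 < δ := lt_min (by norm_num) (by linarith)
  refine ⟨η, δ, hη, hδ, fun κ hκ => ?_⟩
  have cost : ∀ p : ℝ, 0 < p → γ / 2 * p < 1 → ∃ E : ℝ, 0 < E ∧ ∀ ε : ℝ, 0 < ε → ∀ n : ℕ,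
      let ρ := (2 : ℝ) ^ n * ε ^ (1 / β)
      ((ρ ≤ 1 ∧ 0 ≤ η ∧ δ ≤ 1 - (β + η) * p ∧ 0 ≤ p ∧ 0 ≤ δ) ∨
      (1 ≤ ρ ∧ 0 ≤ η ∧ δ ≤ (β - η) * p - 1 ∧ 0 ≤ p ∧ 0 ≤ δ)) → ∃ cost : ℕ → ℝ,
      (∀ k : ℕ, k < 2 ^ n → ∀ v : ℝ≥0,
        (v : ℝ) ≤ C * ((2 : ℝ) ^ n) ^ (-2 * β) * (((k : ℝ) + 1) / 2 ^ n) ^ (-γ) →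
        ENNReal.ofReal (rexp (-cost k)) ≤ gaussianReal 0 v
          {x | |x| ≤ κ * ε * min (((2 : ℝ) ^ η) ^ n * ε ^ (η / β))
            (((2 : ℝ) ^ η) ^ n * ε ^ (η / β))⁻¹}) ∧
      ∑ k ∈ Finset.range (2 ^ n), cost k ≤ E * ε ^ (-1 / β) *
        min (((2 : ℝ) ^ δ) ^ n * ε ^ (δ / β)) (((2 : ℝ) ^ δ) ^ n * ε ^ (δ / β))⁻¹ := by
    intro p hp hq
    obtain ⟨G, hG, hG'⟩ := exists_exp_le_gaussianReal hp
    have hq1 : 0 < 1 - γ / 2 * p := by linarith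
    refine ⟨G * (√C / κ) ^ p / (1 - γ / 2 * p), by positivity, fun ε hε n => ?_⟩
    intro ρ hρ
    have h2n : (0 : ℝ) < 2 ^ n := by positivity
    have hρ0 : 0 < ρ := by positivity
    have pow_eq : ∀ s : ℝ, ((2 : ℝ) ^ s) ^ n * ε ^ (s / β) = ρ ^ s := by
      intro s
      rw [Real.mul_rpow h2n.le (by positivity), ← Real.rpow_mul hε.le, ← Real.rpow_natCast,
        ← Real.rpow_mul (by norm_num), ← Real.rpow_natCast, ← Real.rpow_mul (by norm_num)]
      ring_nf
    have hρβ : ((2 : ℝ) ^ n) ^ (-β) / ε = ρ ^ (-β) := by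
      rw [Real.mul_rpow h2n.le (by positivity), ← Real.rpow_mul hε.le,
        show 1 / β * -β = -1 by field_simp, Real.rpow_neg_one]
      rfl
    have hmin : 0 < min (ρ ^ η) (ρ ^ η)⁻¹ := lt_min (by positivity) (by positivity)
    rw [pow_eq, pow_eq]
    refine ⟨fun k => G * (√C / κ * (ρ ^ (-β) / min (ρ ^ η) (ρ ^ η)⁻¹) *
      (((k : ℝ) + 1) / 2 ^ n) ^ (-(γ / 2))) ^ p, fun k _ v hv => ?_, ?_⟩
    · have h := hG' v (κ * ε * min (ρ ^ η) (ρ ^ η)⁻¹)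
        (√C * ((2 : ℝ) ^ n) ^ (-β) * (((k : ℝ) + 1) / 2 ^ n) ^ (-(γ / 2))) (by positivity)
        (by positivity) ?_
      · convert h using 3
        rw [← hρβ, neg_mul]
        congr 3
        field_simp
      · refine hv.trans_eq ?_
        have sq : ∀ x s : ℝ, 0 < x → (x ^ s) ^ 2 = x ^ (2 * s) := fun x s hx => by
          rw [← Real.rpow_natCast, ← Real.rpow_mul hx.le, mul_comm]; rfl
        rw [mul_pow, mul_pow, Real.sq_sqrt hC.le, sq _ _ h2n, sq _ _ (by positivity)]
        ring_nf
    · have e : ∀ k : ℕ, G * (√C / κ * (ρ ^ (-β) / min (ρ ^ η) (ρ ^ η)⁻¹) *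
          (((k : ℝ) + 1) / 2 ^ n) ^ (-(γ / 2))) ^ p = G * (√C / κ) ^ p *
          (ρ ^ (-β) / min (ρ ^ η) (ρ ^ η)⁻¹) ^ p * (((k : ℝ) + 1) / 2 ^ n) ^ (-(γ / 2 * p)) := by
        intro k
        rw [Real.mul_rpow (by positivity) (by positivity), Real.mul_rpow (by positivity)
          (by positivity),
          ← Real.rpow_mul (by positivity)]
        ring_nf
      simp_rw [e]
      rw [← Finset.mul_sum]
      have h1 := sum_dyadic_rpow_neg_le (q := γ / 2 * p) (by positivity) hq n
      have h2 := mul_rpow_le_min hρ0 δ hρ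
      have h3 : (2 : ℝ) ^ n = ρ * ε ^ (-1 / β) := by
        rw [mul_assoc, ← Real.rpow_add hε]
        ring_nf
        simp
      have hX : 0 ≤ (ρ ^ (-β) / min (ρ ^ η) (ρ ^ η)⁻¹) ^ p := by positivity
      calc _ ≤ G * (√C / κ) ^ p * (ρ ^ (-β) / min (ρ ^ η) (ρ ^ η)⁻¹) ^ p *
            (2 ^ n / (1 - γ / 2 * p)) := by gcongr
        _ = G * (√C / κ) ^ p / (1 - γ / 2 * p) * ε ^ (-1 / β) *
            (ρ * (ρ ^ (-β) / min (ρ ^ η) (ρ ^ η)⁻¹) ^ p) := by rw [h3]; ring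
        _ ≤ _ := by gcongr
  obtain ⟨E₀, hE₀, H₀⟩ := cost p₀ hp₀_pos hq₀
  obtain ⟨E₁, hE₁, H₁⟩ := cost p₁ hp₁_pos hq₁
  refine ⟨max E₀ E₁, lt_max_of_lt_left hE₀, fun ε hε n => ?_⟩
  have hmin : 0 < min (((2 : ℝ) ^ δ) ^ n * ε ^ (δ / β)) (((2 : ℝ) ^ δ) ^ n * ε ^ (δ / β))⁻¹ :=
    lt_min (by positivity) (by positivity)
  rcases le_total ((2 : ℝ) ^ n * ε ^ (1 / β)) 1 with h | h
  · obtain ⟨c, hc1, hc2⟩ := H₀ ε hε n (Or.inl ⟨h, hη.le, by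
      rw [hp₀']; exact (min_le_left _ _).trans (by norm_num), hp₀_pos.le, hδ.le⟩)
    refine ⟨c, hc1, hc2.trans ?_⟩
    gcongr
    exact le_max_left _ _
  · obtain ⟨c, hc1, hc2⟩ := H₁ ε hε n (Or.inr ⟨h, hη.le, min_le_right _ _, hp₁_pos.le, hδ.le⟩)
    refine ⟨c, hc1, hc2.trans ?_⟩
    gcongr
    exact le_max_right _ _

theorem IsCenteredGaussianFamily.sum_mul {Ω : Type*} [MeasurableSpace Ω] {P : Measure Ω}
    {ι κ : Type*} [Fintype ι] [Fintype κ] {W : ι × κ → Ω → ℝ} (hW : IsCenteredGaussianFamily P W)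
    (a : ι → κ → ℝ) : IsCenteredGaussianFamily P (fun i ω => ∑ o, a i o * W (i, o) ω) := by
  classical
  convert hW.linear (fun (i : ι) (p : ι × κ) => if p.1 = i then a i p.2 else 0) using 3 with i ω
  rw [Fintype.sum_prod_type, Finset.sum_eq_single i]
  · simp
  · intro j _ hj
    simp [hj]
  · simp

theorem measure_abs_le_eq {Ω : Type*} [MeasurableSpace Ω] {P : Measure Ω} {V : Ω → ℝ} {v : ℝ≥0}
    (hV : P.map V = gaussianReal 0 v) (r : ℝ) : P {ω | |V ω| ≤ r} = gaussianReal 0 v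
      {x | |x| ≤ r} := by
  have hm : AEMeasurable V P := AEMeasurable.of_map_ne_zero (by
    rw [hV]; exact IsProbabilityMeasure.ne_zero _)
  rw [← hV, Measure.map_apply_of_aemeasurable hm (measurableSet_le (by fun_prop) (by fun_prop))]
  rfl

theorem prod_exp_le {ι : Type*} (s : Finset ι) (cost : ι → ℝ) (p : ι → ℝ≥0∞)
    (h : ∀ i ∈ s, ENNReal.ofReal (rexp (-cost i)) ≤ p i) :
    ENNReal.ofReal (rexp (-∑ i ∈ s, cost i)) ≤ ∏ i ∈ s, p i := by
  rw [← Finset.sum_neg_distrib, Real.exp_sum, ENNReal.ofReal_prod_of_nonneg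
    (fun _ _ => (exp_pos _).le)]
  exact Finset.prod_le_prod' h

/-- A multiscale lower bound for the small ball probability of a Gaussian process on a dyadic grid,
in terms of the variances of local polynomial interpolation errors. -/
theorem exists_exp_le_measure_dyadic {Ω : Type*} [MeasurableSpace Ω] {P : Measure Ω}
    [IsProbabilityMeasure P] {β γ C : ℝ} (hγ : 0 ≤ γ) (hβγ : γ / 2 < β) (hC : 0 < C) (m : ℕ)
    (Z : ℝ → Ω → ℝ)
    (hG : ∀ (ι : Type) [Fintype ι] (t : ι → ℝ), (∀ i, t i ∈ Icc (0 : ℝ) 1) →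
      IsCenteredGaussianFamily P (fun i => Z (t i)))
    (hV : ∀ (n k : ℕ) (b : Fin 2) (i : Fin (m + 1)), k < 2 ^ n → ∀ v : ℝ≥0,
      P.map (fun ω => refineErr m (fun t => Z t ω) n k b i) = gaussianReal 0 v →
      (v : ℝ) ≤ C * ((2 : ℝ) ^ n) ^ (-2 * β) * (((k : ℝ) + 1) / 2 ^ n) ^ (-γ)) :
    ∃ C' : ℝ, 0 < C' ∧ ∀ ε : ℝ, 0 < ε → ∀ N : ℕ,
      ENNReal.ofReal (rexp (-(C' * ε ^ (-1 / β)))) ≤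
        P {ω | ∀ k : ℕ, k < 2 ^ N → |Z (k / 2 ^ N) ω| ≤ ε} := by
  classical
  have hβ : 0 < β := by linarith
  obtain ⟨L, hL, hL'⟩ := exists_abs_refBasis_le m
  obtain ⟨η, δ, hη, hδ, H⟩ := exists_level_cost (C := C) hγ hβγ hC
  have hb : ∀ s : ℝ, 0 < s → (1 : ℝ) < 2 ^ s := fun s hs => Real.one_lt_rpow (by norm_num) hs
  set S : ℝ → ℝ := fun s => 2 * ((2 : ℝ) ^ s + 1) / ((2 : ℝ) ^ s - 1) with hS
  have hS0 : ∀ s, 0 < s → 0 < S s := fun s hs => by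
    have := hb s hs
    exact div_pos (by positivity) (by linarith)
  set κ : ℝ := 1 / ((m + 1) * L * (1 + S η)) with hκ_def
  have hκ : 0 < κ := by have := hS0 η hη; positivity
  obtain ⟨E, hE, H⟩ := H κ hκ
  obtain ⟨G, hG0, hG1⟩ := exists_exp_le_gaussianReal (p := 1 / β) (by positivity)
  choose v0 hv0 using fun i => (hG (Fin (m + 1)) (refNode m) (refNode_mem m)).apply i
  obtain ⟨σ, hσ, hσv⟩ : ∃ σ : ℝ, 0 < σ ∧ ∀ i, (v0 i : ℝ) ≤ σ ^ 2 := by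
    have h0 : (0 : ℝ) ≤ ∑ i, (v0 i : ℝ) := Finset.sum_nonneg fun i _ => (v0 i).2
    refine ⟨1 + ∑ i, (v0 i : ℝ), by positivity, fun i => ?_⟩
    have := Finset.single_le_sum (f := fun i => (v0 i : ℝ)) (fun i _ => (v0 i).2)
      (Finset.mem_univ i)
    nlinarith
  refine ⟨(m + 1) * (G * (σ / κ) ^ (1 / β)) + 2 * (m + 1) * E * S δ, by
    have := hS0 δ hδ; positivity, fun ε hε N => ?_⟩
  choose cost hcost1 hcost2 using H ε hε
  set M : ℕ → ℝ := fun n =>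
    min (((2 : ℝ) ^ η) ^ n * ε ^ (η / β)) (((2 : ℝ) ^ η) ^ n * ε ^ (η / β))⁻¹ with hM
  set ι := Fin (m + 1) ⊕ (Σ n : Fin N, Fin (2 ^ (n : ℕ)) × Fin 2 × Fin (m + 1)) with hι
  let V : ι → Ω → ℝ := Sum.elim (fun i => Z (refNode m i))
    (fun q ω => refineErr m (fun t => Z t ω) q.1 q.2.1 q.2.2.1 q.2.2.2)
  let c : ι → ℝ := Sum.elim (fun _ => κ * ε) (fun q => κ * ε * M q.1)
  let cst : ι → ℝ := Sum.elim (fun _ => G * (σ / (κ * ε)) ^ (1 / β)) (fun q => cost q.1 q.2.1)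
  have mem : ∀ (n k : ℕ) (y : ℝ), k < 2 ^ n → y ∈ Icc (0 : ℝ) 1 → (k + y) / 2 ^ n ∈ Icc
    (0 : ℝ) 1 := by
    intro n k y hk hy
    have hy0 := hy.1
    have hk' : (k : ℝ) + 1 ≤ 2 ^ n := by exact_mod_cast hk
    exact ⟨by positivity, (div_le_one (by positivity)).2 (by linarith [hy.2])⟩
  have VG : IsCenteredGaussianFamily P V := by
    let t : ι × Option (Fin (m + 1)) → ℝ := fun p => Sum.elim (fun i => refNode m i)
      (fun q => p.2.elim ((((q.2.1 : ℕ) : ℝ) + childNode m q.2.2.1 q.2.2.2) / 2 ^ (q.1 : ℕ))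
        (fun j => (((q.2.1 : ℕ) : ℝ) + refNode m j) / 2 ^ (q.1 : ℕ))) p.1
    have ht : ∀ p, t p ∈ Icc (0 : ℝ) 1 := by
      rintro ⟨i | q, o⟩
      · exact refNode_mem m i
      · rcases o with _ | j
        · exact mem _ _ _ q.2.1.2 (childNode_mem m _ _)
        · exact mem _ _ _ q.2.1.2 (refNode_mem m _)
    convert (hG _ t ht).sum_mul (fun i o => Sum.elim (fun _ => o.elim 1 (fun _ => 0))
      (fun q => o.elim 1 (fun j => -refBasis m j (childNode m q.2.2.1 q.2.2.2))) i) with i ω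
    rcases i with i | q
    · simp [V, t, Fintype.sum_option]
    · simp [V, t, Fintype.sum_option, refineErr, sub_eq_add_neg]
  have hle : ∀ i, ENNReal.ofReal (rexp (-cst i)) ≤ P {ω | |V i ω| ≤ c i} := by
    rintro (i | q)
    · rw [measure_abs_le_eq (V := V (Sum.inl i)) (hv0 i)]
      have := hG1 (v0 i) (κ * ε) σ (by positivity) hσ (hσv i)
      rwa [neg_mul] at this
    · obtain ⟨v, hv⟩ := VG.apply (Sum.inr q)
      rw [measure_abs_le_eq hv]
      exact hcost1 _ _ q.2.1.2 v (hV _ _ _ _ q.2.1.2 v hv)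
  have hsum : ∑ i, cst i ≤ ((m + 1) * (G * (σ / κ) ^ (1 / β)) + 2 * (m + 1) * E * S δ) * ε
    ^ (-1 / β) := by
    rw [Fintype.sum_sum_type, Fintype.sum_sigma, add_mul]
    refine add_le_add (le_of_eq ?_) ?_
    · simp only [cst, Sum.elim_inl, Finset.sum_const, Finset.card_univ, Fintype.card_fin,
        nsmul_eq_mul]
      rw [← div_div, Real.div_rpow (by positivity) hε.le, neg_div, Real.rpow_neg hε.le]
      push_cast
      ring
    · have : ∀ n : Fin N, ∑ q : Fin (2 ^ (n : ℕ)) × Fin 2 × Fin (m + 1), cst (Sum.inr ⟨n, q⟩) =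
          2 * (m + 1) * ∑ k ∈ Finset.range (2 ^ (n : ℕ)), cost n k := by
        intro n
        rw [Fintype.sum_prod_type, Finset.sum_range, Finset.mul_sum]
        refine Finset.sum_congr rfl fun k _ => ?_
        simp [cst]
      simp_rw [this]
      rw [Fin.sum_univ_eq_sum_range (fun n => 2 * ((m : ℝ) + 1) * ∑ k ∈ Finset.range (2 ^ n), cost
        n k),
        ← Finset.mul_sum]
      have h1 : ∑ n ∈ Finset.range N, ∑ k ∈ Finset.range (2 ^ n), cost n k ≤
          E * ε ^ (-1 / β) * S δ := by
        refine (Finset.sum_le_sum fun n _ => hcost2 n).trans ?_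
        rw [← Finset.mul_sum]
        gcongr
        exact sum_min_geometric_le (hb δ hδ) (by positivity) N
      calc _ ≤ 2 * ((m : ℝ) + 1) * (E * ε ^ (-1 / β) * S δ) := by gcongr
        _ = _ := by ring
  calc ENNReal.ofReal (rexp (-(((m + 1) * (G * (σ / κ) ^ (1 / β)) + 2 * (m + 1) * E * S δ) * ε
    ^ (-1 / β))))
      ≤ ENNReal.ofReal (rexp (-∑ i, cst i)) := by gcongr
    _ ≤ ∏ i, P {ω | |V i ω| ≤ c i} := prod_exp_le _ _ _ fun i _ => hle i
    _ ≤ P {ω | ∀ i ∈ Finset.univ, |V i ω| ≤ c i} := VG.sidak c _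
    _ ≤ _ := by
      refine measure_mono fun ω hω k hk => ?_
      have h := abs_le_of_refineErr_le hL' (fun t => Z t ω) (κ * ε) (fun n => κ * ε * M n) N
        (fun i => hω (Sum.inl i) (Finset.mem_univ _))
        (fun n hn k hk b i => hω (Sum.inr ⟨⟨n, hn⟩, ⟨k, hk⟩, b, i⟩) (Finset.mem_univ _)) k hk
      refine h.trans ?_
      rw [← Finset.mul_sum]
      have h2 := sum_min_geometric_le (hb η hη) (x := ε ^ (η / β)) (by positivity) N
      have hSη := hS0 η hη
      calc (m + 1) * L * (κ * ε + κ * ε * ∑ n ∈ Finset.range N, M n)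
          ≤ (m + 1) * L * (κ * ε + κ * ε * S η) := by gcongr
        _ = ε := by rw [hκ_def]; field_simp

/-- A linear functional supported on an interval of length one which kills polynomials of degree at
most `m` is small on functions holomorphic in a large disc. -/
theorem norm_sum_mul_le_of_annihilates {ι : Type*} [Fintype ι] {m : ℕ} {a y : ι → ℝ}
    (hy : ∀ i, y i ∈ Icc (0 : ℝ) 1) (ha : ∀ n ≤ m, ∑ i, a i * y i ^ n = 0) {F : ℂ → ℂ} {c : ℂ}
    {R B : ℝ} (hR : 4 ≤ R) (hF : DifferentiableOn ℂ F (Metric.ball c R))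
    (hB : ∀ z ∈ Metric.ball c R, ‖F z‖ ≤ B) :
    ‖∑ i, (a i : ℂ) * F (c + y i)‖ ≤ 2 * (∑ i, |a i|) * B * (2 / R) ^ (m + 1) := by
  set r := R / 2 with hr
  have hr2 : 2 ≤ r := by rw [hr]; linarith
  have hr0 : 0 < r := by linarith
  have hB0 : 0 ≤ B := (norm_nonneg _).trans (hB c (Metric.mem_ball_self (by linarith)))
  have hsub : Metric.closedBall c r ⊆ Metric.ball c R :=
    Metric.closedBall_subset_ball (by rw [hr]; linarith)
  have hcoef : ∀ n : ℕ, ‖iteratedDeriv n F c‖ ≤ n.factorial * B / r ^ n := fun n =>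
    Complex.norm_iteratedDeriv_le_of_forall_mem_sphere_norm_le n hr0
      ((hF.mono (by rw [closure_ball c hr0.ne']; exact hsub)).diffContOnCl)
      (fun z hz => hB z (hsub (Metric.sphere_subset_closedBall hz)))
  set p : ℕ → ℂ := fun n => ((n.factorial : ℂ))⁻¹ * iteratedDeriv n F c with hp
  have hpn : ∀ n, ‖p n‖ ≤ B * (1 / r) ^ n := by
    intro n
    rw [hp]
    simp only [norm_mul, norm_inv, Complex.norm_natCast]
    have h1 := hcoef n
    have h2 : (0 : ℝ) < n.factorial := by positivity
    calc _ ≤ ((n.factorial : ℝ))⁻¹ * (n.factorial * B / r ^ n) := by gcongr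
      _ = _ := by rw [one_div, inv_pow]; field_simp
  have hsum : ∀ i, HasSum (fun n => (a i : ℂ) * (p n * (y i : ℂ) ^ n))
    ((a i : ℂ) * F (c + y i)) := by
    intro i
    have hm : c + (y i : ℂ) ∈ Metric.ball c R := by
      simp only [Metric.mem_ball, dist_self_add_left, Complex.norm_real, Real.norm_eq_abs,
        abs_of_nonneg (hy i).1]
      linarith [(hy i).2]
    have := (Complex.hasSum_taylorSeries_on_ball hF hm).mul_left (a i : ℂ)
    rw [show (fun n : ℕ => (a i : ℂ) * (p n * (y i : ℂ) ^ n)) = _ from funext fun n => ?_]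
    · exact this
    · simp only [hp, smul_eq_mul, add_sub_cancel_left]
      ring
  have hsum2 := hasSum_sum (s := Finset.univ) (fun i _ => hsum i)
  set A := ∑ i, |a i| with hA
  have hterm : ∀ n, ‖∑ i, (a i : ℂ) * (p n * (y i : ℂ) ^ n)‖ ≤
      if n < m + 1 then 0 else A * B * (1 / r) ^ n := by
    intro n
    split_ifs with h
    · have : ∑ i, (a i : ℂ) * (p n * (y i : ℂ) ^ n) = p n * ((∑ i, a i * y i ^ n : ℝ) : ℂ) := by
        push_cast
        rw [Finset.mul_sum]
        exact Finset.sum_congr rfl fun i _ => by ring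
      rw [this, ha n (by omega)]
      simp
    · refine (norm_sum_le _ _).trans ?_
      rw [hA, Finset.sum_mul, Finset.sum_mul]
      refine Finset.sum_le_sum fun i _ => ?_
      rw [norm_mul, norm_mul, norm_pow, Complex.norm_real, Complex.norm_real, Real.norm_eq_abs,
        Real.norm_eq_abs, abs_of_nonneg (hy i).1, mul_assoc]
      have h1 : y i ^ n ≤ 1 := pow_le_one₀ (hy i).1 (hy i).2
      have h2 := pow_nonneg (hy i).1 n
      refine mul_le_mul_of_nonneg_left ?_ (abs_nonneg _)
      calc _ ≤ ‖p n‖ * 1 := by gcongr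
        _ ≤ _ := by rw [mul_one]; exact hpn n
  have hq : 1 / r < 1 := by rw [div_lt_one hr0]; linarith
  have hgeo : HasSum (fun n => if n < m + 1 then 0 else A * B * (1 / r) ^ n)
      (A * B * (1 / r) ^ (m + 1) * (1 - 1 / r)⁻¹) := by
    rw [← hasSum_nat_add_iff' (m + 1)]
    have h := (hasSum_geometric_of_lt_one (by positivity) hq).mul_left (A * B * (1 / r) ^ (m + 1))
    rw [Finset.sum_eq_zero (fun n hn => if_pos (Finset.mem_range.1 hn)), sub_zero]
    rw [show (fun n : ℕ => if n + (m + 1) < m + 1 then 0 else A * B * (1 / r) ^ (n + (m + 1))) =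
      _ from
      funext fun n => ?_]
    · exact h
    · rw [if_neg (by omega), pow_add]
      ring
  have := hsum2.norm_le_of_bounded hgeo hterm
  refine this.trans ?_
  have hA0 : 0 ≤ A := Finset.sum_nonneg fun _ _ => abs_nonneg _
  have h2 : (1 - 1 / r)⁻¹ ≤ 2 := by
    rw [inv_le_comm₀ (by linarith) (by norm_num)]
    have : 1 / r ≤ 1 / 2 := by gcongr
    linarith
  calc _ ≤ A * B * (1 / r) ^ (m + 1) * 2 := by gcongr
    _ = _ := by rw [hr]; rw [one_div_div]; ring

/-- The moving average kernel of generalized fractional Brownian motion. -/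
noncomputable def gfbmKer (α v u : ℝ) : ℝ := (max (v - u) 0) ^ α - (max (-u) 0) ^ α

/-- The moving average kernel of the fractional integral of generalized fractional Brownian
motion. -/
noncomputable def fracKer (α θ t u : ℝ) : ℝ :=
  (Real.Gamma θ)⁻¹ * ∫ v in (0 : ℝ)..t, (t - v) ^ (θ - 1) * gfbmKer α v u

theorem integral_sub_rpow_mul_eq {θ t : ℝ} (hθ : 0 < θ) (ht : 0 ≤ t) (f : ℝ → ℝ) :
    ∫ v in (0 : ℝ)..t, (t - v) ^ (θ - 1) * f v =
      t ^ θ * ∫ w in (0 : ℝ)..1, (1 - w) ^ (θ - 1) * f (t * w) := by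
  rcases ht.eq_or_lt with rfl | ht
  · simp [Real.zero_rpow hθ.ne']
  have h := intervalIntegral.smul_integral_comp_mul_left (a := 0) (b := 1)
    (fun v => (t - v) ^ (θ - 1) * f v) t
  rw [mul_zero, mul_one] at h
  rw [← h, smul_eq_mul, show t ^ θ = t * t ^ (θ - 1) by
    rw [← Real.rpow_one_add' ht.le (by linarith)]; ring_nf, mul_assoc,
    ← intervalIntegral.integral_const_mul (t ^ (θ - 1))]
  congr 1
  refine intervalIntegral.integral_congr fun w hw => ?_
  rw [uIcc_of_le zero_le_one] at hw
  rw [show t - t * w = t * (1 - w) by ring, Real.mul_rpow ht.le (by linarith [hw.2])]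
  ring

theorem fracKer_eq {α θ t u : ℝ} (hθ : 0 < θ) (ht : 0 ≤ t) : fracKer α θ t u =
    (Real.Gamma θ)⁻¹ * (t ^ θ * ∫ w in (0 : ℝ)..1, (1 - w) ^ (θ - 1) * gfbmKer α (t * w) u) := by
  rw [fracKer, integral_sub_rpow_mul_eq hθ ht]

theorem gfbmKer_mul {α h v u : ℝ} (hh : 0 < h) :
    gfbmKer α (h * v) (h * u) = h ^ α * gfbmKer α v u := by
  have e : ∀ x : ℝ, max (h * x) 0 = h * max x 0 := fun x => by
    rw [mul_max_of_nonneg _ _ hh.le, mul_zero]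
  rw [gfbmKer, gfbmKer, ← mul_sub, e, ← mul_neg, e, Real.mul_rpow hh.le (le_max_right _ _),
    Real.mul_rpow hh.le (le_max_right _ _), mul_sub]

theorem fracKer_mul {α θ h t u : ℝ} (hθ : 0 < θ) (hh : 0 < h) (ht : 0 ≤ t) :
    fracKer α θ (h * t) (h * u) = h ^ (α + θ) * fracKer α θ t u := by
  rw [fracKer_eq hθ (by positivity), fracKer_eq hθ ht, Real.mul_rpow hh.le ht, Real.rpow_add hh]
  have : ∀ w : ℝ, (1 - w) ^ (θ - 1) * gfbmKer α (h * t * w) (h * u) =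
      h ^ α * ((1 - w) ^ (θ - 1) * gfbmKer α (t * w) u) := fun w => by
    rw [mul_assoc h, gfbmKer_mul hh]; ring
  simp_rw [this]
  rw [intervalIntegral.integral_const_mul]
  ring

@[simp] theorem gfbmKer_exponent_zero (v u : ℝ) : gfbmKer 0 v u = 0 := by simp [gfbmKer]

@[simp] theorem fracKer_exponent_zero (θ t u : ℝ) : fracKer 0 θ t u = 0 := by simp [fracKer]

theorem gfbmKer_of_pos {α v u : ℝ} (hα : α ≠ 0) (hu : 0 < u) :
    gfbmKer α v u = if u < v then (v - u) ^ α else 0 := by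
  rw [gfbmKer, max_eq_right (by linarith : -u ≤ 0), Real.zero_rpow hα, sub_zero]
  split_ifs with h
  · rw [max_eq_left (by linarith)]
  · rw [max_eq_right (by linarith), Real.zero_rpow hα]

theorem fracKer_of_pos {α θ t u : ℝ} (hα : α ≠ 0) (ht : 0 ≤ t) (hu : 0 < u) :
    fracKer α θ t u = if u < t then
      ((Real.Gamma θ)⁻¹ * ∫ w in (0 : ℝ)..1, (1 - w) ^ (θ - 1) * w ^ α) * (t - u) ^ (α + θ)
        else 0 := by
  rw [fracKer]
  split_ifs with h
  · have htu : 0 < t - u := by linarith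
    have h1 : ∫ v in (0 : ℝ)..t, (t - v) ^ (θ - 1) * gfbmKer α v u =
        ∫ v in u..t, (t - v) ^ (θ - 1) * (v - u) ^ α := by
      rw [intervalIntegral.integral_of_le ht, intervalIntegral.integral_of_le h.le]
      rw [setIntegral_eq_of_subset_of_forall_sdiff_eq_zero measurableSet_Ioc
        (Ioc_subset_Ioc_left hu.le) (f := fun v => (t - v) ^ (θ - 1) * gfbmKer α v u)]
      · refine setIntegral_congr_fun measurableSet_Ioc fun v hv => ?_
        rw [gfbmKer_of_pos hα hu, if_pos hv.1]
      · intro v hv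
        rw [gfbmKer_of_pos hα hu, if_neg, mul_zero]
        intro hv'
        exact hv.2 ⟨hv', hv.1.2⟩
    have h2 := intervalIntegral.integral_comp_add_right (a := 0) (b := t - u)
      (fun v => (t - v) ^ (θ - 1) * (v - u) ^ α) u
    rw [zero_add, sub_add_cancel] at h2
    have h3 := intervalIntegral.smul_integral_comp_mul_left (a := 0) (b := 1)
      (fun v => (t - (v + u)) ^ (θ - 1) * (v + u - u) ^ α) (t - u)
    rw [mul_zero, mul_one] at h3
    rw [h1, ← h2, ← h3, smul_eq_mul, mul_assoc]
    congr 1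
    rw [show (t - u) ^ (α + θ) = (t - u) * ((t - u) ^ (θ - 1) * (t - u) ^ α) by
      rw [← Real.rpow_add htu]
      nth_rw 2 [← Real.rpow_one (t - u)]
      rw [← Real.rpow_add htu]; ring_nf]
    rw [show ∀ I : ℝ, I * ((t - u) * ((t - u) ^ (θ - 1) * (t - u) ^ α)) =
      (t - u) * ((t - u) ^ (θ - 1) * (t - u) ^ α * I) from fun I => by ring,
      ← intervalIntegral.integral_const_mul ((t - u) ^ (θ - 1) * (t - u) ^ α)]
    congr 1
    refine intervalIntegral.integral_congr fun w hw => ?_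
    rw [uIcc_of_le zero_le_one] at hw
    simp only [add_sub_cancel_right]
    rw [show t - ((t - u) * w + u) = (t - u) * (1 - w) by ring,
      Real.mul_rpow htu.le (by linarith [hw.2]), Real.mul_rpow htu.le hw.1]
    ring
  · rw [intervalIntegral.integral_congr (g := fun _ => 0), intervalIntegral.integral_zero, mul_zero]
    intro v hv
    rw [uIcc_of_le ht] at hv
    simp only
    rw [gfbmKer_of_pos hα hu, if_neg (by linarith [hv.2]), mul_zero]

/-- An upper bound for the increments `(ζ + x) ^ α - x ^ α` with `‖ζ‖ ≤ 2 * r`. -/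
noncomputable def incrBound (α r x : ℝ) : ℝ :=
  if x < r then 2 * x ^ α + (3 * r) ^ α else 2 * r * |α| * x ^ (α - 1)

theorem incrBound_nonneg {α r x : ℝ} (hr : 0 < r) (hx : 0 < x) : 0 ≤ incrBound α r x := by
  unfold incrBound; split_ifs <;> positivity

theorem measurable_incrBound (α r : ℝ) : Measurable (incrBound α r) := by
  unfold incrBound
  exact Measurable.ite measurableSet_Iio (by fun_prop) (by fun_prop)

theorem incrBound_mul {α r x : ℝ} (hr : 0 < r) (hx : 0 < x) :
    incrBound α r (r * x) = r ^ α * incrBound α 1 x := by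
  have h1 : r * x < r ↔ x < 1 := by
    constructor <;> intro h <;> nlinarith
  unfold incrBound
  simp only [h1]
  split_ifs
  · rw [Real.mul_rpow hr.le hx.le, Real.mul_rpow (by norm_num) hr.le]; norm_num; ring
  · rw [Real.mul_rpow hr.le hx.le, Real.rpow_sub_one hr.ne']; field_simp

theorem norm_cpow_add_sub_le {α r x : ℝ} (hα : α ≤ 1) (hr : 0 < r) (hx : 0 < x) {z : ℂ}
    (hz : 0 ≤ z.re) (hzr : ‖z‖ ≤ 2 * r) :
    ‖(z + x) ^ (α : ℂ) - (x : ℂ) ^ (α : ℂ)‖ ≤ incrBound α r x := by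
  have hre : ∀ ζ : ℂ, x ≤ ζ.re → x ≤ ‖ζ‖ := fun ζ h => h.trans (Complex.re_le_norm ζ)
  have hzx : x ≤ (z + x).re := by simp [hz]
  unfold incrBound
  split_ifs with h
  · have h1 : ‖z + x‖ ≤ 3 * r := by
      refine (norm_add_le _ _).trans ?_
      rw [Complex.norm_real, Real.norm_eq_abs, abs_of_pos hx]
      linarith
    have h2 : ‖(z + x) ^ (α : ℂ)‖ ≤ x ^ α + (3 * r) ^ α := by
      rw [Complex.norm_cpow_real]
      rcases le_total 0 α with h0 | h0
      · have := Real.rpow_le_rpow (norm_nonneg _) h1 h0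
        have : 0 ≤ x ^ α := by positivity
        linarith
      · have := Real.rpow_le_rpow_of_nonpos hx (hre _ hzx) h0
        have : 0 ≤ (3 * r) ^ α := by positivity
        linarith
    have h3 : ‖(x : ℂ) ^ (α : ℂ)‖ = x ^ α := by
      rw [Complex.norm_cpow_real, Complex.norm_real, Real.norm_eq_abs, abs_of_pos hx]
    have := norm_sub_le ((z + x) ^ (α : ℂ)) ((x : ℂ) ^ (α : ℂ))
    linarith
  · have hmv := (convex_halfSpace_re_ge x).norm_image_sub_le_of_norm_hasDerivWithin_le (𝕜 := ℂ)
      (f := fun ζ : ℂ => ζ ^ (α : ℂ)) (f' := fun ζ => (α : ℂ) * ζ ^ ((α : ℂ) - 1))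
      (C := |α| * x ^ (α - 1)) (x := (x : ℂ)) (y := z + x) ?_ ?_ (by simp) hzx
    · refine hmv.trans ?_
      rw [add_sub_cancel_right]
      have : 0 ≤ |α| * x ^ (α - 1) := by positivity
      nlinarith
    · intro ζ hζ
      have h0 : 0 < ζ.re := lt_of_lt_of_le hx hζ
      simpa using ((hasDerivAt_id ζ).cpow_const (c := (α : ℂ)) (Or.inl h0)).hasDerivWithinAt
    · intro ζ hζ
      have hζ' : x ≤ ζ.re := hζ
      rw [norm_mul, Complex.norm_real, Real.norm_eq_abs, ← Complex.ofReal_one, ← Complex.ofReal_sub,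
        Complex.norm_cpow_real]
      gcongr ?_ * ?_
      exact Real.rpow_le_rpow_of_nonpos hx (hre _ hζ') (by linarith)

theorem lintegral_mul_left_eq {h : ℝ} (hh : 0 < h) (f : ℝ → ℝ≥0∞) :
    ∫⁻ u, f u = ENNReal.ofReal h * ∫⁻ u, f (h * u) := by
  have e := Real.smul_map_volume_mul_left hh.ne'
  have hm : MeasurableEmbedding (h * · : ℝ → ℝ) := (Homeomorph.mulLeft₀ h
    hh.ne').measurableEmbedding
  nth_rw 1 [← e]
  rw [lintegral_smul_measure, hm.lintegral_map, abs_of_pos hh, smul_eq_mul]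

theorem setLIntegral_Ioi_mul_left_eq {h : ℝ} (hh : 0 < h) (f : ℝ → ℝ≥0∞) :
    ∫⁻ u in Ioi 0, f u = ENNReal.ofReal h * ∫⁻ u in Ioi 0, f (h * u) := by
  rw [← lintegral_indicator measurableSet_Ioi, lintegral_mul_left_eq hh,
    ← lintegral_indicator measurableSet_Ioi]
  congr 2 with u
  have : h * u ∈ Ioi (0 : ℝ) ↔ u ∈ Ioi (0 : ℝ) := by simp [hh]
  simp only [indicator, this]

theorem integrableOn_incrBound_sq {α γ : ℝ} (hγ0 : 0 ≤ γ) (hγ : γ < 1) (hα : -1 / 2 + γ / 2 < α)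
    (hα' : α < 1 / 2) : IntegrableOn (fun x => incrBound α 1 x ^ 2 * x ^ (-γ)) (Ioi 0) := by
  have hm : Measurable fun x => incrBound α 1 x ^ 2 * x ^ (-γ) :=
    ((measurable_incrBound α 1).pow_const 2).mul (by fun_prop)
  rw [← Ioc_union_Ioi_eq_Ioi zero_le_one]
  refine IntegrableOn.union ?_ ?_
  · rw [integrableOn_Ioc_iff_integrableOn_Ioo]
    have h1 : IntegrableOn (fun x : ℝ => 8 * x ^ (2 * α - γ) + 2 * (3 ^ α) ^ 2 * x ^ (-γ))
      (Ioo 0 1) := by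
      have := ((intervalIntegral.intervalIntegrable_rpow' (a := 0) (b := 1) (r := 2 * α - γ)
        (by linarith)).const_mul 8).add ((intervalIntegral.intervalIntegrable_rpow'
          (a := 0) (b := 1)
        (r := -γ) (by linarith)).const_mul (2 * (3 ^ α) ^ 2))
      rwa [intervalIntegrable_iff_integrableOn_Ioo_of_le zero_le_one] at this
    refine h1.mono' hm.aestronglyMeasurable ?_
    refine (ae_restrict_iff' measurableSet_Ioo).2 (Eventually.of_forall fun x hx => ?_)
    have hx0 : 0 < x := hx.1
    rw [Real.norm_of_nonneg (by positivity), incrBound, if_pos hx.2, mul_one]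
    have e : x ^ (2 * α - γ) = (x ^ α) ^ 2 * x ^ (-γ) := by
      rw [← Real.rpow_natCast, ← Real.rpow_mul hx0.le, ← Real.rpow_add hx0]
      congr 1
      push_cast
      ring
    rw [e, ← mul_assoc, ← add_mul]
    gcongr
    nlinarith [sq_nonneg (2 * x ^ α - 3 ^ α)]
  · have h1 : IntegrableOn (fun x : ℝ => (2 * |α|) ^ 2 * x ^ (2 * α - 2 - γ)) (Ioi 1) :=
      (integrableOn_Ioi_rpow_of_lt (by linarith) zero_lt_one).const_mul _
    refine h1.congr_fun (fun x hx => ?_) measurableSet_Ioi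
    have hx1 : (1 : ℝ) < x := hx
    have hx0 : 0 < x := by linarith
    have e : x ^ (2 * α - 2 - γ) = (x ^ (α - 1)) ^ 2 * x ^ (-γ) := by
      rw [← Real.rpow_natCast, ← Real.rpow_mul hx0.le, ← Real.rpow_add hx0]
      congr 1
      push_cast
      ring
    beta_reduce
    rw [incrBound, if_neg (by linarith), e]
    ring

theorem exists_lintegral_incrBound_sq_le {α γ : ℝ} (hγ0 : 0 ≤ γ) (hγ : γ < 1)
    (hα : -1 / 2 + γ / 2 < α) (hα' : α < 1 / 2) : ∃ C : ℝ, 0 < C ∧ ∀ r : ℝ, 0 < r →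
      ∫⁻ x in Ioi 0, ENNReal.ofReal (incrBound α r x ^ 2 * x ^ (-γ)) ≤
        ENNReal.ofReal (C * r ^ (2 * α + 1 - γ)) := by
  have hI := integrableOn_incrBound_sq hγ0 hγ hα hα'
  have h0 : 0 ≤ ∫ x in Ioi 0, incrBound α 1 x ^ 2 * x ^ (-γ) :=
    setIntegral_nonneg measurableSet_Ioi fun x hx => by have : 0 < x := hx; positivity
  refine ⟨(∫ x in Ioi 0, incrBound α 1 x ^ 2 * x ^ (-γ)) + 1, by linarith, fun r hr => ?_⟩
  rw [setLIntegral_Ioi_mul_left_eq hr]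
  have e : ∫⁻ x in Ioi 0, ENNReal.ofReal (incrBound α r (r * x) ^ 2 * (r * x) ^ (-γ)) =
      ENNReal.ofReal (r ^ (2 * α - γ)) * ENNReal.ofReal
        (∫ x in Ioi 0, incrBound α 1 x ^ 2 * x ^ (-γ)) := by
    rw [ofReal_integral_eq_lintegral_ofReal hI, ← lintegral_const_mul' _ _ ENNReal.ofReal_ne_top]
    · refine setLIntegral_congr_fun measurableSet_Ioi fun x hx => ?_
      have hx0 : 0 < x := hx
      rw [incrBound_mul hr hx0, ← ENNReal.ofReal_mul (by positivity), Real.mul_rpow hr.le hx0.le,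
        show r ^ (2 * α - γ) = (r ^ α) ^ 2 * r ^ (-γ) by
          rw [← Real.rpow_natCast, ← Real.rpow_mul hr.le, ← Real.rpow_add hr]
          congr 1
          push_cast
          ring]
      ring_nf
    · refine (ae_restrict_iff' measurableSet_Ioi).2 (Eventually.of_forall fun x hx => ?_)
      have hx0 : 0 < x := hx
      simp only [Pi.zero_apply]
      positivity
  rw [e, ← mul_assoc, ← ENNReal.ofReal_mul hr.le, ← ENNReal.ofReal_mul (by positivity)]
  refine ENNReal.ofReal_le_ofReal ?_
  rw [show r ^ (2 * α + 1 - γ) = r * r ^ (2 * α - γ) by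
    nth_rw 2 [← Real.rpow_one r]
    rw [← Real.rpow_add hr]
    ring_nf, mul_comm]
  gcongr
  linarith

/-- The truncated power `(t - u)₊ ^ b`. -/
noncomputable def truncPow (b t u : ℝ) : ℝ := if u < t then (t - u) ^ b else 0

theorem truncPow_nonneg (b t u : ℝ) : 0 ≤ truncPow b t u := by
  unfold truncPow; split_ifs with h
  · exact Real.rpow_nonneg (by linarith) _
  · rfl

theorem measurable_truncPow (b t : ℝ) : Measurable (truncPow b t) := by
  unfold truncPow
  exact Measurable.ite measurableSet_Iio (by fun_prop) (by fun_prop)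

theorem sq_rpow {x : ℝ} (hx : 0 ≤ x) (s : ℝ) : (x ^ s) ^ 2 = x ^ (2 * s) := by
  rw [← Real.rpow_natCast, ← Real.rpow_mul hx]; congr 1; push_cast; ring

theorem truncPow_sq {b t u : ℝ} : truncPow b t u ^ 2 = truncPow (2 * b) t u := by
  unfold truncPow
  split_ifs with h
  · rw [sq_rpow (by linarith)]
  · norm_num

theorem truncPow_mul {b t u : ℝ} (ht : 0 < t) : truncPow b t (t * u) = t ^ b * truncPow b 1 u := by
  have h1 : t * u < t ↔ u < 1 := by
    constructor <;> intro h <;> nlinarith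
  unfold truncPow
  simp only [h1]
  split_ifs with h
  · rw [show t - t * u = t * (1 - u) by ring, Real.mul_rpow ht.le (by linarith)]
  · simp

theorem integrableOn_truncPow_mul_rpow {p q : ℝ} (hp : -1 < p) (hq : -1 < q) :
    IntegrableOn (fun u => truncPow p 1 u * u ^ q) (Ioi 0) := by
  have h := (Complex.betaIntegral_convergent (u := ((q + 1 : ℝ) : ℂ)) (v := ((p + 1 : ℝ) : ℂ))
    (by simp; linarith) (by simp; linarith)).norm
  rw [intervalIntegrable_iff_integrableOn_Ioo_of_le zero_le_one] at h
  have h2 : IntegrableOn (fun u => truncPow p 1 u * u ^ q) (Ioo 0 1) := by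
    refine h.congr_fun (fun x hx => ?_) measurableSet_Ioo
    have hx1 : 0 < 1 - x := by linarith [hx.2]
    have hx0 : 0 < x := hx.1
    beta_reduce
    rw [norm_mul, show ((q + 1 : ℝ) : ℂ) - 1 = (q : ℂ) by push_cast; ring,
      show ((p + 1 : ℝ) : ℂ) - 1 = (p : ℂ) by push_cast; ring,
      show 1 - (x : ℂ) = ((1 - x : ℝ) : ℂ) by push_cast; ring, Complex.norm_cpow_real,
      Complex.norm_cpow_real, Complex.norm_real, Complex.norm_real, Real.norm_of_nonneg hx0.le,
      Real.norm_of_nonneg hx1.le, truncPow, if_pos hx.2, mul_comm]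
  refine h2.of_forall_sdiff_eq_zero measurableSet_Ioi fun x hx => ?_
  have : ¬ x < 1 := fun h => hx.2 ⟨hx.1, h⟩
  rw [truncPow, if_neg this, zero_mul]

theorem exists_lintegral_truncPow_sq_le {p γ : ℝ} (hγ : γ < 1) (hp : -1 / 2 < p) :
    ∃ C : ℝ, 0 < C ∧ ∀ t : ℝ, 0 ≤ t →
      ∫⁻ u in Ioi 0, ENNReal.ofReal (truncPow p t u ^ 2 * u ^ (-γ)) ≤
        ENNReal.ofReal (C * t ^ (2 * p + 1 - γ)) := by
  have hI := integrableOn_truncPow_mul_rpow (p := 2 * p) (q := -γ) (by linarith) (by linarith)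
  have h0 : 0 ≤ ∫ x in Ioi 0, truncPow (2 * p) 1 x * x ^ (-γ) :=
    setIntegral_nonneg measurableSet_Ioi fun x hx => by
      have : 0 < x := hx
      have := truncPow_nonneg (2 * p) 1 x
      positivity
  refine ⟨(∫ x in Ioi 0, truncPow (2 * p) 1 x * x ^ (-γ)) + 1, by linarith, fun t ht => ?_⟩
  rcases ht.eq_or_lt with rfl | ht
  · rw [setLIntegral_congr_fun (g := fun _ => 0) measurableSet_Ioi]
    · simp
    · intro u hu
      have : ¬ u < 0 := not_lt.2 (le_of_lt hu)
      simp [truncPow, this]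
  rw [setLIntegral_Ioi_mul_left_eq ht]
  have e : ∫⁻ x in Ioi 0, ENNReal.ofReal (truncPow p t (t * x) ^ 2 * (t * x) ^ (-γ)) =
      ENNReal.ofReal (t ^ (2 * p - γ)) *
        ENNReal.ofReal (∫ x in Ioi 0, truncPow (2 * p) 1 x * x ^ (-γ)) := by
    rw [ofReal_integral_eq_lintegral_ofReal hI, ← lintegral_const_mul' _ _ ENNReal.ofReal_ne_top]
    · refine setLIntegral_congr_fun measurableSet_Ioi fun x hx => ?_
      have hx0 : 0 < x := hx
      rw [truncPow_sq, truncPow_mul ht, ← ENNReal.ofReal_mul (by positivity),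
        Real.mul_rpow ht.le hx0.le,
        show t ^ (2 * p - γ) = t ^ (2 * p) * t ^ (-γ) by
          rw [← Real.rpow_add ht]
          ring_nf]
      ring_nf
    · refine (ae_restrict_iff' measurableSet_Ioi).2 (Eventually.of_forall fun x hx => ?_)
      have hx0 : 0 < x := hx
      have := truncPow_nonneg (2 * p) 1 x
      simp only [Pi.zero_apply]
      positivity
  rw [e, ← mul_assoc, ← ENNReal.ofReal_mul ht.le, ← ENNReal.ofReal_mul (by positivity)]
  refine ENNReal.ofReal_le_ofReal ?_
  rw [show t ^ (2 * p + 1 - γ) = t * t ^ (2 * p - γ) by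
    nth_rw 2 [← Real.rpow_one t]
    rw [← Real.rpow_add ht]
    ring_nf, mul_comm]
  gcongr
  linarith

theorem lintegral_eq_Ioi_add_Ioi (f : ℝ → ℝ≥0∞) :
    ∫⁻ u, f u = (∫⁻ u in Ioi 0, f u) + ∫⁻ u in Ioi 0, f (-u) := by
  rw [← lintegral_add_compl f (measurableSet_Ioi (a := (0 : ℝ)))]
  congr 1
  have e : ∫⁻ u in Ioi 0, f (-u) = ∫⁻ u in Iio 0, f u := by
    rw [← lintegral_indicator measurableSet_Ioi, ← lintegral_indicator measurableSet_Iio,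
      ← lintegral_neg_eq_self (indicator (Iio 0) f)]
    congr 1 with u
    simp [indicator]
  rw [e, compl_Ioi]
  exact setLIntegral_congr Iio_ae_eq_Iic.symm

theorem gfbmKer_neg_of_pos {α v x : ℝ} (hv : 0 ≤ v) (hx : 0 < x) :
    gfbmKer α v (-x) = (v + x) ^ α - x ^ α := by
  rw [gfbmKer, sub_neg_eq_add, neg_neg, max_eq_left (by linarith), max_eq_left hx.le]

theorem abs_gfbmKer_neg_le {α v r x : ℝ} (hα : α ≤ 1) (hv : 0 ≤ v) (hvr : v ≤ r) (hr : 0 < r)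
    (hx : 0 < x) : |gfbmKer α v (-x)| ≤ incrBound α r x := by
  have h := norm_cpow_add_sub_le hα hr hx (z := (v : ℂ)) (by simpa) (by
    rw [Complex.norm_real, Real.norm_of_nonneg hv]; linarith)
  rw [gfbmKer_neg_of_pos hv hx, ← Real.norm_eq_abs, ← Complex.norm_real]
  convert h using 2
  rw [Complex.ofReal_sub, Complex.ofReal_cpow (by linarith), Complex.ofReal_cpow hx.le]
  simp

theorem intervalIntegrable_one_sub_rpow {θ : ℝ} (hθ : 0 < θ) :
    IntervalIntegrable (fun w : ℝ => (1 - w) ^ (θ - 1)) volume 0 1 := by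
  have h := (intervalIntegral.intervalIntegrable_rpow' (a := 0) (b := 1) (r := θ - 1)
    (by linarith)).comp_sub_left 1
  simpa using h.symm

theorem integral_one_sub_rpow {θ : ℝ} (hθ : 0 < θ) :
    ∫ w in (0 : ℝ)..1, (1 - w) ^ (θ - 1) = θ⁻¹ := by
  rw [intervalIntegral.integral_comp_sub_left (fun w => w ^ (θ - 1)) 1, integral_rpow
    (Or.inl (by linarith))]
  simp [Real.zero_rpow hθ.ne']

theorem continuousOn_gfbmKer_neg {α t x : ℝ} (ht : 0 ≤ t) (hx : 0 < x) :
    ContinuousOn (fun w => gfbmKer α (t * w) (-x)) (uIcc 0 1) := by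
  unfold gfbmKer
  refine ContinuousOn.sub (ContinuousOn.rpow_const (by fun_prop) fun w hw => Or.inl ?_)
    continuousOn_const
  rw [uIcc_of_le zero_le_one] at hw
  have := mul_nonneg ht hw.1
  exact (lt_of_lt_of_le (by linarith) (le_max_left _ _)).ne'

theorem abs_integral_one_sub_rpow_mul_le {θ B : ℝ} (hθ : 0 < θ) {g : ℝ → ℝ}
    (hB : ∀ w ∈ Icc (0 : ℝ) 1, |g w| ≤ B) :
    |∫ w in (0 : ℝ)..1, (1 - w) ^ (θ - 1) * g w| ≤ θ⁻¹ * B := by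
  rw [← integral_one_sub_rpow hθ, ← intervalIntegral.integral_mul_const, ← Real.norm_eq_abs]
  refine intervalIntegral.norm_integral_le_of_norm_le zero_le_one ?_
    ((intervalIntegrable_one_sub_rpow hθ).mul_const B)
  refine Eventually.of_forall fun w hw => ?_
  have : 0 ≤ (1 - w) ^ (θ - 1) := Real.rpow_nonneg (by linarith [hw.2]) _
  rw [norm_mul, Real.norm_of_nonneg this]
  exact mul_le_mul_of_nonneg_left (hB w ⟨hw.1.le, hw.2⟩) this

theorem abs_fracKer_neg_le {α θ t r x : ℝ} (hα : α ≤ 1) (hθ : 0 < θ) (ht : 0 ≤ t) (htr : t ≤ r)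
    (hr : 0 < r) (hx : 0 < x) :
    |fracKer α θ t (-x)| ≤ (Real.Gamma θ)⁻¹ * θ⁻¹ * (r ^ θ * incrBound α r x) := by
  have hΓ := Real.Gamma_pos_of_pos hθ
  have hI := incrBound_nonneg (α := α) hr hx
  have h1 := abs_integral_one_sub_rpow_mul_le hθ (g := fun w => gfbmKer α (t * w) (-x))
    (B := incrBound α r x) fun w hw => abs_gfbmKer_neg_le hα (mul_nonneg ht hw.1)
      ((mul_le_of_le_one_right ht hw.2).trans htr) hr hx
  rw [fracKer_eq hθ ht, abs_mul, abs_mul, abs_of_pos (inv_pos.2 hΓ), abs_of_nonneg (by positivity)]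
  calc _ ≤ (Real.Gamma θ)⁻¹ * (r ^ θ * (θ⁻¹ * incrBound α r x)) := by gcongr
    _ = _ := by ring

theorem abs_sum_fracKer_neg_le_of_annihilates {ι : Type*} [Fintype ι] {m : ℕ} {a y : ι → ℝ}
    (hy : ∀ i, y i ∈ Icc (0 : ℝ) 1) (ha : ∀ n ≤ m, ∑ i, a i * y i ^ n = 0) {α θ : ℝ} (hα : α ≤ 1)
    (hθ : 0 < θ) {k x : ℝ} (hk : 4 ≤ k) (hx : 0 < x) :
    |∑ i, a i * fracKer α θ (k + y i) (-x)| ≤ (Real.Gamma θ)⁻¹ * θ⁻¹ *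
      (2 * (∑ i, |a i|) * ((2 * (k + 1)) ^ θ * incrBound α (k + 1) x) * (2 / k) ^ (m + 1)) := by
  have hΓ := Real.Gamma_pos_of_pos hθ
  have ht : ∀ i, 0 < k + y i := fun i => by linarith [(hy i).1]
  have e : ∑ i, a i * fracKer α θ (k + y i) (-x) = (Real.Gamma θ)⁻¹ *
      ∫ w in (0 : ℝ)..1, (1 - w) ^ (θ - 1) *
        ∑ i, a i * ((k + y i) ^ θ * gfbmKer α ((k + y i) * w) (-x)) := by
    simp_rw [Finset.mul_sum]
    rw [intervalIntegral.integral_finsetSum, Finset.mul_sum]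
    · refine Finset.sum_congr rfl fun i _ => ?_
      rw [fracKer_eq hθ (ht i).le, ← intervalIntegral.integral_const_mul]
      simp_rw [← intervalIntegral.integral_const_mul]
      congr 1 with w
      ring
    · intro i _
      have := (((intervalIntegrable_one_sub_rpow hθ).mul_continuousOn
        (continuousOn_gfbmKer_neg (α := α) (ht i).le hx)).const_mul (a i * (k + y i) ^ θ))
      refine this.congr fun w _ => ?_
      ring
  rw [e, abs_mul, abs_of_pos (inv_pos.2 hΓ), mul_assoc (Real.Gamma θ)⁻¹]
  refine mul_le_mul_of_nonneg_left (abs_integral_one_sub_rpow_mul_le hθ fun w hw => ?_)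
    (inv_pos.2 hΓ).le
  have hball : ∀ z ∈ Metric.ball (k : ℂ) k, 0 < z.re ∧ ‖z‖ ≤ 2 * k := by
    intro z hz
    rw [Metric.mem_ball, dist_eq_norm] at hz
    have h1 := (Complex.abs_re_le_norm (z - k)).trans_lt hz
    rw [Complex.sub_re, Complex.ofReal_re, abs_lt] at h1
    have h2 := norm_add_le (z - k) (k : ℂ)
    rw [sub_add_cancel, Complex.norm_real, Real.norm_of_nonneg (by linarith)] at h2
    exact ⟨by linarith, by linarith⟩
  have hF := norm_sum_mul_le_of_annihilates hy ha (c := (k : ℂ)) hk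
    (F := fun z => z ^ (θ : ℂ) * ((z * w + x) ^ (α : ℂ) - (x : ℂ) ^ (α : ℂ)))
    (B := (2 * (k + 1)) ^ θ * incrBound α (k + 1) x) ?_ ?_
  · rw [← Real.norm_eq_abs, ← Complex.norm_real]
    convert hF using 2
    rw [Complex.ofReal_sum]
    refine Finset.sum_congr rfl fun i _ => ?_
    have h3 : 0 ≤ (k + y i) * w := mul_nonneg (ht i).le hw.1
    rw [gfbmKer_neg_of_pos h3 hx, Complex.ofReal_mul, Complex.ofReal_mul, Complex.ofReal_sub,
      Complex.ofReal_cpow (ht i).le, Complex.ofReal_cpow (by linarith), Complex.ofReal_cpow hx.le]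
    push_cast
    ring
  · intro z hz
    have hz' := (hball z hz).1
    refine DifferentiableAt.differentiableWithinAt ?_
    refine DifferentiableAt.mul (differentiableAt_id.cpow_const (Or.inl hz'))
      (DifferentiableAt.sub (DifferentiableAt.cpow_const (by fun_prop) (Or.inl ?_)) (by fun_prop))
    have := mul_nonneg hz'.le hw.1
    simp only [Complex.add_re, Complex.mul_re, Complex.ofReal_re, Complex.ofReal_im, mul_zero,
      sub_zero]
    linarith
  · intro z hz
    obtain ⟨h1, h2⟩ := hball z hz
    have h3 : (0 : ℝ) < k + 1 := by linarith
    rw [norm_mul, Complex.norm_cpow_real]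
    refine mul_le_mul (Real.rpow_le_rpow (norm_nonneg _) (by linarith) hθ.le)
      (norm_cpow_add_sub_le hα h3 hx ?_ ?_) (norm_nonneg _) (by positivity)
    · have := mul_nonneg h1.le hw.1
      simpa using this
    · rw [norm_mul, Complex.norm_real, Real.norm_of_nonneg hw.1]
      have := mul_le_of_le_one_right (norm_nonneg z) hw.2
      linarith

theorem exists_abs_sum_fracKer_neg_le {ι : Type*} [Fintype ι] {m : ℕ} {a y : ι → ℝ}
    (hy : ∀ i, y i ∈ Icc (0 : ℝ) 1) (ha : ∀ n ≤ m, ∑ i, a i * y i ^ n = 0) {α θ : ℝ} (hα : α ≤ 1)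
    (hθ : 0 < θ) : ∃ C : ℝ, 0 < C ∧ ∀ k : ℕ, ∀ x : ℝ, 0 < x →
      |∑ i, a i * fracKer α θ (k + y i) (-x)| ≤
        C * ((k : ℝ) + 1) ^ (θ - (m + 1)) * incrBound α (k + 1) x := by
  have hΓ := Real.Gamma_pos_of_pos hθ
  have hA : 0 ≤ ∑ i, |a i| := Finset.sum_nonneg fun i _ => abs_nonneg _
  refine ⟨(Real.Gamma θ)⁻¹ * θ⁻¹ * (2 * (∑ i, |a i|) * 2 ^ θ * 4 ^ (m + 1)) + 1, by positivity,
    fun k x hx => ?_⟩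
  have hk0 : (0 : ℝ) < (k : ℝ) + 1 := by positivity
  have hI := incrBound_nonneg (α := α) hk0 hx
  have hexp : ((k : ℝ) + 1) ^ θ = ((k : ℝ) + 1) ^ (θ - (m + 1)) * ((k : ℝ) + 1) ^ (m + 1) := by
    rw [← Real.rpow_natCast, ← Real.rpow_add hk0]
    congr 1
    push_cast
    ring
  have key : |∑ i, a i * fracKer α θ (k + y i) (-x)| ≤
      ((Real.Gamma θ)⁻¹ * θ⁻¹ * (2 * (∑ i, |a i|) * 2 ^ θ * 4 ^ (m + 1))) *
        ((k : ℝ) + 1) ^ (θ - (m + 1)) * incrBound α (k + 1) x := by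
    rcases le_or_gt 4 k with hk | hk
    · have hk' : (4 : ℝ) ≤ k := by exact_mod_cast hk
      refine (abs_sum_fracKer_neg_le_of_annihilates hy ha hα hθ hk' hx).trans ?_
      have h1 : (2 / (k : ℝ)) ^ (m + 1) ≤ (4 / ((k : ℝ) + 1)) ^ (m + 1) := by
        refine pow_le_pow_left₀ (by positivity) ?_ _
        rw [div_le_div_iff₀ (by linarith) hk0]
        linarith
      calc _ ≤ (Real.Gamma θ)⁻¹ * θ⁻¹ * (2 * (∑ i, |a i|) * ((2 * ((k : ℝ) + 1)) ^ θ *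
            incrBound α (k + 1) x) * (4 / ((k : ℝ) + 1)) ^ (m + 1)) := by gcongr
        _ = _ := by
          rw [Real.mul_rpow (by norm_num) hk0.le, hexp, div_pow]
          field_simp
    · have h1 : ∀ i, |fracKer α θ (k + y i) (-x)| ≤
          (Real.Gamma θ)⁻¹ * θ⁻¹ * (((k : ℝ) + 1) ^ θ * incrBound α (k + 1) x) := fun i =>
        abs_fracKer_neg_le hα hθ (add_nonneg (by positivity) (hy i).1) (by linarith [(hy i).2])
          hk0 hx
      have h2 : ((k : ℝ) + 1) ^ (m + 1) ≤ 4 ^ (m + 1) := by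
        have : (k : ℝ) ≤ 3 := by exact_mod_cast Nat.lt_succ_iff.1 hk
        exact pow_le_pow_left₀ hk0.le (by linarith) _
      have h3 : (1 : ℝ) ≤ 2 * 2 ^ θ := by
        have := Real.one_le_rpow (x := 2) (by norm_num) hθ.le
        linarith
      calc _ ≤ ∑ i, |a i| * ((Real.Gamma θ)⁻¹ * θ⁻¹ * (((k : ℝ) + 1) ^ θ * incrBound α
        (k + 1) x)) := by
            refine (Finset.abs_sum_le_sum_abs _ _).trans (Finset.sum_le_sum fun i _ => ?_)
            rw [abs_mul]
            exact mul_le_mul_of_nonneg_left (h1 i) (abs_nonneg _)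
        _ = 1 * ((Real.Gamma θ)⁻¹ * θ⁻¹ * (∑ i, |a i|) * ((k : ℝ) + 1) ^ (θ - (m + 1)) *
            ((k : ℝ) + 1) ^ (m + 1) * incrBound α (k + 1) x) := by
          rw [← Finset.sum_mul, hexp]
          ring
        _ ≤ (2 * 2 ^ θ) * ((Real.Gamma θ)⁻¹ * θ⁻¹ * (∑ i, |a i|) * ((k : ℝ) + 1) ^ (θ - (m + 1)) *
            4 ^ (m + 1) * incrBound α (k + 1) x) := by gcongr
        _ = _ := by ring
  refine key.trans ?_
  gcongr
  linarith

theorem exists_lintegral_sum_fracKer_neg_le {ι : Type*} [Fintype ι] {m : ℕ} {a y : ι → ℝ}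
    (hy : ∀ i, y i ∈ Icc (0 : ℝ) 1) (ha : ∀ n ≤ m, ∑ i, a i * y i ^ n = 0) {α γ θ : ℝ}
    (hγ0 : 0 ≤ γ) (hγ : γ < 1) (hα : -1 / 2 + γ / 2 < α) (hα' : α < 1 / 2) (hθ : 0 < θ)
    (hm : α + θ + 1 / 2 ≤ m + 1) : ∃ C : ℝ, 0 < C ∧ ∀ k : ℕ,
      ∫⁻ x in Ioi 0, ENNReal.ofReal
        ((∑ i, a i * fracKer α θ (k + y i) (-x)) ^ 2 * |-x| ^ (-γ)) ≤
        ENNReal.ofReal (C * ((k : ℝ) + 1) ^ (-γ)) := by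
  obtain ⟨C, hC, h⟩ := exists_abs_sum_fracKer_neg_le hy ha (α := α) (by linarith) hθ
  obtain ⟨D, hD, hI⟩ := exists_lintegral_incrBound_sq_le hγ0 hγ hα hα'
  refine ⟨C ^ 2 * D, by positivity, fun k => ?_⟩
  have hk0 : (0 : ℝ) < (k : ℝ) + 1 := by positivity
  have hk1 : (1 : ℝ) ≤ (k : ℝ) + 1 := by linarith [(Nat.cast_nonneg k : (0 : ℝ) ≤ k)]
  calc _ ≤ ∫⁻ x in Ioi 0, ENNReal.ofReal ((C * ((k : ℝ) + 1) ^ (θ - (m + 1))) ^ 2) *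
        ENNReal.ofReal (incrBound α (k + 1) x ^ 2 * x ^ (-γ)) := by
        refine setLIntegral_mono' measurableSet_Ioi fun x hx => ?_
        have hx0 : 0 < x := hx
        rw [← ENNReal.ofReal_mul (by positivity), abs_neg, abs_of_pos hx0]
        refine ENNReal.ofReal_le_ofReal ?_
        rw [← mul_assoc, ← mul_pow]
        gcongr ?_ * _
        exact sq_le_sq' (abs_le.1 (h k x hx0)).1 (abs_le.1 (h k x hx0)).2
    _ ≤ ENNReal.ofReal ((C * ((k : ℝ) + 1) ^ (θ - (m + 1))) ^ 2) *
        ENNReal.ofReal (D * ((k : ℝ) + 1) ^ (2 * α + 1 - γ)) := by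
        rw [lintegral_const_mul' _ _ ENNReal.ofReal_ne_top]
        gcongr
        exact hI _ hk0
    _ ≤ _ := by
        rw [← ENNReal.ofReal_mul (by positivity)]
        refine ENNReal.ofReal_le_ofReal ?_
        rw [mul_pow, sq_rpow hk0.le]
        have : ((k : ℝ) + 1) ^ (2 * (θ - (m + 1))) * ((k : ℝ) + 1) ^ (2 * α + 1 - γ) ≤
            ((k : ℝ) + 1) ^ (-γ) := by
          rw [← Real.rpow_add hk0]
          exact Real.rpow_le_rpow_of_exponent_le hk1 (by linarith)
        calc _ = C ^ 2 * D * (((k : ℝ) + 1) ^ (2 * (θ - (m + 1))) *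
              ((k : ℝ) + 1) ^ (2 * α + 1 - γ)) := by ring
          _ ≤ _ := by gcongr

theorem exists_abs_sum_rpow_le_of_annihilates {ι : Type*} [Fintype ι] {m : ℕ} {a y : ι → ℝ}
    (hy : ∀ i, y i ∈ Icc (0 : ℝ) 1) (ha : ∀ n ≤ m, ∑ i, a i * y i ^ n = 0) (b : ℝ) :
    ∃ C : ℝ, 0 < C ∧ ∀ d : ℝ, 8 ≤ d → |∑ i, a i * (d + y i) ^ b| ≤ C * d ^ (b - (m + 1)) := by
  have hA : 0 ≤ ∑ i, |a i| := Finset.sum_nonneg fun i _ => abs_nonneg _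
  refine ⟨2 * (∑ i, |a i|) * 2 ^ |b| * 4 ^ (m + 1) + 1, by positivity, fun d hd => ?_⟩
  have hd0 : 0 < d := by linarith
  have hball : ∀ z ∈ Metric.ball (d : ℂ) (d / 2), 0 < z.re ∧ d / 2 ≤ ‖z‖ ∧ ‖z‖ ≤ 2 * d := by
    intro z hz
    rw [Metric.mem_ball, dist_eq_norm] at hz
    have h1 := (Complex.abs_re_le_norm (z - d)).trans_lt hz
    rw [Complex.sub_re, Complex.ofReal_re, abs_lt] at h1
    have h2 := norm_add_le (z - d) (d : ℂ)
    rw [sub_add_cancel, Complex.norm_real, Real.norm_of_nonneg hd0.le] at h2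
    exact ⟨by linarith, by linarith [Complex.re_le_norm z], by linarith⟩
  have hF := norm_sum_mul_le_of_annihilates hy ha (c := (d : ℂ)) (R := d / 2) (by linarith)
    (F := fun z => z ^ (b : ℂ)) (B := 2 ^ |b| * d ^ b) ?_ ?_
  · rw [← Real.norm_eq_abs, ← Complex.norm_real]
    have e : ((∑ i, a i * (d + y i) ^ b : ℝ) : ℂ) =
        ∑ i, (a i : ℂ) * (fun z => z ^ (b : ℂ)) ((d : ℂ) + y i) := by
      rw [Complex.ofReal_sum]
      refine Finset.sum_congr rfl fun i _ => ?_
      have h3 : 0 ≤ d + y i := by linarith [(hy i).1]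
      rw [Complex.ofReal_mul, Complex.ofReal_cpow h3]
      push_cast
      ring
    rw [e]
    refine hF.trans ?_
    have hexp : d ^ b = d ^ (b - (m + 1)) * d ^ (m + 1) := by
      rw [← Real.rpow_natCast, ← Real.rpow_add hd0]
      congr 1
      push_cast
      ring
    rw [add_mul]
    have : 0 ≤ 1 * d ^ (b - (m + 1)) := by positivity
    refine le_trans (le_of_eq ?_) (le_add_of_nonneg_right this)
    rw [hexp, show 2 / (d / 2) = 4 / d by field_simp; norm_num, div_pow]
    field_simp
  · intro z hz
    exact (differentiableAt_id.cpow_const (Or.inl (hball z hz).1)).differentiableWithinAt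
  · intro z hz
    obtain ⟨-, h1, h2⟩ := hball z hz
    rw [Complex.norm_cpow_real]
    rcases le_total 0 b with h0 | h0
    · rw [abs_of_nonneg h0, ← Real.mul_rpow (by norm_num) hd0.le]
      exact Real.rpow_le_rpow (norm_nonneg _) h2 h0
    · rw [abs_of_nonpos h0, Real.rpow_neg (by norm_num), ← Real.inv_rpow (by norm_num),
        ← Real.mul_rpow (by norm_num) hd0.le]
      exact Real.rpow_le_rpow_of_nonpos (by positivity) (by linarith) h0

theorem sum_truncPow_sq_le {ι : Type*} [Fintype ι] (a t : ι → ℝ) (b u : ℝ) :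
    (∑ i, a i * truncPow b (t i) u) ^ 2 ≤ (∑ i, a i ^ 2) * ∑ i, truncPow b (t i) u ^ 2 :=
  Finset.sum_mul_sq_le_sq_mul_sq _ _ _

/-- The function `x ^ p` on `(0, 9)`, extended by zero. -/
noncomputable def nearPow (p x : ℝ) : ℝ := (Ioo (0 : ℝ) 9).indicator (fun x => x ^ p) x

/-- The function `x ^ (-2)` on `(1, ∞)`, extended by zero. -/
noncomputable def farPow (x : ℝ) : ℝ := (Ioi (1 : ℝ)).indicator (fun x => x ^ (-2 : ℝ)) x

/-- The function `x ^ (-γ)` on `(0, 1)`, extended by zero. -/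
noncomputable def zeroPow (γ x : ℝ) : ℝ := (Ioo (0 : ℝ) 1).indicator (fun x => x ^ (-γ)) x

theorem nearPow_nonneg (p x : ℝ) : 0 ≤ nearPow p x :=
  indicator_nonneg (fun _ hx => Real.rpow_nonneg hx.1.le _) _

theorem farPow_nonneg (x : ℝ) : 0 ≤ farPow x :=
  indicator_nonneg (fun _ hx => Real.rpow_nonneg (zero_le_one.trans (le_of_lt hx)) _) _

theorem zeroPow_nonneg (γ x : ℝ) : 0 ≤ zeroPow γ x :=
  indicator_nonneg (fun _ hx => Real.rpow_nonneg hx.1.le _) _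

theorem integrable_nearPow {p : ℝ} (hp : -1 < p) : Integrable (nearPow p) := by
  have h := intervalIntegral.intervalIntegrable_rpow' (a := 0) (b := 9) hp
  rw [intervalIntegrable_iff_integrableOn_Ioo_of_le (by norm_num)] at h
  exact h.integrable_indicator measurableSet_Ioo

theorem integrable_farPow : Integrable farPow :=
  (integrableOn_Ioi_rpow_of_lt (by norm_num) zero_lt_one).integrable_indicator measurableSet_Ioi

theorem integrable_zeroPow {γ : ℝ} (hγ : γ < 1) : Integrable (zeroPow γ) := by
  have h := intervalIntegral.intervalIntegrable_rpow' (a := 0) (b := 1) (r := -γ) (by linarith)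
  rw [intervalIntegrable_iff_integrableOn_Ioo_of_le (by norm_num)] at h
  exact h.integrable_indicator measurableSet_Ioo

theorem exists_sum_truncPow_sq_mul_le {ι : Type*} [Fintype ι] {m : ℕ} {a y : ι → ℝ}
    (hy : ∀ i, y i ∈ Icc (0 : ℝ) 1) (ha : ∀ n ≤ m, ∑ i, a i * y i ^ n = 0) {b γ : ℝ}
    (hγ0 : 0 ≤ γ) (hγ : γ < 1) (hm : b + 3 / 2 ≤ m + 1) : ∃ C : ℝ, 0 < C ∧ ∀ k u : ℝ, 10 ≤ k →
      0 < u → (∑ i, a i * truncPow b (k + y i) u) ^ 2 * u ^ (-γ) ≤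
        C * (k + 1) ^ (-γ) * (zeroPow γ u + farPow (k - u) + ∑ i, nearPow (2 * b)
          (k + y i - u)) := by
  obtain ⟨C, hC, h⟩ := exists_abs_sum_rpow_le_of_annihilates hy ha b
  have hA : 0 ≤ ∑ i, a i ^ 2 := Finset.sum_nonneg fun i _ => sq_nonneg _
  refine ⟨3 * C ^ 2 + 10 * ∑ i, a i ^ 2, by positivity, fun k u hk hu => ?_⟩
  have hk0 : 0 < k + 1 := by linarith
  have hz := zeroPow_nonneg γ u
  have hf := farPow_nonneg (k - u)
  have hn : 0 ≤ ∑ i, nearPow (2 * b) (k + y i - u) :=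
    Finset.sum_nonneg fun i _ => nearPow_nonneg _ _
  suffices H : (k + 1) ^ γ * ((∑ i, a i * truncPow b (k + y i) u) ^ 2 * u ^ (-γ)) ≤
      (3 * C ^ 2 + 10 * ∑ i, a i ^ 2) *
        (zeroPow γ u + farPow (k - u) + ∑ i, nearPow (2 * b) (k + y i - u)) by
    have hp : 0 < (k + 1) ^ γ := by positivity
    rw [Real.rpow_neg hk0.le, mul_right_comm, ← div_eq_mul_inv, le_div_iff₀ hp, mul_comm _
      ((k + 1) ^ γ)]
    exact H
  rcases le_or_gt u (k - 8) with hd | hd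
  · set d := k - u with hdd
    have hd8 : 8 ≤ d := by linarith
    have hd0 : 0 < d := by linarith
    have e : ∑ i, a i * truncPow b (k + y i) u = ∑ i, a i * (d + y i) ^ b := by
      refine Finset.sum_congr rfl fun i _ => ?_
      rw [truncPow, if_pos (by linarith [(hy i).1]), show k + y i - u = d + y i by rw [hdd]; ring]
    have h1 : (∑ i, a i * truncPow b (k + y i) u) ^ 2 ≤ C ^ 2 * d ^ (-3 : ℝ) := by
      have h2 := h d hd8
      have h3 : C * d ^ (b - (m + 1)) ≤ C * d ^ (-(3 / 2) : ℝ) := by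
        gcongr
        · linarith
        · linarith
      rw [e, ← sq_abs]
      refine (pow_le_pow_left₀ (abs_nonneg _) (h2.trans h3) 2).trans (le_of_eq ?_)
      rw [mul_pow, sq_rpow hd0.le]
      norm_num
    have h4 : farPow d = d ^ (-2 : ℝ) := by
      rw [farPow, indicator_of_mem]
      exact (by linarith : 1 < d)
    have h5 : d ^ (-2 : ℝ) = d * d ^ (-3 : ℝ) := by
      nth_rw 2 [← Real.rpow_one d]
      rw [← Real.rpow_add hd0]
      norm_num
    have h6 : d ^ (-2 : ℝ) ≤ 1 := Real.rpow_le_one_of_one_le_of_nonpos (by linarith) (by norm_num)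
    have h7 : (k + 1) ^ γ * (d ^ (-3 : ℝ) * u ^ (-γ)) ≤ 3 * (zeroPow γ u + farPow d) := by
      rcases lt_or_ge u 1 with hu1 | hu1
      · have h8 : zeroPow γ u = u ^ (-γ) := by
          rw [zeroPow, indicator_of_mem]
          exact ⟨hu, hu1⟩
        have h9 : (k + 1) ^ γ ≤ 3 * d :=
          (Real.rpow_le_self_of_one_le (by linarith) hγ.le).trans (by linarith)
        calc _ ≤ 3 * d * (d ^ (-3 : ℝ) * u ^ (-γ)) := by gcongr
          _ = 3 * d ^ (-2 : ℝ) * u ^ (-γ) := by rw [h5]; ring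
          _ ≤ 3 * 1 * u ^ (-γ) := by gcongr
          _ ≤ _ := by rw [h8]; linarith
      · have h9 : (k + 1) ^ γ * u ^ (-γ) ≤ 3 * d := by
          rw [Real.rpow_neg hu.le, ← div_eq_mul_inv, ← Real.div_rpow hk0.le hu.le]
          refine (Real.rpow_le_self_of_one_le ?_ hγ.le).trans ?_
          · rw [le_div_iff₀ hu]; linarith
          · rw [div_le_iff₀ hu]; nlinarith
        calc _ = (k + 1) ^ γ * u ^ (-γ) * d ^ (-3 : ℝ) := by ring
          _ ≤ 3 * d * d ^ (-3 : ℝ) := by gcongr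
          _ = 3 * farPow d := by rw [h4, h5]; ring
          _ ≤ _ := by linarith
    calc _ ≤ (k + 1) ^ γ * ((C ^ 2 * d ^ (-3 : ℝ)) * u ^ (-γ)) := by gcongr
      _ = C ^ 2 * ((k + 1) ^ γ * (d ^ (-3 : ℝ) * u ^ (-γ))) := by ring
      _ ≤ C ^ 2 * (3 * (zeroPow γ u + farPow d)) := by gcongr
      _ ≤ _ := by
        have h10 : 0 ≤ (∑ i, a i ^ 2) *
          (zeroPow γ u + farPow d + ∑ i, nearPow (2 * b) (k + y i - u)) := by positivity
        have h11 : 0 ≤ C ^ 2 * ∑ i, nearPow (2 * b) (k + y i - u) := by positivity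
        linarith
  · have h1 : ∀ i, truncPow b (k + y i) u ^ 2 = nearPow (2 * b) (k + y i - u) := by
      intro i
      rw [truncPow_sq, truncPow, nearPow]
      split_ifs with hi
      · rw [indicator_of_mem]
        exact ⟨by linarith, by linarith [(hy i).2]⟩
      · rw [indicator_of_notMem]
        exact fun h => hi (by linarith [h.1])
    have h2 : (k + 1) ^ γ * u ^ (-γ) ≤ 10 := by
      rw [Real.rpow_neg hu.le, ← div_eq_mul_inv, ← Real.div_rpow hk0.le hu.le]
      have h3 : (k + 1) / u ≤ 10 := by rw [div_le_iff₀ hu]; linarith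
      rcases le_total 1 ((k + 1) / u) with h4 | h4
      · exact (Real.rpow_le_self_of_one_le h4 hγ.le).trans h3
      · exact (Real.rpow_le_one (by positivity) h4 hγ0).trans (by norm_num)
    have h5 := sum_truncPow_sq_le a (fun i => k + y i) b u
    simp only [h1] at h5
    calc _ ≤ (k + 1) ^ γ * (((∑ i, a i ^ 2) * ∑ i, nearPow (2 * b) (k + y i - u)) * u ^ (-γ)) := by
          gcongr
      _ = ((k + 1) ^ γ * u ^ (-γ)) * ((∑ i, a i ^ 2) * ∑ i, nearPow (2 * b) (k + y i - u)) := by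
        ring
      _ ≤ 10 * ((∑ i, a i ^ 2) * ∑ i, nearPow (2 * b) (k + y i - u)) := by gcongr
      _ ≤ _ := by
        have h10 : 0 ≤ (∑ i, a i ^ 2) * (zeroPow γ u + farPow (k - u)) := by positivity
        have h11 : 0 ≤ C ^ 2 * (zeroPow γ u + farPow (k - u) +
          ∑ i, nearPow (2 * b) (k + y i - u)) := by positivity
        linarith

theorem exists_lintegral_sum_truncPow_le {ι : Type*} [Fintype ι] {m : ℕ} {a y : ι → ℝ}
    (hy : ∀ i, y i ∈ Icc (0 : ℝ) 1) (ha : ∀ n ≤ m, ∑ i, a i * y i ^ n = 0) {b γ : ℝ}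
    (hγ0 : 0 ≤ γ) (hγ : γ < 1) (hb : -1 / 2 + γ / 2 < b) (hm : b + 3 / 2 ≤ m + 1) :
    ∃ C : ℝ, 0 < C ∧ ∀ k : ℕ,
      ∫⁻ u in Ioi 0, ENNReal.ofReal ((∑ i, a i * truncPow b (k + y i) u) ^ 2 * u ^ (-γ)) ≤
        ENNReal.ofReal (C * ((k : ℝ) + 1) ^ (-γ)) := by
  obtain ⟨C, hC, h⟩ := exists_sum_truncPow_sq_mul_le hy ha hγ0 hγ hm
  obtain ⟨D, hD, hI⟩ := exists_lintegral_truncPow_sq_le hγ (p := b) (by linarith)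
  have hA : 0 ≤ ∑ i, a i ^ 2 := Finset.sum_nonneg fun i _ => sq_nonneg _
  set n : ℝ := (Fintype.card ι : ℝ) with hn
  have hn0 : 0 ≤ n := by positivity
  set J := (∫ u, zeroPow γ u) + (∫ u, farPow u) + n * ∫ u, nearPow (2 * b) u with hJ
  have hJ0 : 0 ≤ J := by
    have : 0 ≤ ∫ u, zeroPow γ u := integral_nonneg fun x => zeroPow_nonneg γ x
    have : 0 ≤ ∫ u, farPow u := integral_nonneg fun x => farPow_nonneg x
    have : 0 ≤ ∫ u, nearPow (2 * b) u := integral_nonneg fun x => nearPow_nonneg (2 * b) x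
    positivity
  refine ⟨C * J + 10 * ((∑ i, a i ^ 2) * (n * (D * 10 ^ (2 * b + 1 - γ)))) + 1, by positivity,
    fun k => ?_⟩
  have hk0 : (0 : ℝ) < (k : ℝ) + 1 := by positivity
  rcases le_or_gt 10 k with hk | hk
  · have hk' : (10 : ℝ) ≤ k := by exact_mod_cast hk
    have i1 := integrable_zeroPow hγ
    have i2 : Integrable fun u => farPow (k - u) := integrable_farPow.comp_sub_left _
    have i3 : ∀ i, Integrable fun u => nearPow (2 * b) (k + y i - u) := fun i =>
      (integrable_nearPow (by linarith)).comp_sub_left _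
    have i12 : Integrable fun u => zeroPow γ u + farPow (k - u) := i1.add i2
    have i4 : Integrable fun u => zeroPow γ u + farPow (k - u) + ∑ i, nearPow (2 * b)
      (k + y i - u) :=
      i12.add (integrable_finsetSum _ fun i _ => i3 i)
    have eJ : ∫ u, (zeroPow γ u + farPow (k - u) + ∑ i, nearPow (2 * b) (k + y i - u)) = J := by
      rw [integral_add i12 (integrable_finsetSum _ fun i _ => i3 i), integral_add i1 i2,
        integral_finsetSum _ fun i _ => i3 i, integral_sub_left_eq_self farPow]
      simp_rw [integral_sub_left_eq_self (nearPow (2 * b))]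
      simp [hJ, hn]
    calc _ ≤ ∫⁻ u in Ioi 0, ENNReal.ofReal (C * ((k : ℝ) + 1) ^ (-γ) *
          (zeroPow γ u + farPow (k - u) + ∑ i, nearPow (2 * b) (k + y i - u))) :=
          setLIntegral_mono' measurableSet_Ioi fun u hu => ENNReal.ofReal_le_ofReal (h k u hk' hu)
      _ ≤ ∫⁻ u, ENNReal.ofReal (C * ((k : ℝ) + 1) ^ (-γ) *
          (zeroPow γ u + farPow (k - u) + ∑ i, nearPow (2 * b) (k + y i - u))) :=
          setLIntegral_le_lintegral _ _
      _ = ENNReal.ofReal (C * ((k : ℝ) + 1) ^ (-γ) * J) := by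
          rw [← ofReal_integral_eq_lintegral_ofReal (i4.const_mul _), integral_const_mul, eJ]
          refine Eventually.of_forall fun u => ?_
          have := zeroPow_nonneg γ u
          have := farPow_nonneg (k - u)
          have : 0 ≤ ∑ i, nearPow (2 * b) (k + y i - u) :=
            Finset.sum_nonneg fun i _ => nearPow_nonneg _ _
          simp only [Pi.zero_apply]
          positivity
      _ ≤ _ := by
          refine ENNReal.ofReal_le_ofReal ?_
          have : 0 ≤ (10 * ((∑ i, a i ^ 2) * (n * (D * 10 ^ (2 * b + 1 - γ)))) + 1) *
            ((k : ℝ) + 1) ^ (-γ) := by positivity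
          linarith
  · have hk' : (k : ℝ) + 1 ≤ 10 := by exact_mod_cast hk
    have hk1 : 1 ≤ 10 * ((k : ℝ) + 1) ^ (-γ) := by
      rw [Real.rpow_neg hk0.le, ← div_eq_mul_inv, le_div_iff₀ (by positivity), one_mul]
      have : (1 : ℝ) ≤ (k : ℝ) + 1 := by linarith [(Nat.cast_nonneg k : (0 : ℝ) ≤ k)]
      exact (Real.rpow_le_self_of_one_le this hγ.le).trans hk'
    calc _ ≤ ∫⁻ u in Ioi 0, ENNReal.ofReal (∑ i, a i ^ 2) *
          ∑ i, ENNReal.ofReal (truncPow b (k + y i) u ^ 2 * u ^ (-γ)) := by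
          refine setLIntegral_mono' measurableSet_Ioi fun u hu => ?_
          have hu0 : 0 < u := hu
          rw [← ENNReal.ofReal_sum_of_nonneg fun i _ => by positivity, ← ENNReal.ofReal_mul hA,
            ← Finset.sum_mul, ← mul_assoc]
          refine ENNReal.ofReal_le_ofReal ?_
          gcongr
          exact sum_truncPow_sq_le a (fun i => k + y i) b u
      _ = ENNReal.ofReal (∑ i, a i ^ 2) *
          ∑ i, ∫⁻ u in Ioi 0, ENNReal.ofReal (truncPow b (k + y i) u ^ 2 * u ^ (-γ)) := by
          rw [lintegral_const_mul' _ _ ENNReal.ofReal_ne_top, lintegral_finsetSum]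
          intro i _
          have := measurable_truncPow b (k + y i)
          fun_prop
      _ ≤ ENNReal.ofReal (∑ i, a i ^ 2) * ∑ i : ι, ENNReal.ofReal (D * 10 ^ (2 * b + 1 - γ)) := by
          gcongr with i
          have h0 : 0 ≤ (k : ℝ) + y i := add_nonneg (by positivity) (hy i).1
          refine (hI _ h0).trans (ENNReal.ofReal_le_ofReal ?_)
          gcongr
          · linarith
          · linarith [(hy i).2]
      _ = ENNReal.ofReal ((∑ i, a i ^ 2) * (n * (D * 10 ^ (2 * b + 1 - γ)))) := by
          rw [Finset.sum_const, Finset.card_univ, nsmul_eq_mul, ENNReal.ofReal_mul hA,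
            ENNReal.ofReal_mul hn0, hn, ENNReal.ofReal_natCast]
      _ ≤ _ := by
          refine ENNReal.ofReal_le_ofReal ?_
          set Q := (∑ i, a i ^ 2) * (n * (D * 10 ^ (2 * b + 1 - γ))) with hQ
          have hQ0 : 0 ≤ Q := by positivity
          have h1 : 0 ≤ (C * J + 1) * ((k : ℝ) + 1) ^ (-γ) := by positivity
          nlinarith [mul_le_mul_of_nonneg_left hk1 hQ0]

theorem exists_lintegral_sum_fracKer_le {ι : Type*} [Fintype ι] {m : ℕ} {a y : ι → ℝ}
    (hy : ∀ i, y i ∈ Icc (0 : ℝ) 1) (ha : ∀ n ≤ m, ∑ i, a i * y i ^ n = 0) {α γ θ : ℝ}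
    (hγ0 : 0 ≤ γ) (hγ : γ < 1) (hα : -1 / 2 + γ / 2 < α) (hα' : α < 1 / 2) (hθ : 0 < θ)
    (hm : α + θ + 3 / 2 ≤ m + 1) : ∃ C : ℝ, 0 < C ∧ ∀ k : ℕ,
      ∫⁻ u, ENNReal.ofReal ((∑ i, a i * fracKer α θ (k + y i) u) ^ 2 * |u| ^ (-γ)) ≤
        ENNReal.ofReal (C * ((k : ℝ) + 1) ^ (-γ)) := by
  rcases eq_or_ne α 0 with rfl | hα0
  · exact ⟨1, one_pos, fun k => by simp⟩
  obtain ⟨C, hC, h1⟩ := exists_lintegral_sum_fracKer_neg_le hy ha hγ0 hγ hα hα' hθ (by linarith)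
  obtain ⟨D, hD, h2⟩ := exists_lintegral_sum_truncPow_le hy ha hγ0 hγ (b := α + θ) (by linarith)
    (by linarith)
  set c := (Real.Gamma θ)⁻¹ * ∫ w in (0 : ℝ)..1, (1 - w) ^ (θ - 1) * w ^ α with hc
  refine ⟨c ^ 2 * D + C, by positivity, fun k => ?_⟩
  rw [lintegral_eq_Ioi_add_Ioi, add_mul, ENNReal.ofReal_add (by positivity) (by positivity)]
  refine add_le_add ?_ (h1 k)
  rw [mul_assoc, ENNReal.ofReal_mul (by positivity)]
  refine le_trans (le_of_eq ?_) (mul_le_mul_right (h2 k) _)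
  rw [← lintegral_const_mul' _ _ ENNReal.ofReal_ne_top]
  refine setLIntegral_congr_fun measurableSet_Ioi fun u hu => ?_
  have hu0 : 0 < u := hu
  have e : ∑ i, a i * fracKer α θ (k + y i) u = c * ∑ i, a i * truncPow (α + θ) (k + y i) u := by
    rw [Finset.mul_sum]
    refine Finset.sum_congr rfl fun i _ => ?_
    have : 0 ≤ (k : ℝ) + y i := add_nonneg (by positivity) (hy i).1
    rw [fracKer_of_pos hα0 this hu0, truncPow]
    split_ifs
    · ring
    · simp
  rw [← ENNReal.ofReal_mul (by positivity), e, abs_of_pos hu0]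
  ring_nf

theorem exists_lintegral_sum_fracKer_dyadic_le {ι : Type*} [Fintype ι] {m : ℕ} {a y : ι → ℝ}
    (hy : ∀ i, y i ∈ Icc (0 : ℝ) 1) (ha : ∀ n ≤ m, ∑ i, a i * y i ^ n = 0) {α γ θ : ℝ}
    (hγ0 : 0 ≤ γ) (hγ : γ < 1) (hα : -1 / 2 + γ / 2 < α) (hα' : α < 1 / 2) (hθ : 0 < θ)
    (hm : α + θ + 3 / 2 ≤ m + 1) : ∃ C : ℝ, 0 < C ∧ ∀ n k : ℕ,
      ∫⁻ u, ENNReal.ofReal ((∑ i, a i * fracKer α θ ((k + y i) / 2 ^ n) u) ^ 2 * |u| ^ (-γ)) ≤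
        ENNReal.ofReal (C * (2 ^ n) ^ (-2 * (α + θ + 1 / 2)) * (((k : ℝ) + 1) / 2 ^ n) ^ (-γ)) := by
  obtain ⟨C, hC, h⟩ := exists_lintegral_sum_fracKer_le hy ha hγ0 hγ hα hα' hθ hm
  refine ⟨C, hC, fun n k => ?_⟩
  have h2 : (0 : ℝ) < 2 ^ n := by positivity
  have hh : (0 : ℝ) < (2 ^ n)⁻¹ := by positivity
  have hk0 : (0 : ℝ) < (k : ℝ) + 1 := by positivity
  rw [lintegral_mul_left_eq hh]
  have e : ∀ u, ENNReal.ofReal ((∑ i, a i * fracKer α θ ((k + y i) / 2 ^ n) ((2 ^ n)⁻¹ * u)) ^ 2 *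
      |(2 ^ n)⁻¹ * u| ^ (-γ)) = ENNReal.ofReal (((2 ^ n)⁻¹ ^ (α + θ)) ^ 2 * (2 ^ n)⁻¹ ^ (-γ)) *
      ENNReal.ofReal ((∑ i, a i * fracKer α θ (k + y i) u) ^ 2 * |u| ^ (-γ)) := by
    intro u
    rw [← ENNReal.ofReal_mul (by positivity), abs_mul, abs_of_pos hh,
      Real.mul_rpow hh.le (abs_nonneg _)]
    have : ∑ i, a i * fracKer α θ ((k + y i) / 2 ^ n) ((2 ^ n)⁻¹ * u) =
        (2 ^ n)⁻¹ ^ (α + θ) * ∑ i, a i * fracKer α θ (k + y i) u := by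
      rw [Finset.mul_sum]
      refine Finset.sum_congr rfl fun i _ => ?_
      rw [div_eq_inv_mul, fracKer_mul hθ hh (add_nonneg (by positivity) (hy i).1)]
      ring
    rw [this]
    ring_nf
  simp_rw [e]
  rw [lintegral_const_mul' _ _ ENNReal.ofReal_ne_top, ← mul_assoc, ← ENNReal.ofReal_mul hh.le]
  refine (mul_le_mul_right (h k) _).trans ?_
  rw [← ENNReal.ofReal_mul (by positivity)]
  refine ENNReal.ofReal_le_ofReal (le_of_eq ?_)
  rw [Real.div_rpow hk0.le h2.le, Real.inv_rpow h2.le, Real.inv_rpow h2.le, inv_pow, sq_rpow h2.le,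
    show -2 * (α + θ + 1 / 2) = -(2 * (α + θ)) + -1 by ring, Real.rpow_add h2, Real.rpow_neg_one,
    Real.rpow_neg h2.le (2 * (α + θ))]
  field_simp

theorem measurable_gfbmKer (α : ℝ) : Measurable fun p : ℝ × ℝ => gfbmKer α p.1 p.2 := by
  unfold gfbmKer
  fun_prop

theorem exists_lintegral_gfbmKer_sq_le {α γ : ℝ} (hγ0 : 0 ≤ γ) (hγ : γ < 1)
    (hα : -1 / 2 + γ / 2 < α) (hα' : α < 1 / 2) : ∃ C : ℝ, 0 < C ∧ ∀ v ∈ Icc (0 : ℝ) 1,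
      ∫⁻ u, ENNReal.ofReal (gfbmKer α v u ^ 2 * |u| ^ (-γ)) ≤ ENNReal.ofReal C := by
  rcases eq_or_ne α 0 with rfl | hα0
  · exact ⟨1, one_pos, fun k => by simp⟩
  obtain ⟨C, hC, h1⟩ := exists_lintegral_truncPow_sq_le hγ (p := α) (by linarith)
  obtain ⟨D, hD, h2⟩ := exists_lintegral_incrBound_sq_le hγ0 hγ hα hα'
  refine ⟨C + D, by positivity, fun v hv => ?_⟩
  rw [lintegral_eq_Ioi_add_Ioi, ENNReal.ofReal_add hC.le hD.le]
  refine add_le_add ?_ ?_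
  · calc _ = ∫⁻ u in Ioi 0, ENNReal.ofReal (truncPow α v u ^ 2 * u ^ (-γ)) := by
          refine setLIntegral_congr_fun measurableSet_Ioi fun u hu => ?_
          have hu0 : 0 < u := hu
          rw [gfbmKer_of_pos hα0 hu0, truncPow, abs_of_pos hu0]
      _ ≤ _ := h1 v hv.1
      _ ≤ _ := ENNReal.ofReal_le_ofReal (mul_le_of_le_one_right hC.le
          (Real.rpow_le_one hv.1 hv.2 (by linarith)))
  · calc _ ≤ ∫⁻ x in Ioi 0, ENNReal.ofReal (incrBound α 1 x ^ 2 * x ^ (-γ)) := by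
          refine setLIntegral_mono' measurableSet_Ioi fun x hx => ENNReal.ofReal_le_ofReal ?_
          have hx0 : 0 < x := hx
          have h := abs_gfbmKer_neg_le (α := α) (by linarith) hv.1 hv.2 one_pos hx0
          rw [abs_neg, abs_of_pos hx0]
          gcongr ?_ * _
          exact sq_le_sq' (abs_le.1 h).1 (abs_le.1 h).2
      _ ≤ _ := h2 1 one_pos
      _ = _ := by simp

theorem exists_lintegral_refineErr_fracKer_le {m : ℕ} {α γ θ : ℝ}
    (hγ0 : 0 ≤ γ) (hγ : γ < 1) (hα : -1 / 2 + γ / 2 < α) (hα' : α < 1 / 2) (hθ : 0 < θ)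
    (hm : α + θ + 3 / 2 ≤ m + 1) : ∃ C : ℝ, 0 < C ∧ ∀ n k b i,
      ∫⁻ u, ENNReal.ofReal (refineErr m (fun t => fracKer α θ t u) n k b i ^ 2 * |u| ^ (-γ)) ≤
        ENNReal.ofReal (C * (2 ^ n) ^ (-2 * (α + θ + 1 / 2)) * (((k : ℝ) + 1) / 2 ^ n) ^ (-γ)) := by
  have key : ∀ p : Fin 2 × Fin (m + 1), ∃ C : ℝ, 0 < C ∧ ∀ n k,
      ∫⁻ u, ENNReal.ofReal (refineErr m (fun t => fracKer α θ t u) n k p.1 p.2 ^ 2 * |u| ^ (-γ)) ≤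
        ENNReal.ofReal (C * (2 ^ n) ^ (-2 * (α + θ + 1 / 2)) * (((k : ℝ) + 1) / 2 ^ n) ^ (-γ)) := by
    rintro ⟨b, i⟩
    set y : Option (Fin (m + 1)) → ℝ := fun o => o.elim (childNode m b i) (refNode m) with hy
    set a : Option (Fin (m + 1)) → ℝ :=
      fun o => o.elim 1 (fun j => -refBasis m j (childNode m b i)) with ha
    have hy1 : ∀ o, y o ∈ Icc (0 : ℝ) 1 := by
      rintro (_ | j)
      · exact childNode_mem m b i
      · exact refNode_mem m j
    have ha1 : ∀ n ≤ m, ∑ o, a o * y o ^ n = 0 := by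
      intro n hn
      have h := sum_eval_mul_refBasis m (Polynomial.X ^ n) (by simpa using hn) (childNode m b i)
      simp only [Polynomial.eval_pow, Polynomial.eval_X] at h
      rw [Fintype.sum_option]
      simp only [hy, ha, Option.elim, one_mul, neg_mul, Finset.sum_neg_distrib]
      rw [← h, Finset.sum_congr rfl fun j _ => mul_comm _ _, add_neg_cancel]
    obtain ⟨C, hC, h⟩ := exists_lintegral_sum_fracKer_dyadic_le hy1 ha1 hγ0 hγ hα hα' hθ hm
    refine ⟨C, hC, fun n k => ?_⟩
    convert h n k using 5 with u
    rw [Fintype.sum_option]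
    simp only [refineErr, hy, ha, Option.elim, one_mul, neg_mul, Finset.sum_neg_distrib]
    ring
  choose C hC h using key
  refine ⟨∑ p, C p, Finset.sum_pos (fun p _ => hC p) Finset.univ_nonempty, fun n k b i => ?_⟩
  refine (h (b, i) n k).trans (ENNReal.ofReal_le_ofReal ?_)
  gcongr
  exact Finset.single_le_sum (f := C) (fun p _ => (hC p).le) (Finset.mem_univ (b, i))

/-- The largest multiple of `1 / N` below `v`. -/
noncomputable def stepMap (N : ℕ) (v : ℝ) : ℝ := (⌊(N : ℝ) * v⌋₊ : ℝ) / N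

theorem measurable_stepMap (N : ℕ) : Measurable (stepMap N) := by
  unfold stepMap
  have : Measurable fun v : ℝ => ⌊(N : ℝ) * v⌋₊ := Nat.measurable_floor.comp (by fun_prop)
  exact (measurable_from_top.comp this).div_const _

theorem stepMap_mem {N : ℕ} {v : ℝ} (hv : v ∈ Icc (0 : ℝ) 1) : stepMap N v ∈ Icc (0 : ℝ) 1 := by
  refine ⟨by unfold stepMap; positivity, ?_⟩
  unfold stepMap
  refine div_le_one_of_le₀ ?_ (by positivity)
  refine (Nat.floor_le (by have := hv.1; positivity)).trans ?_
  exact mul_le_of_le_one_right (by positivity) hv.2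

theorem tendsto_stepMap {v : ℝ} (hv : 0 ≤ v) : Tendsto (fun N => stepMap N v) atTop (𝓝 v) := by
  have h := (tendsto_nat_floor_mul_div_atTop hv).comp (tendsto_natCast_atTop_atTop (R := ℝ))
  refine h.congr fun N => ?_
  simp [stepMap, mul_comm]

theorem integral_mul_comp_stepMap {μ : Measure ℝ} (hμ : ∀ᵐ v ∂μ, v ∈ Icc (0 : ℝ) 1) {κ : ℝ → ℝ}
    (hκ : Integrable κ μ) (N : ℕ) (h : ℝ → ℝ) :
    ∫ v, κ v * h (stepMap N v) ∂μ = ∑ j : Fin (N + 1),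
      (∫ v, {v : ℝ | ⌊(N : ℝ) * v⌋₊ = j}.indicator κ v ∂μ) * h ((j : ℕ) / N) := by
  simp_rw [← integral_mul_const]
  rw [← integral_finsetSum]
  · refine integral_congr_ae (hμ.mono fun v hv => ?_)
    have hle : ⌊(N : ℝ) * v⌋₊ < N + 1 := by
      rw [Nat.lt_succ_iff, ← Nat.floor_natCast (R := ℝ) N]
      refine Nat.floor_le_floor ?_
      rw [Nat.floor_natCast]
      exact mul_le_of_le_one_right (by positivity) hv.2
    simp only
    rw [Finset.sum_eq_single (⟨⌊(N : ℝ) * v⌋₊, hle⟩ : Fin (N + 1))]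
    · simp [stepMap]
    · intro j _ hj
      rw [indicator_of_notMem, zero_mul]
      intro hv'
      exact hj (Fin.ext (Eq.symm hv'))
    · simp
  · intro j _
    refine (hκ.indicator ?_).mul_const _
    have : Measurable fun v : ℝ => ⌊(N : ℝ) * v⌋₊ := Nat.measurable_floor.comp (by fun_prop)
    exact this (measurableSet_singleton _)

theorem charFun_map_eq_of_gaussianReal {Ω : Type*} [MeasurableSpace Ω] {P : Measure Ω}
    {W : Ω → ℝ} {v : ℝ≥0} (h : P.map W = gaussianReal 0 v) (s : ℝ) :
    ∫ ω, Complex.exp (s * W ω * Complex.I) ∂P = Complex.exp (-(v * s ^ 2 / 2)) := by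
  have hW : AEMeasurable W P := by
    refine AEMeasurable.of_map_ne_zero ?_
    rw [h]
    exact IsProbabilityMeasure.ne_zero _
  have h1 := charFun_gaussianReal (μ := 0) (v := v) s
  rw [← h, charFun_apply_real, integral_map hW (by fun_prop)] at h1
  rw [h1]
  congr 1
  push_cast
  ring

theorem tendsto_integral_exp_of_tendsto {Ω : Type*} [MeasurableSpace Ω] {P : Measure Ω}
    [IsFiniteMeasure P] {W : ℕ → Ω → ℝ} {W' : Ω → ℝ} (hm : ∀ N, AEMeasurable (W N) P)
    (h : ∀ ω, Tendsto (fun N => W N ω) atTop (𝓝 (W' ω))) (s : ℝ) :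
    Tendsto (fun N => ∫ ω, Complex.exp (s * W N ω * Complex.I) ∂P) atTop
      (𝓝 (∫ ω, Complex.exp (s * W' ω * Complex.I) ∂P)) := by
  refine tendsto_integral_of_dominated_convergence (fun _ => 1) (fun N => ?_) (integrable_const _)
    (fun N => Eventually.of_forall fun ω => ?_) (Eventually.of_forall fun ω => ?_)
  · have := (hm N)
    have h2 : Measurable fun x : ℝ => Complex.exp (s * x * Complex.I) := by fun_prop
    exact (h2.comp_aemeasurable this).aestronglyMeasurable
  · rw [← Complex.ofReal_mul, Complex.norm_exp_ofReal_mul_I]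
  · have hc : Continuous fun x : ℝ => Complex.exp (s * x * Complex.I) := by fun_prop
    exact (hc.tendsto _).comp (h ω)

theorem aemeasurable_of_map_eq_gaussianReal {Ω : Type*} [MeasurableSpace Ω] {P : Measure Ω}
    {W : Ω → ℝ} {v : ℝ≥0} (h : P.map W = gaussianReal 0 v) : AEMeasurable W P := by
  refine AEMeasurable.of_map_ne_zero ?_
  rw [h]
  exact IsProbabilityMeasure.ne_zero _

theorem map_eq_gaussianReal_of_tendsto {Ω : Type*} [MeasurableSpace Ω] {P : Measure Ω}
    [IsProbabilityMeasure P] {W : ℕ → Ω → ℝ} {W' : Ω → ℝ} {v : ℕ → ℝ≥0} {v' : ℝ≥0}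
    (hG : ∀ N, P.map (W N) = gaussianReal 0 (v N))
    (h : ∀ ω, Tendsto (fun N => W N ω) atTop (𝓝 (W' ω))) (hv : Tendsto v atTop (𝓝 v')) :
    P.map W' = gaussianReal 0 v' := by
  have hm := fun N => aemeasurable_of_map_eq_gaussianReal (hG N)
  have hm' : AEMeasurable W' P :=
    aemeasurable_of_tendsto_metrizable_ae atTop hm (Eventually.of_forall h)
  have : IsProbabilityMeasure (P.map W') := Measure.isProbabilityMeasure_map hm'
  refine Measure.ext_of_charFun (funext fun s => ?_)
  have h1 := tendsto_integral_exp_of_tendsto hm h s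
  simp_rw [charFun_map_eq_of_gaussianReal (hG _)] at h1
  have h2 : Tendsto (fun N => Complex.exp (-((v N : ℝ) * s ^ 2 / 2))) atTop
      (𝓝 (Complex.exp (-((v' : ℝ) * s ^ 2 / 2)))) := by
    have hc : Continuous fun x : ℝ≥0 => Complex.exp (-((x : ℝ) * s ^ 2 / 2)) := by fun_prop
    exact (hc.tendsto _).comp hv
  rw [charFun_apply_real, integral_map hm' (by fun_prop), tendsto_nhds_unique h1 h2,
    charFun_gaussianReal]
  congr 1
  push_cast
  ring

theorem tendsto_variance_of_tendsto {Ω : Type*} [MeasurableSpace Ω] {P : Measure Ω}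
    [IsProbabilityMeasure P] {W : ℕ → Ω → ℝ} {W' : Ω → ℝ} {v : ℕ → ℝ≥0} {v' : ℝ≥0}
    (hG : ∀ N, P.map (W N) = gaussianReal 0 (v N)) (hG' : P.map W' = gaussianReal 0 v')
    (h : ∀ ω, Tendsto (fun N => W N ω) atTop (𝓝 (W' ω))) :
    Tendsto (fun N => (v N : ℝ)) atTop (𝓝 v') := by
  have h1 := tendsto_integral_exp_of_tendsto
    (fun N => aemeasurable_of_map_eq_gaussianReal (hG N)) h 1
  simp_rw [charFun_map_eq_of_gaussianReal (hG _)] at h1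
  rw [charFun_map_eq_of_gaussianReal hG'] at h1
  have e : ∀ x : ℝ≥0, Complex.exp (-((x : ℝ) * ((1 : ℝ) : ℂ) ^ 2 / 2)) =
    ((rexp (-(x / 2)) : ℝ) : ℂ) := by
    intro x; push_cast; simp
  simp_rw [e] at h1
  have h2 := (Complex.continuous_re.tendsto _).comp h1
  simp only [Function.comp_def, Complex.ofReal_re] at h2
  have h3 := ((Real.continuousAt_log (Real.exp_pos _).ne').tendsto.comp h2).const_mul (-2)
  simp only [Function.comp_def, Real.log_exp] at h3
  convert h3 using 2 <;> ring

theorem gfbmCov_eq (α γ s t : ℝ) :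
    gfbmCov α γ s t = ∫ u, gfbmKer α s u * gfbmKer α t u * |u| ^ (-γ) := rfl

theorem exists_lintegral_gfbmKer_mul_le {α γ : ℝ} (hγ0 : 0 ≤ γ) (hγ : γ < 1)
    (hα : -1 / 2 + γ / 2 < α) (hα' : α < 1 / 2) : ∃ C : ℝ, 0 < C ∧
      ∀ s ∈ Icc (0 : ℝ) 1, ∀ t ∈ Icc (0 : ℝ) 1,
        ∫⁻ u, ‖gfbmKer α s u * gfbmKer α t u * |u| ^ (-γ)‖ₑ ≤ ENNReal.ofReal C := by
  obtain ⟨C, hC, h⟩ := exists_lintegral_gfbmKer_sq_le hγ0 hγ hα hα'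
  refine ⟨C + C, by positivity, fun s hs t ht => ?_⟩
  calc _ ≤ ∫⁻ u, (ENNReal.ofReal (gfbmKer α s u ^ 2 * |u| ^ (-γ)) +
        ENNReal.ofReal (gfbmKer α t u ^ 2 * |u| ^ (-γ))) := by
        refine lintegral_mono fun u => ?_
        have hρ : 0 ≤ |u| ^ (-γ) := by positivity
        rw [← ofReal_norm, ← ENNReal.ofReal_add (by positivity) (by positivity), ← add_mul,
          norm_mul, Real.norm_of_nonneg hρ]
        refine ENNReal.ofReal_le_ofReal (mul_le_mul_of_nonneg_right ?_ hρ)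
        rw [Real.norm_eq_abs, abs_le]
        constructor <;> nlinarith [sq_nonneg (gfbmKer α s u + gfbmKer α t u),
          sq_nonneg (gfbmKer α s u - gfbmKer α t u)]
    _ = (∫⁻ u, ENNReal.ofReal (gfbmKer α s u ^ 2 * |u| ^ (-γ))) +
        ∫⁻ u, ENNReal.ofReal (gfbmKer α t u ^ 2 * |u| ^ (-γ)) := by
        rw [lintegral_add_left]
        have := (measurable_gfbmKer α).comp (measurable_prodMk_left (x := s))
        have h2 : Measurable fun u => gfbmKer α s u := this
        fun_prop
    _ ≤ _ := by
        rw [ENNReal.ofReal_add hC.le hC.le]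
        exact add_le_add (h s hs) (h t ht)

theorem exists_abs_gfbmCov_le {α γ : ℝ} (hγ0 : 0 ≤ γ) (hγ : γ < 1)
    (hα : -1 / 2 + γ / 2 < α) (hα' : α < 1 / 2) : ∃ C : ℝ, 0 < C ∧
      ∀ s ∈ Icc (0 : ℝ) 1, ∀ t ∈ Icc (0 : ℝ) 1, |gfbmCov α γ s t| ≤ C := by
  obtain ⟨C, hC, h⟩ := exists_lintegral_gfbmKer_mul_le hγ0 hγ hα hα'
  refine ⟨C, hC, fun s hs t ht => ?_⟩
  have h1 := (enorm_integral_le_lintegral_enorm _).trans (h s hs t ht)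
  rw [← gfbmCov_eq, ← ofReal_norm] at h1
  exact (ENNReal.ofReal_le_ofReal_iff hC.le).1 h1

theorem stronglyMeasurable_gfbmCov (α γ : ℝ) :
    StronglyMeasurable fun p : ℝ × ℝ => gfbmCov α γ p.1 p.2 := by
  have h : Measurable fun q : (ℝ × ℝ) × ℝ =>
      gfbmKer α q.1.1 q.2 * gfbmKer α q.1.2 q.2 * |q.2| ^ (-γ) := by
    have h1 : Measurable fun q : (ℝ × ℝ) × ℝ => gfbmKer α q.1.1 q.2 :=
      (measurable_gfbmKer α).comp (by fun_prop : Measurable fun q : (ℝ × ℝ) × ℝ => (q.1.1, q.2))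
    have h2 : Measurable fun q : (ℝ × ℝ) × ℝ => gfbmKer α q.1.2 q.2 :=
      (measurable_gfbmKer α).comp (by fun_prop : Measurable fun q : (ℝ × ℝ) × ℝ => (q.1.2, q.2))
    fun_prop
  exact h.stronglyMeasurable.integral_prod_right

section
variable {Ω : Type*} [MeasurableSpace Ω] {P : Measure Ω} {W : Ω → ℝ} {v : ℝ≥0}

theorem memLp_two_of_map_eq_gaussianReal (h : P.map W = gaussianReal 0 v) : MemLp W 2 P := by
  have hm := aemeasurable_of_map_eq_gaussianReal h
  have h1 : MemLp id 2 (P.map W) := by rw [h]; exact memLp_id_gaussianReal 2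
  exact (memLp_map_measure_iff (by fun_prop) hm).1 h1

theorem integral_sq_of_map_eq_gaussianReal (h : P.map W = gaussianReal 0 v) :
    ∫ ω, W ω ^ 2 ∂P = v := by
  have hm := aemeasurable_of_map_eq_gaussianReal h
  have h1 := variance_id_gaussianReal (μ := 0) (v := v)
  rw [variance_of_integral_eq_zero (by fun_prop) (by simp), ← h,
    integral_map hm (by fun_prop)] at h1
  simpa using h1

end

section
variable {Ω : Type*} [MeasurableSpace Ω] {P : Measure Ω} {α γ : ℝ} {X : ℝ → Ω → ℝ}

theorem IsCenteredGaussianProcess.family (hX : IsCenteredGaussianProcess P X) {ι : Type*}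
    [Fintype ι] (t : ι → ℝ) : IsCenteredGaussianFamily P (fun i => X (t i)) := by
  intro c
  obtain ⟨v, hv⟩ := hX (Fintype.card ι) (t ∘ (Fintype.equivFin ι).symm)
    (c ∘ (Fintype.equivFin ι).symm)
  refine ⟨v, ?_⟩
  rw [← hv]
  congr 1 with ω
  exact ((Fintype.equivFin ι).symm.sum_comp fun i => c i * X (t i) ω).symm

theorem IsGFBM.exists_map_sum_eq (hX : IsGFBM P α γ X) {ι : Type*} [Fintype ι] {t : ι → ℝ}
    (ht : ∀ i, 0 ≤ t i) (c : ι → ℝ) : ∃ v : ℝ≥0,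
      P.map (fun ω => ∑ i, c i * X (t i) ω) = gaussianReal 0 v ∧
        (v : ℝ) = ∑ i, c i * ∑ j, c j * gfbmCov α γ (t i) (t j) := by
  have hf := hX.1.family t
  obtain ⟨v, hv⟩ := hf c
  refine ⟨v, hv, ?_⟩
  have hL : ∀ i, MemLp (X (t i)) 2 P := fun i => by
    obtain ⟨w, hw⟩ := hX.1.family (fun _ : Fin 1 => t i) 1
    simp only [Pi.one_apply, one_mul, Finset.univ_unique, Finset.sum_singleton] at hw
    exact memLp_two_of_map_eq_gaussianReal hw
  have hI : ∀ i j, Integrable (fun ω => c i * X (t i) ω * (c j * X (t j) ω)) P := fun i j =>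
    ((hL i).const_mul (c i)).integrable_mul ((hL j).const_mul (c j))
  rw [← integral_sq_of_map_eq_gaussianReal hv]
  simp_rw [sq, Finset.sum_mul_sum]
  rw [integral_finsetSum _ fun i _ => integrable_finsetSum _ fun j _ => hI i j]
  refine Finset.sum_congr rfl fun i _ => ?_
  rw [integral_finsetSum _ fun j _ => hI i j, Finset.mul_sum]
  refine Finset.sum_congr rfl fun j _ => ?_
  rw [← hX.2.2.2 (t i) (t j) (ht i) (ht j), ← integral_const_mul, ← integral_const_mul]
  congr 1 with ω
  ring

theorem IsGFBM.tendsto_apply (hX : IsGFBM P α γ X) {s : ℕ → ℝ} {s' : ℝ} (hs : ∀ n, 0 ≤ s n)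
    (hs' : 0 ≤ s') (h : Tendsto s atTop (𝓝 s')) (ω : Ω) :
    Tendsto (fun n => X (s n) ω) atTop (𝓝 (X s' ω)) :=
  (hX.2.1 ω s' hs').tendsto.comp
    (tendsto_nhdsWithin_iff.2 ⟨h, Eventually.of_forall fun n => hs n⟩)

theorem IsGFBM.tendsto_gfbmCov [IsProbabilityMeasure P] (hX : IsGFBM P α γ X) {s t : ℕ → ℝ}
    {s' t' : ℝ} (hs : ∀ n, 0 ≤ s n) (ht : ∀ n, 0 ≤ t n) (hs' : Tendsto s atTop (𝓝 s'))
    (ht' : Tendsto t atTop (𝓝 t')) :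
    Tendsto (fun n => gfbmCov α γ (s n) (t n)) atTop (𝓝 (gfbmCov α γ s' t')) := by
  have hs0 : 0 ≤ s' := ge_of_tendsto' hs' hs
  have ht0 : 0 ≤ t' := ge_of_tendsto' ht' ht
  have hsym : ∀ x y : ℝ, gfbmCov α γ x y = gfbmCov α γ y x := fun x y => by
    rw [gfbmCov_eq, gfbmCov_eq]
    congr 1 with u
    ring
  have key : ∀ e : ℝ, Tendsto (fun n => ∑ i, ![1, e] i * ∑ j, ![1, e] j *
      gfbmCov α γ (![s n, t n] i) (![s n, t n] j)) atTop
      (𝓝 (∑ i, ![1, e] i * ∑ j, ![1, e] j * gfbmCov α γ (![s', t'] i) (![s', t'] j))) := by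
    intro e
    choose v hv hv2 using fun n => hX.exists_map_sum_eq (t := ![s n, t n])
      (fun i => by fin_cases i <;> simp [hs n, ht n]) ![1, e]
    obtain ⟨v', hv', hv2'⟩ := hX.exists_map_sum_eq (t := ![s', t'])
      (fun i => by fin_cases i <;> simp [hs0, ht0]) ![1, e]
    simp_rw [← hv2, ← hv2']
    refine tendsto_variance_of_tendsto hv hv' fun ω => tendsto_finsetSum _ fun i _ => ?_
    refine Tendsto.const_mul _ ?_
    fin_cases i
    · exact hX.tendsto_apply hs hs0 hs' ω
    · exact hX.tendsto_apply ht ht0 ht' ω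
  have h := ((key 1).sub (key (-1))).const_mul (1 / 4)
  simp only [Fin.sum_univ_two, Matrix.cons_val_zero, Matrix.cons_val_one] at h
  convert h using 2
  · rw [hsym (t _) (s _)]; ring
  · rw [hsym t' s']; ring

end

theorem ae_restrict_Ioc_mem_Icc : ∀ᵐ v ∂(volume.restrict (Ioc (0 : ℝ) 1)), v ∈ Icc (0 : ℝ) 1 :=
  (ae_restrict_iff' measurableSet_Ioc).2 (Eventually.of_forall fun _ hv => Ioc_subset_Icc_self hv)

theorem integral_integral_mul_gfbmCov {μ : Measure ℝ} [SFinite μ]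
    (hμ : ∀ᵐ v ∂μ, v ∈ Icc (0 : ℝ) 1) {α γ : ℝ} (hγ0 : 0 ≤ γ) (hγ : γ < 1)
    (hα : -1 / 2 + γ / 2 < α) (hα' : α < 1 / 2) {κ : ℝ → ℝ} (hκ : Integrable κ μ) :
    ∫ v, κ v * ∫ w, κ w * gfbmCov α γ v w ∂μ ∂μ =
      ∫ u, (∫ v, κ v * gfbmKer α v u ∂μ) ^ 2 * |u| ^ (-γ) := by
  obtain ⟨C, hC, hI⟩ := exists_lintegral_gfbmKer_mul_le hγ0 hγ hα hα'
  set f : (ℝ × ℝ) × ℝ → ℝ := fun q => κ q.1.1 * κ q.1.2 *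
    (gfbmKer α q.1.1 q.2 * gfbmKer α q.1.2 q.2 * |q.2| ^ (-γ)) with hf
  have hκ2 : Integrable (fun p : ℝ × ℝ => κ p.1 * κ p.2) (μ.prod μ) := hκ.mul_prod hκ
  have hker : Measurable fun q : (ℝ × ℝ) × ℝ =>
      gfbmKer α q.1.1 q.2 * gfbmKer α q.1.2 q.2 * |q.2| ^ (-γ) := by
    have h1 : Measurable fun q : (ℝ × ℝ) × ℝ => gfbmKer α q.1.1 q.2 :=
      (measurable_gfbmKer α).comp (by fun_prop : Measurable fun q : (ℝ × ℝ) × ℝ => (q.1.1, q.2))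
    have h2 : Measurable fun q : (ℝ × ℝ) × ℝ => gfbmKer α q.1.2 q.2 :=
      (measurable_gfbmKer α).comp (by fun_prop : Measurable fun q : (ℝ × ℝ) × ℝ => (q.1.2, q.2))
    fun_prop
  have hfm : AEStronglyMeasurable f ((μ.prod μ).prod volume) :=
    (hκ2.aestronglyMeasurable.comp_fst (ν := volume)).mul hker.aestronglyMeasurable
  have hmem : ∀ᵐ p ∂(μ.prod μ), p.1 ∈ Icc (0 : ℝ) 1 ∧ p.2 ∈ Icc (0 : ℝ) 1 :=
    (Measure.quasiMeasurePreserving_fst.ae hμ).and (Measure.quasiMeasurePreserving_snd.ae hμ)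
  have hfi : Integrable f ((μ.prod μ).prod volume) := by
    refine ⟨hfm, ?_⟩
    rw [HasFiniteIntegral, lintegral_prod _ hfm.enorm]
    calc _ ≤ ∫⁻ p, ‖κ p.1 * κ p.2‖ₑ * ENNReal.ofReal C ∂(μ.prod μ) := by
          refine lintegral_mono_ae (hmem.mono fun p hp => ?_)
          simp only [hf, enorm_mul (κ p.1 * κ p.2)]
          rw [lintegral_const_mul' _ _ enorm_ne_top]
          exact mul_le_mul_right (hI _ hp.1 _ hp.2) _
      _ = (∫⁻ p, ‖κ p.1 * κ p.2‖ₑ ∂(μ.prod μ)) * ENNReal.ofReal C :=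
          lintegral_mul_const' _ _ ENNReal.ofReal_ne_top
      _ < ∞ := ENNReal.mul_lt_top hκ2.2 ENNReal.ofReal_lt_top
  have e1 : ∫ v, κ v * ∫ w, κ w * gfbmCov α γ v w ∂μ ∂μ =
      ∫ v, ∫ w, (∫ u, f ((v, w), u)) ∂μ ∂μ := by
    simp_rw [gfbmCov_eq, ← integral_const_mul, hf]
    simp only [← mul_assoc]
  rw [e1, integral_integral (f := fun v w => ∫ u, f ((v, w), u)) hfi.integral_prod_left,
    integral_integral_swap (f := fun p u => f (p, u)) hfi]
  congr 1 with u
  have e2 : ∀ p : ℝ × ℝ, f (p, u) = (κ p.1 * gfbmKer α p.1 u) * (κ p.2 * gfbmKer α p.2 u) *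
      |u| ^ (-γ) := fun p => by simp only [hf]; ring
  simp_rw [e2]
  rw [integral_mul_const, integral_prod_mul (fun v => κ v * gfbmKer α v u)
    (fun v => κ v * gfbmKer α v u), sq]

theorem ae_integrable_mul_gfbmKer {μ : Measure ℝ} [SFinite μ]
    (hμ : ∀ᵐ v ∂μ, v ∈ Icc (0 : ℝ) 1) {α γ : ℝ} (hγ0 : 0 ≤ γ) (hγ : γ < 1)
    (hα : -1 / 2 + γ / 2 < α) (hα' : α < 1 / 2) {κ : ℝ → ℝ} (hκ : Integrable κ μ) :
    ∀ᵐ u : ℝ, Integrable (fun v => κ v * gfbmKer α v u) μ := by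
  obtain ⟨C, hC, hI⟩ := exists_lintegral_gfbmKer_mul_le hγ0 hγ hα hα'
  set f : ℝ × ℝ → ℝ := fun q => κ q.1 * (gfbmKer α q.1 q.2 * gfbmKer α q.1 q.2 * |q.2| ^ (-γ))
    with hf
  have hker : Measurable fun q : ℝ × ℝ =>
      gfbmKer α q.1 q.2 * gfbmKer α q.1 q.2 * |q.2| ^ (-γ) := by
    have h1 : Measurable fun q : ℝ × ℝ => gfbmKer α q.1 q.2 := measurable_gfbmKer α
    fun_prop
  have hfm : AEStronglyMeasurable f (μ.prod volume) :=
    (hκ.aestronglyMeasurable.comp_fst (ν := volume)).mul hker.aestronglyMeasurable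
  have hfi : Integrable f (μ.prod volume) := by
    refine ⟨hfm, ?_⟩
    rw [HasFiniteIntegral, lintegral_prod _ hfm.enorm]
    calc _ ≤ ∫⁻ p, ‖κ p‖ₑ * ENNReal.ofReal C ∂μ := by
          refine lintegral_mono_ae (hμ.mono fun p hp => ?_)
          simp only [hf, enorm_mul (κ p)]
          rw [lintegral_const_mul' _ _ enorm_ne_top]
          exact mul_le_mul_right (hI _ hp _ hp) _
      _ = (∫⁻ p, ‖κ p‖ₑ ∂μ) * ENNReal.ofReal C := lintegral_mul_const' _ _ ENNReal.ofReal_ne_top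
      _ < ∞ := ENNReal.mul_lt_top hκ.2 ENNReal.ofReal_lt_top
  have h0 : ∀ᵐ u : ℝ, u ≠ 0 := by simp [ae_iff]
  filter_upwards [hfi.prod_left_ae, h0] with u hu hu0
  have hρ : 0 < |u| ^ (-γ) := Real.rpow_pos_of_pos (abs_pos.2 hu0) _
  have h1 : Integrable (fun v => κ v * gfbmKer α v u ^ 2) μ := by
    refine (hu.mul_const (|u| ^ (-γ))⁻¹).congr (Eventually.of_forall fun v => ?_)
    simp only [hf]
    field_simp
  have hg : Measurable fun v => gfbmKer α v u :=
    (measurable_gfbmKer α).comp (by fun_prop : Measurable fun v : ℝ => (v, u))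
  refine (hκ.norm.add h1.norm).mono' (hκ.aestronglyMeasurable.mul hg.aestronglyMeasurable)
    (Eventually.of_forall fun v => ?_)
  simp only [Pi.add_apply, norm_mul, norm_pow]
  have h2 := norm_nonneg (κ v)
  have h3 : ‖gfbmKer α v u‖ ≤ 1 + ‖gfbmKer α v u‖ ^ 2 := by
    nlinarith [sq_nonneg (‖gfbmKer α v u‖ - 1), norm_nonneg (gfbmKer α v u)]
  nlinarith [mul_le_mul_of_nonneg_left h3 h2]

theorem ContinuousOn.integrable_mul_of_ae_mem {f : ℝ → ℝ} (hf : ContinuousOn f (Icc 0 1))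
    {μ : Measure ℝ} (hμ : ∀ᵐ v ∂μ, v ∈ Icc (0 : ℝ) 1) {κ : ℝ → ℝ} (hκ : Integrable κ μ) :
    Integrable (fun v => κ v * f v) μ := by
  obtain ⟨B, hB⟩ := isCompact_Icc.exists_bound_of_continuousOn hf
  have hm : AEStronglyMeasurable f μ := by
    rw [← Measure.restrict_eq_self_of_ae_mem hμ]
    exact hf.aestronglyMeasurable measurableSet_Icc
  exact hκ.mul_bdd (c := B) hm (hμ.mono fun v hv => hB v hv)

theorem tendsto_integral_mul_comp_stepMap {f : ℝ → ℝ} (hf : ContinuousOn f (Icc 0 1))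
    {μ : Measure ℝ} (hμ : ∀ᵐ v ∂μ, v ∈ Icc (0 : ℝ) 1) {κ : ℝ → ℝ} (hκ : Integrable κ μ) :
    Tendsto (fun N => ∫ v, κ v * f (stepMap N v) ∂μ) atTop (𝓝 (∫ v, κ v * f v ∂μ)) := by
  obtain ⟨B, hB⟩ := isCompact_Icc.exists_bound_of_continuousOn hf
  have hcm : Continuous (IccExtend (zero_le_one (α := ℝ)) ((Icc 0 1).domRestrict f)) :=
    (continuousOn_iff_continuous_domRestrict.1 hf).Icc_extend'
  refine tendsto_integral_of_dominated_convergence (fun v => ‖κ v‖ * B) (fun N => ?_)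
    (hκ.norm.mul_const _) (fun N => hμ.mono fun v hv => ?_) (hμ.mono fun v hv => ?_)
  · refine hκ.aestronglyMeasurable.mul
      ⟨_, (hcm.measurable.comp (measurable_stepMap N)).stronglyMeasurable,
        hμ.mono fun v hv => ?_⟩
    simp [IccExtend_of_mem _ _ (stepMap_mem hv), Set.domRestrict]
  · rw [norm_mul]
    exact mul_le_mul_of_nonneg_left (hB _ (stepMap_mem hv)) (norm_nonneg _)
  · refine Tendsto.const_mul _ ?_
    have : ContinuousWithinAt f (Icc 0 1) v := hf v hv
    refine this.tendsto.comp (tendsto_nhdsWithin_iff.2 ⟨tendsto_stepMap hv.1, ?_⟩)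
    exact Eventually.of_forall fun N => stepMap_mem hv

section
variable {Ω : Type*} [MeasurableSpace Ω] {P : Measure Ω} [IsProbabilityMeasure P] {α γ : ℝ}
  {X : ℝ → Ω → ℝ}

theorem IsGFBM.tendsto_integral_integral_mul_gfbmCov (hX : IsGFBM P α γ X) {μ : Measure ℝ}
    [SFinite μ] (hμ : ∀ᵐ v ∂μ, v ∈ Icc (0 : ℝ) 1) (hγ0 : 0 ≤ γ) (hγ : γ < 1)
    (hα : -1 / 2 + γ / 2 < α) (hα' : α < 1 / 2) {κ : ℝ → ℝ} (hκ : Integrable κ μ) :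
    Tendsto (fun N => ∫ v, κ v * ∫ w, κ w * gfbmCov α γ (stepMap N v) (stepMap N w) ∂μ ∂μ) atTop
      (𝓝 (∫ v, κ v * ∫ w, κ w * gfbmCov α γ v w ∂μ ∂μ)) := by
  obtain ⟨C, hC, hR⟩ := exists_abs_gfbmCov_le hγ0 hγ hα hα'
  have hRm := (stronglyMeasurable_gfbmCov α γ).measurable
  have hmap : ∀ N, Measurable fun p : ℝ × ℝ => gfbmCov α γ (stepMap N p.1) (stepMap N p.2) :=
    fun N => hRm.comp (f := fun p : ℝ × ℝ => (stepMap N p.1, stepMap N p.2))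
      (((measurable_stepMap N).comp measurable_fst).prodMk
        ((measurable_stepMap N).comp measurable_snd))
  have hin : ∀ v ∈ Icc (0 : ℝ) 1, Tendsto
      (fun N => ∫ w, κ w * gfbmCov α γ (stepMap N v) (stepMap N w) ∂μ) atTop
      (𝓝 (∫ w, κ w * gfbmCov α γ v w ∂μ)) := by
    intro v hv
    refine tendsto_integral_of_dominated_convergence (fun w => ‖κ w‖ * C) (fun N => ?_)
      (hκ.norm.mul_const _) (fun N => hμ.mono fun w hw => ?_) (hμ.mono fun w hw => ?_)
    · exact hκ.aestronglyMeasurable.mul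
        ((hmap N).comp measurable_prodMk_left).aestronglyMeasurable
    · rw [norm_mul]
      exact mul_le_mul_of_nonneg_left (hR _ (stepMap_mem hv) _ (stepMap_mem hw)) (norm_nonneg _)
    · exact (hX.tendsto_gfbmCov (fun N => (stepMap_mem hv).1) (fun N => (stepMap_mem hw).1)
        (tendsto_stepMap hv.1) (tendsto_stepMap hw.1)).const_mul _
  refine tendsto_integral_of_dominated_convergence (fun v => ‖κ v‖ * ∫ w, ‖κ w‖ * C ∂μ)
    (fun N => ?_) (hκ.norm.mul_const _) (fun N => hμ.mono fun v hv => ?_)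
    (hμ.mono fun v hv => (hin v hv).const_mul _)
  · refine hκ.aestronglyMeasurable.mul ?_
    have h1 : AEStronglyMeasurable (fun p : ℝ × ℝ => κ p.2 *
        gfbmCov α γ (stepMap N p.1) (stepMap N p.2)) (μ.prod μ) :=
      hκ.aestronglyMeasurable.comp_snd.mul (hmap N).aestronglyMeasurable
    exact h1.integral_prod_right'
  · rw [norm_mul]
    refine mul_le_mul_of_nonneg_left ?_ (norm_nonneg _)
    refine norm_integral_le_of_norm_le (hκ.norm.mul_const _) (hμ.mono fun w hw => ?_)
    rw [norm_mul]
    exact mul_le_mul_of_nonneg_left (hR _ (stepMap_mem hv) _ (stepMap_mem hw)) (norm_nonneg _)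

theorem IsGFBM.exists_map_integral_eq (hX : IsGFBM P α γ X) {μ : Measure ℝ} [SFinite μ]
    (hμ : ∀ᵐ v ∂μ, v ∈ Icc (0 : ℝ) 1) (hγ0 : 0 ≤ γ) (hγ : γ < 1)
    (hα : -1 / 2 + γ / 2 < α) (hα' : α < 1 / 2) {κ : ℝ → ℝ} (hκ : Integrable κ μ) :
    ∃ v : ℝ≥0, P.map (fun ω => ∫ v, κ v * X v ω ∂μ) = gaussianReal 0 v ∧
      (v : ℝ) = ∫ u, (∫ v, κ v * gfbmKer α v u ∂μ) ^ 2 * |u| ^ (-γ) := by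
  rw [← integral_integral_mul_gfbmCov hμ hγ0 hγ hα hα' hκ]
  choose v hv hv2 using fun N : ℕ => hX.exists_map_sum_eq
    (t := fun j : Fin (N + 1) => ((j : ℕ) : ℝ) / N) (fun j => by positivity)
    (fun j => ∫ v, {v : ℝ | ⌊(N : ℝ) * v⌋₊ = j}.indicator κ v ∂μ)
  have hv1 : ∀ N, P.map (fun ω => ∫ v, κ v * X (stepMap N v) ω ∂μ) = gaussianReal 0 (v N) := by
    intro N
    rw [← hv N]
    congr 1 with ω
    exact integral_mul_comp_stepMap hμ hκ N fun v => X v ω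
  have hv3 : ∀ N, (v N : ℝ) =
      ∫ v, κ v * ∫ w, κ w * gfbmCov α γ (stepMap N v) (stepMap N w) ∂μ ∂μ := by
    intro N
    rw [hv2 N, integral_mul_comp_stepMap hμ hκ N
      (fun s => ∫ w, κ w * gfbmCov α γ s (stepMap N w) ∂μ)]
    refine Finset.sum_congr rfl fun i _ => ?_
    rw [integral_mul_comp_stepMap hμ hκ N (fun t => gfbmCov α γ ((i : ℕ) / N) t)]
  have hpt : ∀ ω, Tendsto (fun N => ∫ v, κ v * X (stepMap N v) ω ∂μ) atTop
      (𝓝 (∫ v, κ v * X v ω ∂μ)) := fun ω =>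
    tendsto_integral_mul_comp_stepMap ((hX.2.1 ω).mono Icc_subset_Ici_self) hμ hκ
  have hlim := (hX.tendsto_integral_integral_mul_gfbmCov hμ hγ0 hγ hα hα' hκ).congr
    fun N => (hv3 N).symm
  set L := ∫ v, κ v * ∫ w, κ w * gfbmCov α γ v w ∂μ ∂μ with hL
  have hL0 : 0 ≤ L := ge_of_tendsto' hlim fun N => (v N).2
  refine ⟨⟨L, hL0⟩, map_eq_gaussianReal_of_tendsto hv1 hpt ?_, rfl⟩
  exact NNReal.tendsto_coe.1 hlim

end

/-- The kernel of the Riemann–Liouville fractional integral of order `θ`. -/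
noncomputable def rlKer (θ t v : ℝ) : ℝ :=
  (Ioc 0 t).indicator (fun v => (Real.Gamma θ)⁻¹ * (t - v) ^ (θ - 1)) v

theorem integral_rlKer_mul (θ : ℝ) {t : ℝ} (ht : t ∈ Icc (0 : ℝ) 1) (f : ℝ → ℝ) :
    ∫ v in Ioc 0 1, rlKer θ t v * f v =
      (Real.Gamma θ)⁻¹ * ∫ v in (0 : ℝ)..t, (t - v) ^ (θ - 1) * f v := by
  have e : (fun v => rlKer θ t v * f v) =
      (Ioc 0 t).indicator fun v => (Real.Gamma θ)⁻¹ * ((t - v) ^ (θ - 1) * f v) := by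
    funext v
    by_cases hv : v ∈ Ioc 0 t <;> simp [rlKer, hv, mul_assoc]
  rw [e, integral_indicator measurableSet_Ioc, Measure.restrict_restrict measurableSet_Ioc,
    Ioc_inter_Ioc, max_self, min_eq_left ht.2, integral_const_mul,
    intervalIntegral.integral_of_le ht.1]

theorem integrable_rlKer {θ t : ℝ} (hθ : 0 < θ) (ht : 0 ≤ t) :
    Integrable (rlKer θ t) (volume.restrict (Ioc 0 1)) := by
  have h := (intervalIntegral.intervalIntegrable_rpow' (a := t) (b := 0) (r := θ - 1)
    (by linarith)).comp_sub_left t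
  rw [sub_self, sub_zero, intervalIntegrable_iff_integrableOn_Ioc_of_le ht] at h
  exact ((integrable_indicator_iff measurableSet_Ioc).2
    (Integrable.const_mul h (Real.Gamma θ)⁻¹)).restrict

theorem continuousOn_integral_sub_rpow_mul {θ : ℝ} (hθ : 0 < θ) {f : ℝ → ℝ}
    (hf : ContinuousOn f (Icc 0 1)) :
    ContinuousOn (fun t => ∫ v in (0 : ℝ)..t, (t - v) ^ (θ - 1) * f v) (Icc 0 1) := by
  obtain ⟨B, hB⟩ := isCompact_Icc.exists_bound_of_continuousOn hf
  set g := IccExtend (zero_le_one (α := ℝ)) ((Icc 0 1).domRestrict f) with hg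
  have hgc : Continuous g := (continuousOn_iff_continuous_domRestrict.1 hf).Icc_extend'
  have hgB : ∀ x, ‖g x‖ ≤ B := fun x => hB _ (projIcc 0 1 zero_le_one x).2
  have hgf : ∀ x ∈ Icc (0 : ℝ) 1, g x = f x := fun x hx => IccExtend_of_mem _ _ hx
  have hm : Measurable fun w : ℝ => (1 - w) ^ (θ - 1) := by fun_prop
  have h1 : Continuous fun t => ∫ w in (0 : ℝ)..1, (1 - w) ^ (θ - 1) * g (t * w) := by
    refine intervalIntegral.continuous_of_dominated_interval
      (bound := fun w => ‖(1 - w) ^ (θ - 1)‖ * B) (fun t => ?_) (fun t => ?_)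
      ((intervalIntegrable_one_sub_rpow hθ).norm.mul_const B) ?_
    · have : Measurable fun w => g (t * w) := (hgc.comp (by fun_prop)).measurable
      exact (hm.mul this).aestronglyMeasurable
    · refine Eventually.of_forall fun w _ => ?_
      rw [norm_mul]
      exact mul_le_mul_of_nonneg_left (hgB _) (norm_nonneg _)
    · exact Eventually.of_forall fun w _ =>
        continuous_const.mul (hgc.comp (continuous_id.mul continuous_const))
  refine ((Real.continuous_rpow_const hθ.le).mul h1).continuousOn.congr fun t ht => ?_
  rw [integral_sub_rpow_mul_eq hθ ht.1]
  congr 1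
  refine intervalIntegral.integral_congr fun w hw => ?_
  rw [uIcc_of_le zero_le_one] at hw
  rw [hgf _ ⟨mul_nonneg ht.1 hw.1, mul_le_one₀ ht.2 hw.1 hw.2⟩]

section
variable {Ω : Type*} [MeasurableSpace Ω] {P : Measure Ω} {α γ θ : ℝ} {X : ℝ → Ω → ℝ}

theorem IsGFBM.continuousOn_fracInt (hX : IsGFBM P α γ X) (hθ : 0 < θ) (ω : Ω) :
    ContinuousOn (fun t => fracInt θ X t ω) (Icc 0 1) :=
  (continuousOn_integral_sub_rpow_mul hθ ((hX.2.1 ω).mono Icc_subset_Ici_self)).const_smul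
    (Real.Gamma θ)⁻¹

/-- Linear combinations of values of the fractional integral of a GFBM are centered Gaussian,
with variance computed from the moving average kernel. -/
theorem IsGFBM.exists_map_sum_fracInt_eq [IsProbabilityMeasure P] (hX : IsGFBM P α γ X)
    (hγ0 : 0 ≤ γ) (hγ : γ < 1) (hα : -1 / 2 + γ / 2 < α) (hα' : α < 1 / 2) (hθ : 0 < θ)
    {ι : Type*} [Fintype ι] {t : ι → ℝ} (ht : ∀ i, t i ∈ Icc (0 : ℝ) 1) (c : ι → ℝ) :
    ∃ v : ℝ≥0, P.map (fun ω => ∑ i, c i * fracInt θ X (t i) ω) = gaussianReal 0 v ∧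
      (v : ℝ) = ∫ u, (∑ i, c i * fracKer α θ (t i) u) ^ 2 * |u| ^ (-γ) := by
  set κ : ℝ → ℝ := fun v => ∑ i, c i * rlKer θ (t i) v with hκ_def
  have hκ : Integrable κ (volume.restrict (Ioc 0 1)) :=
    integrable_finsetSum _ fun i _ => (integrable_rlKer hθ (ht i).1).const_mul _
  have hsum : ∀ f : ℝ → ℝ, (∀ i, Integrable (fun v => rlKer θ (t i) v * f v)
      (volume.restrict (Ioc 0 1))) → ∫ v in Ioc 0 1, κ v * f v =
        ∑ i, c i * ((Real.Gamma θ)⁻¹ * ∫ v in (0 : ℝ)..t i, (t i - v) ^ (θ - 1) * f v) := by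
    intro f hf
    simp_rw [← integral_rlKer_mul θ (ht _), ← integral_const_mul, hκ_def, Finset.sum_mul, mul_assoc]
    exact integral_finsetSum _ fun i _ => (hf i).const_mul _
  obtain ⟨v, hv, hv2⟩ := hX.exists_map_integral_eq ae_restrict_Ioc_mem_Icc hγ0 hγ hα hα' hκ
  refine ⟨v, ?_, ?_⟩
  · rw [← hv]
    congr 1 with ω
    exact (hsum _ fun i => ContinuousOn.integrable_mul_of_ae_mem
      ((hX.2.1 ω).mono Icc_subset_Ici_self) ae_restrict_Ioc_mem_Icc
      (integrable_rlKer hθ (ht i).1)).symm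
  · rw [hv2]
    have hae : ∀ᵐ u : ℝ, ∀ i, Integrable (fun v => rlKer θ (t i) v * gfbmKer α v u)
        (volume.restrict (Ioc 0 1)) :=
      ae_all_iff.2 fun i => ae_integrable_mul_gfbmKer ae_restrict_Ioc_mem_Icc hγ0 hγ hα hα'
        (integrable_rlKer hθ (ht i).1)
    refine integral_congr_ae (hae.mono fun u hu => ?_)
    simp only
    rw [hsum _ hu]
    rfl

theorem IsGFBM.fracInt_family [IsProbabilityMeasure P] (hX : IsGFBM P α γ X)
    (hγ0 : 0 ≤ γ) (hγ : γ < 1) (hα : -1 / 2 + γ / 2 < α) (hα' : α < 1 / 2) (hθ : 0 < θ)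
    {ι : Type*} [Fintype ι] {t : ι → ℝ} (ht : ∀ i, t i ∈ Icc (0 : ℝ) 1) :
    IsCenteredGaussianFamily P (fun i => fracInt θ X (t i)) := fun c =>
  (hX.exists_map_sum_fracInt_eq hγ0 hγ hα hα' hθ ht c).imp fun _ h => h.1

theorem refineErr_eq_sum (m : ℕ) (f : ℝ → ℝ) (n k : ℕ) (b : Fin 2) (i : Fin (m + 1)) :
    refineErr m f n k b i =
      ∑ o : Option (Fin (m + 1)), o.elim 1 (fun j => -refBasis m j (childNode m b i)) *
        f ((k + o.elim (childNode m b i) (refNode m)) / 2 ^ n) := by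
  rw [Fintype.sum_option]
  simp only [refineErr, Option.elim, one_mul, neg_mul, Finset.sum_neg_distrib]
  ring

theorem add_div_two_pow_mem {n k : ℕ} (hk : k < 2 ^ n) {x : ℝ} (hx : x ∈ Icc (0 : ℝ) 1) :
    (k + x) / 2 ^ n ∈ Icc (0 : ℝ) 1 := by
  have h : (k : ℝ) + 1 ≤ 2 ^ n := by exact_mod_cast hk
  exact ⟨div_nonneg (add_nonneg k.cast_nonneg hx.1) (by positivity),
    div_le_one_of_le₀ (by linarith [hx.2]) (by positivity)⟩

/-- The small ball lower bound for the fractional integral of a GFBM on dyadic grids. -/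
theorem IsGFBM.exists_exp_le_measure_fracInt_dyadic [IsProbabilityMeasure P]
    (hX : IsGFBM P α γ X) (hγ0 : 0 ≤ γ) (hγ : γ < 1) (hα : -1 / 2 + γ / 2 < α) (hα' : α < 1 / 2)
    (hθ : 0 < θ) : ∃ C : ℝ, 0 < C ∧ ∀ ε : ℝ, 0 < ε → ∀ N : ℕ,
      ENNReal.ofReal (rexp (-(C * ε ^ (-1 / (α + θ + 1 / 2))))) ≤
        P {ω | ∀ k : ℕ, k < 2 ^ N → |fracInt θ X (k / 2 ^ N) ω| ≤ ε} := by
  obtain ⟨m, hm⟩ := exists_nat_ge (α + θ + 1 / 2)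
  obtain ⟨C, hC, hC'⟩ := exists_lintegral_refineErr_fracKer_le (m := m) hγ0 hγ hα hα' hθ
    (by linarith)
  refine exists_exp_le_measure_dyadic hγ0 (by linarith) hC m (fracInt θ X)
    (fun ι _ t ht => hX.fracInt_family hγ0 hγ hα hα' hθ ht) fun n k b i hk v hv => ?_
  obtain ⟨w, hw, hw2⟩ := hX.exists_map_sum_fracInt_eq hγ0 hγ hα hα' hθ
    (t := fun o : Option (Fin (m + 1)) => (k + o.elim (childNode m b i) (refNode m)) / 2 ^ n)
    (fun o => add_div_two_pow_mem hk (by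
      cases o
      exacts [childNode_mem m b i, refNode_mem m _]))
    (fun o => o.elim 1 (fun j => -refBasis m j (childNode m b i)))
  have hvw : v = w := (gaussianReal_ext_iff.1 (hv.symm.trans ((congrArg (Measure.map · P)
    (funext fun ω => refineErr_eq_sum m (fun t => fracInt θ X t ω) n k b i)).trans hw))).2
  rw [hvw, ← ENNReal.ofReal_le_ofReal_iff (by positivity)]
  refine le_trans ?_ (hC' n k b i)
  simp_rw [refineErr_eq_sum]
  rw [hw2, ← Real.enorm_of_nonneg
    (integral_nonneg fun u => mul_nonneg (sq_nonneg _) (by positivity))]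
  refine (enorm_integral_le_lintegral_enorm _).trans_eq (lintegral_congr fun u => ?_)
  exact Real.enorm_of_nonneg (mul_nonneg (sq_nonneg _) (by positivity))

end

/-- A bounded log-concave function on the half line has increments controlled by its lower
bounds. -/
theorem sub_log_le_of_logConcave {φ : ℝ → ℝ} {C p : ℝ} (hC : 0 < C) (hp : 0 ≤ p)
    (hφ : ∀ x, 0 < x → rexp (-(C * x ^ (-p))) ≤ φ x) (hφ1 : ∀ x, φ x ≤ 1)
    (hconc : ∀ a b r s : ℝ, 0 < a → 0 < b → a + b = 1 →
      φ r ^ a * φ s ^ b ≤ φ (a * r + b * s)) {ε x y : ℝ} (hε : 0 < ε) (hx : ε / 2 ≤ x)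
    (hxy : x ≤ y) :
    Real.log (φ y) - Real.log (φ x) ≤ 4 * C * 4 ^ p * (y - x) / ε ^ (1 + p) := by
  rcases hxy.eq_or_lt with rfl | hxy
  · simp
  have hx0 : 0 < x := by linarith
  have hpos : ∀ z, 0 < z → 0 < φ z := fun z hz => (exp_pos _).trans_le (hφ z hz)
  have hlow : -Real.log (φ (x / 2)) ≤ C * (4 ^ p * ε ^ (-p)) := by
    have h1 := (Real.le_log_iff_exp_le (hpos _ (half_pos hx0))).2 (hφ _ (half_pos hx0))
    have h2 : (x / 2) ^ (-p) ≤ (ε / 4) ^ (-p) :=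
      Real.rpow_le_rpow_of_nonpos (by positivity) (by linarith) (by linarith)
    rw [Real.div_rpow hε.le (by norm_num), Real.rpow_neg (by norm_num : (0 : ℝ) ≤ 4),
      div_inv_eq_mul,
      mul_comm] at h2
    nlinarith [mul_le_mul_of_nonneg_left h2 hC.le]
  have hd : 0 < y - x / 2 := by linarith
  have hd' : y * 2 - x ≠ 0 := (by linarith : 0 < y * 2 - x).ne'
  set a := (y - x) / (y - x / 2) with ha
  set b := x / 2 / (y - x / 2) with hb
  have ha0 : 0 < a := div_pos (by linarith) hd
  have hb0 : 0 < b := div_pos (by linarith) hd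
  have hab : a + b = 1 := by rw [ha, hb]; field_simp; ring
  have hc := hconc a b (x / 2) y ha0 hb0 hab
  rw [show a * (x / 2) + b * y = x by rw [ha, hb]; field_simp; ring] at hc
  have hφx2 := hpos _ (half_pos hx0)
  have hφy := hpos y (hx0.trans hxy)
  have hlog := Real.log_le_log (by positivity) hc
  rw [Real.log_mul (by positivity) (by positivity), Real.log_rpow hφx2, Real.log_rpow hφy] at hlog
  have hx1 : Real.log (φ x) ≤ 0 := Real.log_nonpos (hpos x hx0).le (hφ1 x)
  have h3 : b * (Real.log (φ y) - Real.log (φ x)) ≤ a * (C * (4 ^ p * ε ^ (-p))) := by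
    have : b = 1 - a := by linarith
    nlinarith [mul_le_mul_of_nonneg_left hlow ha0.le, mul_nonneg ha0.le (neg_nonneg.2 hx1)]
  have hD : 0 ≤ C * (4 ^ p * ε ^ (-p)) := by positivity
  have h4 : Real.log (φ y) - Real.log (φ x) ≤ (y - x) / (x / 2) * (C * (4 ^ p * ε ^ (-p))) := by
    rw [show (y - x) / (x / 2) = a / b by rw [ha, hb]; field_simp, div_mul_eq_mul_div,
      le_div_iff₀ hb0, mul_comm]
    exact h3
  refine h4.trans ?_
  have h5 : (y - x) / (x / 2) ≤ (y - x) / (ε / 4) :=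
    div_le_div_of_nonneg_left (by linarith) (by positivity) (by linarith)
  refine (mul_le_mul_of_nonneg_right h5 hD).trans_eq ?_
  rw [Real.rpow_add hε, Real.rpow_one, Real.rpow_neg hε.le]
  field_simp

theorem ratio_bounds_of_logConcave {φ : ℝ → ℝ} {C p : ℝ} (hC : 0 < C) (hp : 0 ≤ p)
    (hφ : ∀ x, 0 < x → rexp (-(C * x ^ (-p))) ≤ φ x) (hφ1 : ∀ x, φ x ≤ 1) (hmono : Monotone φ)
    (hconc : ∀ a b r s : ℝ, 0 < a → 0 < b → a + b = 1 →
      φ r ^ a * φ s ^ b ≤ φ (a * r + b * s)) {ε μ : ℝ} (hε : 0 < ε) (hμ : ε / 2 < μ) :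
    rexp (-(4 * C * 4 ^ p) * |μ - ε| / ε ^ (1 + p)) ≤ φ μ / φ ε ∧
      φ μ / φ ε ≤ rexp (4 * C * 4 ^ p * |μ - ε| / ε ^ (1 + p)) := by
  have hpos : ∀ z, 0 < z → 0 < φ z := fun z hz => (exp_pos _).trans_le (hφ z hz)
  have hμ0 : 0 < μ := by linarith
  have hr : φ μ / φ ε = rexp (Real.log (φ μ) - Real.log (φ ε)) := by
    rw [Real.exp_sub, Real.exp_log (hpos _ hμ0), Real.exp_log (hpos _ hε)]
  rw [hr, Real.exp_le_exp, Real.exp_le_exp, neg_mul, neg_div, ← abs_le]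
  rcases le_total ε μ with h | h
  · rw [abs_of_nonneg (sub_nonneg.2 h),
      abs_of_nonneg (sub_nonneg.2 (Real.log_le_log (hpos _ hε) (hmono h)))]
    exact sub_log_le_of_logConcave hC hp hφ hφ1 hconc hε (by linarith) h
  · rw [abs_sub_comm μ, abs_sub_comm (Real.log _), abs_of_nonneg (sub_nonneg.2 h),
      abs_of_nonneg (sub_nonneg.2 (Real.log_le_log (hpos _ hμ0) (hmono h)))]
    exact sub_log_le_of_logConcave hC hp hφ hφ1 hconc hε hμ.le h

theorem ContinuousOn.abs_le_iff_dyadic {f : ℝ → ℝ} (hf : ContinuousOn f (Icc 0 1)) {r : ℝ} :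
    (∀ s ∈ Icc (0 : ℝ) 1, |f s| ≤ r) ↔ ∀ N k : ℕ, k < 2 ^ N → |f (k / 2 ^ N)| ≤ r := by
  refine ⟨fun h N k hk => h _ ?_, fun h => ?_⟩
  · simpa using add_div_two_pow_mem hk (left_mem_Icc.2 zero_le_one)
  have hIco : ∀ s ∈ Ico (0 : ℝ) 1, |f s| ≤ r := by
    intro s hs
    have hk : ∀ N : ℕ, ⌊s * 2 ^ N⌋₊ < 2 ^ N := fun N => by
      rw [Nat.floor_lt (mul_nonneg hs.1 (by positivity))]
      push_cast
      exact mul_lt_of_lt_one_left (by positivity) hs.2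
    have h1 : Tendsto (fun N : ℕ => (⌊s * 2 ^ N⌋₊ : ℝ) / 2 ^ N) atTop (𝓝 s) :=
      (tendsto_nat_floor_mul_div_atTop hs.1).comp (tendsto_pow_atTop_atTop_of_one_lt one_lt_two)
    have h2 : Tendsto (fun N : ℕ => f (⌊s * 2 ^ N⌋₊ / 2 ^ N)) atTop (𝓝 (f s)) :=
      (hf s (Ico_subset_Icc_self hs)).tendsto.comp (tendsto_nhdsWithin_iff.2
        ⟨h1, Eventually.of_forall fun N => by
          simpa using add_div_two_pow_mem (hk N) (left_mem_Icc.2 zero_le_one)⟩)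
    exact le_of_tendsto' h2.abs fun N => h N _ (hk N)
  intro s hs
  rcases hs.2.eq_or_lt with rfl | hs1
  · have hcl : (1 : ℝ) ∈ closure (Ico (0 : ℝ) 1) := by
      rw [closure_Ico zero_ne_one]; exact right_mem_Icc.2 zero_le_one
    exact ContinuousWithinAt.closure_le hcl ((hf.abs 1 hs).mono Ico_subset_Icc_self)
      continuousWithinAt_const hIco
  · exact hIco s ⟨hs.1, hs1⟩

section
variable {Ω : Type*} {Z : ℝ → Ω → ℝ}

theorem runSup_one_le_iff {ω : Ω} (hc : ContinuousOn (fun t => Z t ω) (Icc 0 1)) {r : ℝ} :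
    runSup Z 1 ω ≤ r ↔ ∀ N k : ℕ, k < 2 ^ N → |Z (k / 2 ^ N) ω| ≤ r := by
  rw [← hc.abs_le_iff_dyadic]
  obtain ⟨B, hB⟩ := isCompact_Icc.exists_bound_of_continuousOn hc
  have hbdd : BddAbove (range fun s : Icc (0 : ℝ) 1 => |Z s.1 ω|) :=
    ⟨B, by rintro _ ⟨s, rfl⟩; exact hB s s.2⟩
  have : Nonempty (Icc (0 : ℝ) 1) := ⟨⟨0, left_mem_Icc.2 zero_le_one⟩⟩
  rw [runSup, ciSup_le_iff hbdd]
  exact Subtype.forall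

theorem antitone_dyadic_event (Z : ℝ → Ω → ℝ) (r : ℝ) :
    Antitone fun N : ℕ => {ω | ∀ k : ℕ, k < 2 ^ N → |Z (k / 2 ^ N) ω| ≤ r} := by
  refine antitone_nat_of_succ_le fun N ω h k hk => ?_
  have := h (2 * k) (by rw [pow_succ]; omega)
  rwa [pow_succ, Nat.cast_mul, Nat.cast_two, mul_comm (2 : ℝ), mul_div_mul_right _ _ two_ne_zero]
    at this

variable [MeasurableSpace Ω] {P : Measure Ω} [IsProbabilityMeasure P]

theorem tendsto_measure_dyadic_event (hc : ∀ ω, ContinuousOn (fun t => Z t ω) (Icc 0 1))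
    (hm : ∀ t ∈ Icc (0 : ℝ) 1, AEMeasurable (Z t) P) (r : ℝ) :
    Tendsto (fun N : ℕ => P {ω | ∀ k : ℕ, k < 2 ^ N → |Z (k / 2 ^ N) ω| ≤ r}) atTop
      (𝓝 (P {ω | runSup Z 1 ω ≤ r})) := by
  have e : {ω | runSup Z 1 ω ≤ r} = ⋂ N : ℕ, {ω | ∀ k : ℕ, k < 2 ^ N → |Z (k / 2 ^ N) ω| ≤ r} := by
    ext ω
    rw [mem_ofPred_eq, runSup_one_le_iff (hc ω), mem_iInter]
    rfl
  rw [e]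
  refine tendsto_measure_iInter_atTop (fun N => ?_) (antitone_dyadic_event Z r)
    ⟨0, measure_ne_top _ _⟩
  simp only [ofPred_forall]
  refine NullMeasurableSet.iInter fun k => NullMeasurableSet.iInter fun hk => ?_
  refine nullMeasurableSet_le (AEMeasurable.abs (hm _ ?_)) aemeasurable_const
  simpa using add_div_two_pow_mem hk (left_mem_Icc.2 zero_le_one)

theorem smallBall_rpow_mul_rpow_le (hc : ∀ ω, ContinuousOn (fun t => Z t ω) (Icc 0 1))
    (hG : ∀ (ι : Type) [Fintype ι] (t : ι → ℝ), (∀ i, t i ∈ Icc (0 : ℝ) 1) →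
      IsCenteredGaussianFamily P (fun i => Z (t i))) {a b : ℝ} (ha : 0 < a) (hb : 0 < b)
    (hab : a + b = 1) (r s : ℝ) :
    smallBall P Z r ^ a * smallBall P Z s ^ b ≤ smallBall P Z (a * r + b * s) := by
  have hm : ∀ t ∈ Icc (0 : ℝ) 1, AEMeasurable (Z t) P := fun t ht =>
    (hG Unit (fun _ => t) fun _ => ht).aemeasurable ()
  have hle : ∀ (x : ℝ) (N : ℕ), P {ω | runSup Z 1 ω ≤ x} ≤
      P {ω | ∀ k : ℕ, k < 2 ^ N → |Z (k / 2 ^ N) ω| ≤ x} := fun x N =>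
    measure_mono fun ω h => (runSup_one_le_iff (hc ω)).1 h N
  rw [smallBall, smallBall, smallBall, ENNReal.toReal_rpow, ENNReal.toReal_rpow,
    ← ENNReal.toReal_mul]
  refine ENNReal.toReal_mono (measure_ne_top _ _) ?_
  refine ge_of_tendsto' (tendsto_measure_dyadic_event hc hm _) fun N => ?_
  have h := (hG (Fin (2 ^ N)) (fun k => (k : ℕ) / 2 ^ N) fun k => by
    simpa using add_div_two_pow_mem k.2 (left_mem_Icc.2 zero_le_one)).measure_abs_le_rpow_mul_le
      ha hb hab r s
  simp only [Fin.forall_iff] at h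
  exact (mul_le_mul' (ENNReal.rpow_le_rpow (hle r N) ha.le)
    (ENNReal.rpow_le_rpow (hle s N) hb.le)).trans h

theorem monotone_smallBall (P : Measure Ω) [IsProbabilityMeasure P] (Z : ℝ → Ω → ℝ) :
    Monotone (smallBall P Z) := fun _ _ h =>
  ENNReal.toReal_mono (measure_ne_top _ _) (measure_mono fun _ hω => le_trans hω h)

end

end

/-- Two-sided ratio bound for the small ball function `φ`. -/
theorem smallBall_ratio_bound
    {Ω : Type*} [MeasurableSpace Ω] (P : Measure Ω) [IsProbabilityMeasure P]
    (γ α θ H β : ℝ) (hγ : γ ∈ Set.Ico (0:ℝ) 1)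
    (hα : α ∈ Set.Ioo (-1/2 + γ/2) (1/2)) (hθ : 0 < θ)
    (hH : H = α - γ/2 + 1/2) (hβ : β = α + θ + 1/2)
    (X : ℝ → Ω → ℝ) (hX : IsGFBM P α γ X)
    (Y : ℝ → Ω → ℝ) (hY : Y = fracInt θ X)
    (φ : ℝ → ℝ) (hφ : φ = smallBall P Y) :
    ∃ K₂ : ℝ, 0 < K₂ ∧ ∃ K₃ : ℝ, 0 < K₃ ∧
      ∀ ε : ℝ, 0 < ε → ε < 2 / K₂ → ∀ μ : ℝ, ε / 2 < μ →
        Real.exp (-K₃ * |μ - ε| / ε ^ (1 + 1/β)) ≤ φ μ / φ ε ∧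
        φ μ / φ ε ≤ Real.exp (K₃ * |μ - ε| / ε ^ (1 + 1/β)) := by
  obtain ⟨hγ0, hγ1⟩ := hγ
  obtain ⟨hα0, hα1⟩ := hα
  have hβ0 : 0 < β := by linarith
  subst hY hφ
  have hc := hX.continuousOn_fracInt hθ
  have hG : ∀ (ι : Type) [Fintype ι] (t : ι → ℝ), (∀ i, t i ∈ Icc (0 : ℝ) 1) →
      IsCenteredGaussianFamily P (fun i => fracInt θ X (t i)) := fun ι _ t ht =>
    hX.fracInt_family hγ0 hγ1 hα0 hα1 hθ ht
  obtain ⟨C, hC, hlow⟩ := hX.exists_exp_le_measure_fracInt_dyadic hγ0 hγ1 hα0 hα1 hθ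
  refine ⟨2, two_pos, 4 * C * 4 ^ (1 / β), by positivity, fun ε hε _ μ hμ =>
    ratio_bounds_of_logConcave hC (by positivity) (fun x hx => ?_)
      (fun x => ENNReal.toReal_le_of_le_ofReal zero_le_one (by simpa using prob_le_one))
      (monotone_smallBall P _)
      (fun a b r s ha hb hab => smallBall_rpow_mul_rpow_le hc hG ha hb hab r s) hε hμ⟩
  rw [← ENNReal.ofReal_le_iff_le_toReal (measure_ne_top _ _), ← neg_div, hβ]
  exact ge_of_tendsto' (tendsto_measure_dyadic_event hc (fun t ht =>
    (hG Unit (fun _ => t) fun _ => ht).aemeasurable ()) x) (hlow x hx)
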